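/- arXiv:2409.18206 — 15 statements merged into one kernel-verified Lean document; each statement's English description precedes it below -/
import Mathlib

section
/- Let k_x, k_y be nonnegative integers with max(k_x,k_y) ≥ 1. Then the dimension, as a vector space over ZMod 3, of the quotient ring (ZMod 3)[x,y] / (f, x^(3^k_x) − 1, y^(3^k_y) − 1) equals 2 · 3^(min(k_x,k_y)). -/
open MvPolynomial

theorem add_pow_three_pow {A : Type*} [CommRing A] [Algebra (ZMod 3) A] (a b : A) (k : ℕ) :
    (a + b) ^ 3 ^ k = a ^ 3 ^ k + b ^ 3 ^ k := by
  nontriviality A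
  have := charP_of_injective_algebraMap (algebraMap (ZMod 3) A).injective 3
  exact add_pow_char_pow a b 3 k

theorem three_eq_zero_of_algebra {A : Type*} [CommRing A] [Algebra (ZMod 3) A] : (3 : A) = 0 := by
  rw [← map_ofNat (algebraMap (ZMod 3) A) 3, show (OfNat.ofNat 3 : ZMod 3) = 0 from rfl, map_zero]

theorem pow_three_pow_eq_one_of_laplacian_eq_zero {A : Type*} [CommRing A] [Algebra (ZMod 3) A]
    {x y : A} {m n : ℕ} (hmn : m ≤ n) (hn : 1 ≤ n)
    (hf : x ^ 2 * y + x * y ^ 2 + x ^ 2 + y ^ 2 + x + y - 6 * x * y = 0)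
    (hx : x ^ 3 ^ m = 1) : y ^ 3 ^ n = 1 := by
  have h3 : (3 : A) = 0 := three_eq_zero_of_algebra
  obtain ⟨u, rfl⟩ : ∃ u, x = u + 1 := ⟨x - 1, by ring⟩
  obtain ⟨v, rfl⟩ : ∃ v, y = v + 1 := ⟨y - 1, by ring⟩
  rw [add_pow_three_pow, one_pow, add_eq_right] at hx ⊢
  obtain ⟨c, hc⟩ : ∃ c, 3 ^ n = c + 1 :=
    Nat.exists_eq_add_one.2 (by positivity)
  have hc0 : c ≠ 0 := by
    rintro rfl
    have := Nat.one_lt_pow (n := n) (by omega) (show 1 < 3 by simp)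
    omega
  have hu : u ^ (c + 1) = 0 := by
    rw [← hc]
    exact pow_eq_zero_of_le (Nat.pow_le_pow_right (by simp) hmn) hx
  have hsq : (u + v) * (u + v) = u * v * (u + v) := by
    linear_combination -hf + (u ^ 2 + v ^ 2) * h3
  have hpow (k : ℕ) : (u + v) ^ (k + 1) = (u * v) ^ k * (u + v) := by
    induction k with
    | zero => simp
    | succ k ih => rw [pow_succ, ih, mul_assoc, hsq]; ring
  have hv := add_pow_three_pow u v n
  rw [hc, hpow, hu] at hv
  have hunit : IsUnit (1 - u ^ c) := IsNilpotent.isUnit_one_sub (.pow_of_pos ⟨c + 1, hu⟩ hc0)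
  rw [hc, ← hunit.mul_right_eq_zero]
  linear_combination -hv + v ^ c * hu

theorem add_one_mul_neg_pow_eq_one {A : Type*} [CommRing A] [Algebra (ZMod 3) A]
    {x : A} {m : ℕ} (hx : x ^ 3 ^ m = 1) : (x + 1) * -(x + 1) ^ (3 ^ m - 1) = 1 := by
  rw [mul_neg, mul_pow_sub_one (by positivity), add_pow_three_pow, hx, one_pow]
  linear_combination -three_eq_zero_of_algebra (A := A)

/-- The group algebra `(ZMod 3)[x] / (x ^ 3 ^ m - 1)` of a cyclic group of order `3 ^ m`. -/
abbrev CyclicAlgebra (m : ℕ) : Type :=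
  AdjoinRoot (Polynomial.X ^ 3 ^ m - 1 : Polynomial (ZMod 3))

namespace CyclicAlgebra

theorem root_pow (m : ℕ) :
    (AdjoinRoot.root _ : CyclicAlgebra m) ^ 3 ^ m = 1 := by
  have := AdjoinRoot.eval₂_root (Polynomial.X ^ 3 ^ m - 1 : Polynomial (ZMod 3))
  simpa [sub_eq_zero] using this

/-- The inverse of `x + 1` in `(ZMod 3)[x] / (x ^ 3 ^ m - 1)`. -/
noncomputable def invRootAddOne (m : ℕ) : CyclicAlgebra m :=
  -(AdjoinRoot.root _ + 1) ^ (3 ^ m - 1)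

/-- The Laplacian as a quadratic in `y` over `(ZMod 3)[x] / (x ^ 3 ^ m - 1)`, divided by its leading
coefficient `x + 1`. -/
noncomputable def laplacian (m : ℕ) : Polynomial (CyclicAlgebra m) :=
  Polynomial.X ^ 2
    + Polynomial.C (invRootAddOne m * (AdjoinRoot.root _ ^ 2 + 1)) * Polynomial.X
    + Polynomial.C (invRootAddOne m * (AdjoinRoot.root _ ^ 2 + AdjoinRoot.root _))

theorem natDegree_cyclic (m : ℕ) :
    (Polynomial.X ^ 3 ^ m - 1 : Polynomial (ZMod 3)).natDegree = 3 ^ m :=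
  Polynomial.natDegree_X_pow_sub_C (r := (1 : ZMod 3))

theorem monic_cyclic (m : ℕ) : (Polynomial.X ^ 3 ^ m - 1 : Polynomial (ZMod 3)).Monic :=
  Polynomial.monic_X_pow_sub_C (1 : ZMod 3) (by positivity)

instance (m : ℕ) : Nontrivial (CyclicAlgebra m) :=
  AdjoinRoot.nontrivial _ <|
    Polynomial.degree_ne_of_natDegree_ne <| by
      rw [natDegree_cyclic]
      exact pow_ne_zero m three_ne_zero

theorem natDegree_laplacian (m : ℕ) : (laplacian m).natDegree = 2 := by
  unfold laplacian
  compute_degree!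

theorem monic_laplacian (m : ℕ) : (laplacian m).Monic := by
  unfold laplacian
  monicity!

theorem finrank_adjoinRoot_laplacian (m : ℕ) :
    Module.finrank (ZMod 3) (AdjoinRoot (laplacian m)) = 2 * 3 ^ m := by
  have h₁ := (AdjoinRoot.powerBasis' (monic_cyclic m)).finrank
  have h₂ := (AdjoinRoot.powerBasis' (monic_laplacian m)).finrank
  rw [AdjoinRoot.powerBasis'_dim, natDegree_cyclic] at h₁
  rw [AdjoinRoot.powerBasis'_dim, natDegree_laplacian] at h₂
  have : Module.Free (CyclicAlgebra m) (AdjoinRoot (laplacian m)) :=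
    .of_basis (AdjoinRoot.powerBasis' (monic_laplacian m)).basis
  rw [← Module.finrank_mul_finrank (ZMod 3) (CyclicAlgebra m), h₁, h₂, mul_comm]

theorem root_add_one_mul_inv (m : ℕ) : (AdjoinRoot.root _ + 1) * invRootAddOne m = 1 :=
  add_one_mul_neg_pow_eq_one (root_pow m)

theorem eval₂_laplacian {A : Type*} [CommRing A] [Algebra (ZMod 3) A] {m : ℕ}
    (φ : CyclicAlgebra m →ₐ[ZMod 3] A) {x : A} (hx : φ (AdjoinRoot.root _) = x) (y : A) :
    (laplacian m).eval₂ φ y = φ (invRootAddOne m) *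
      (x ^ 2 * y + x * y ^ 2 + x ^ 2 + y ^ 2 + x + y - 6 * x * y) := by
  have hinv := congrArg φ (root_add_one_mul_inv m)
  have h3 : (3 : A) = 0 := three_eq_zero_of_algebra
  subst hx
  simp only [map_mul, map_add, map_one] at hinv
  simp only [laplacian, Polynomial.eval₂_add, Polynomial.eval₂_mul, Polynomial.eval₂_pow,
    Polynomial.eval₂_X, Polynomial.eval₂_C, Polynomial.eval₂_one, RingHom.coe_coe,
    map_mul, map_add, map_pow, map_one]
  linear_combination -y ^ 2 * hinv
    + 2 * φ (invRootAddOne m) * φ (AdjoinRoot.root _) * y * h3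

end CyclicAlgebra

open CyclicAlgebra

/-- The ideal generated by the Laplacian, `x ^ 3 ^ m - 1` and `y ^ 3 ^ n - 1`, where `x = X i` and
`y = X j`. -/
noncomputable abbrev laplacianIdeal (i j : Fin 2) (m n : ℕ) :
    Ideal (MvPolynomial (Fin 2) (ZMod 3)) :=
  Ideal.span {X i ^ 2 * X j + X i * X j ^ 2 + X i ^ 2 + X j ^ 2 + X i + X j - 6 * X i * X j,
    X i ^ 3 ^ m - 1, X j ^ 3 ^ n - 1}

theorem exists_algEquiv_adjoinRoot_laplacian {i j : Fin 2} (hij : i ≠ j) {m n : ℕ} (hmn : m ≤ n)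
    (hn : 1 ≤ n) :
    Nonempty ((MvPolynomial (Fin 2) (ZMod 3) ⧸ laplacianIdeal i j m n) ≃ₐ[ZMod 3]
      AdjoinRoot (laplacian m)) := by
  let I := laplacianIdeal i j m n
  let x : AdjoinRoot (laplacian m) := AdjoinRoot.of _ (AdjoinRoot.root _)
  let y : AdjoinRoot (laplacian m) := AdjoinRoot.root _
  have hx : x ^ 3 ^ m = 1 := by rw [← map_pow, root_pow, map_one]
  have hxinv : (x + 1) * AdjoinRoot.of _ (invRootAddOne m) = 1 := by
    rw [← map_one (AdjoinRoot.of (laplacian m)), ← map_add, ← map_mul, root_add_one_mul_inv]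
  have hf : x ^ 2 * y + x * y ^ 2 + x ^ 2 + y ^ 2 + x + y - 6 * x * y = 0 := by
    have h : AdjoinRoot.of _ (invRootAddOne m) * _ = 0 :=
      (eval₂_laplacian (AdjoinRoot.ofAlgHom (ZMod 3) (laplacian m)) (x := x) rfl y).symm.trans
        (AdjoinRoot.eval₂_root (laplacian m))
    exact (IsUnit.of_mul_eq_one_right _ hxinv).mul_right_eq_zero.1 h
  have hy : y ^ 3 ^ n = 1 := pow_three_pow_eq_one_of_laplacian_eq_zero hmn hn hf hx
  let v : Fin 2 → AdjoinRoot (laplacian m) := fun k => if k = i then x else y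
  have hvi : v i = x := if_pos rfl
  have hvj : v j = y := if_neg hij.symm
  let F : (MvPolynomial (Fin 2) (ZMod 3) ⧸ I) →ₐ[ZMod 3] AdjoinRoot (laplacian m) :=
    Ideal.Quotient.liftₐ I (aeval v) <| by
      suffices h : I ≤ RingHom.ker (aeval (R := ZMod 3) v) from fun a ha => h ha
      refine Ideal.span_le.2 ?_
      rintro p (rfl | rfl | rfl)
      · simpa [hvi, hvj] using hf
      · simp [hvi, hx]
      · simp [hvj, hy]
  let q := Ideal.Quotient.mkₐ (ZMod 3) I
  have hq {p} (hp : p ∈ I) : q p = 0 := Ideal.Quotient.eq_zero_iff_mem.2 hp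
  let G₀ : CyclicAlgebra m →ₐ[ZMod 3] (MvPolynomial (Fin 2) (ZMod 3) ⧸ I) :=
    AdjoinRoot.liftAlgHom _ (Algebra.ofId _ _) (q (X i)) <| by
      have h : q (X i ^ 3 ^ m - 1) = 0 := hq (Ideal.subset_span (by simp))
      rw [map_sub, map_pow, map_one] at h
      simpa using h
  have hG₀ : G₀ (AdjoinRoot.root _) = q (X i) := AdjoinRoot.liftAlgHom_root ..
  let G : AdjoinRoot (laplacian m) →ₐ[ZMod 3] (MvPolynomial (Fin 2) (ZMod 3) ⧸ I) :=
    AdjoinRoot.liftAlgHom _ G₀ (q (X j)) <| by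
      have h := hq (Ideal.subset_span (Set.mem_insert _ _))
      simp only [map_add, map_sub, map_mul, map_pow, map_ofNat] at h
      rw [eval₂_laplacian G₀ hG₀, h, mul_zero]
  have hGx : G x = q (X i) := (AdjoinRoot.liftAlgHom_of ..).trans hG₀
  have hGy : G y = q (X j) := AdjoinRoot.liftAlgHom_root ..
  have hFi : F (q (X i)) = x := (aeval_X v i).trans hvi
  have hFj : F (q (X j)) = y := (aeval_X v j).trans hvj
  refine ⟨AlgEquiv.ofAlgHom F G ?_ ?_⟩
  · refine AdjoinRoot.algHom_ext' (AdjoinRoot.algHom_ext ?_) ?_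
    · exact (congrArg F hGx).trans hFi
    · exact (congrArg F hGy).trans hFj
  · refine Ideal.Quotient.algHom_ext _ (MvPolynomial.algHom_ext fun k => ?_)
    obtain rfl | rfl : k = i ∨ k = j := by omega
    · exact (congrArg G hFi).trans hGx
    · exact (congrArg G hFj).trans hGy

theorem finrank_quotient_laplacianIdeal {i j : Fin 2} (hij : i ≠ j) {m n : ℕ} (hmn : m ≤ n)
    (hn : 1 ≤ n) :
    Module.finrank (ZMod 3) (MvPolynomial (Fin 2) (ZMod 3) ⧸ laplacianIdeal i j m n) =
      2 * 3 ^ m := by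
  obtain ⟨e⟩ := exists_algEquiv_adjoinRoot_laplacian hij hmn hn
  rw [e.toLinearEquiv.finrank_eq, finrank_adjoinRoot_laplacian]

theorem laplacianIdeal_swap (i j : Fin 2) (m n : ℕ) :
    laplacianIdeal i j m n = laplacianIdeal j i n m := by
  have h : (X i ^ 2 * X j + X i * X j ^ 2 + X i ^ 2 + X j ^ 2 + X i + X j - 6 * X i * X j :
      MvPolynomial (Fin 2) (ZMod 3)) =
      X j ^ 2 * X i + X j * X i ^ 2 + X j ^ 2 + X i ^ 2 + X j + X i - 6 * X j * X i := by
    ring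
  rw [laplacianIdeal, h, Set.pair_comm]


/-- The dimension over `ZMod 3` of the quotient of `(ZMod 3)[x,y]` by the ideal generated
by the triangular-lattice Laplacian polynomial
`f = x²y + xy² + x² + y² + x + y - 6xy`, `x^(3^kx) - 1`, and `y^(3^ky) - 1`
equals `2 · 3^(min kx ky)`, provided `max kx ky ≥ 1`. -/
theorem triangular_laplacian_gsd_mod_three (kx ky : ℕ) (hk : 1 ≤ max kx ky) :
    Module.finrank (ZMod 3)
      (MvPolynomial (Fin 2) (ZMod 3) ⧸
        Ideal.span {(X 0 ^ 2 * X 1 + X 0 * X 1 ^ 2 + X 0 ^ 2 + X 1 ^ 2 + X 0 + X 1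
            - 6 * X 0 * X 1 : MvPolynomial (Fin 2) (ZMod 3)),
          X 0 ^ 3 ^ kx - 1, X 1 ^ 3 ^ ky - 1}) = 2 * 3 ^ min kx ky := by
  rcases le_total kx ky with h | h
  · rw [min_eq_left h]
    exact finrank_quotient_laplacianIdeal (by decide) h (max_eq_right h ▸ hk)
  · rw [min_eq_right h]
    have := finrank_quotient_laplacianIdeal (i := 1) (j := 0) (by decide) h (max_eq_left h ▸ hk)
    rwa [laplacianIdeal_swap] at this
end

section
/- Let p be a prime with p > 3 and let k_x, k_y be nonnegative integers. Then the dimension, as a vector space over ZMod p, of the quotient ring (ZMod p)[x,y] / (f, x^(p^k_x) − 1, y^(p^k_y) − 1) equals 2 · p^(min(k_x,k_y)) − 1 if k_x = k_y, and 2 · p^(min(k_x,k_y)) if k_x ≠ k_y. -/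
/-- On the curve `2(u² - uv + v²) + uv(u + v) = 0`, the powers of `v` agree to leading order with
`s u + t v` times a power of `u`, where `(s, t)` follows the recursion of `v² = uv - u²`. -/
theorem pow_succ_of_tangent_relation {R : Type*} [CommRing R] {u v w : R} (hw : w * (2 + u) = 1)
    (h : 2 * (u ^ 2 - u * v + v ^ 2) + u * v * (u + v) = 0) (n : ℕ) :
    ∃ (s t : ℤ) (a b : R), v ^ (n + 1) = u ^ n * ((s + a * u) * u + (t + b * u) * v) ∧
      (n % 3 = 0 ∧ s = 0 ∧ IsUnit t ∨ n % 3 = 1 ∧ s = -t ∧ IsUnit t ∨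
        n % 3 = 2 ∧ t = 0 ∧ IsUnit s) := by
  have hv : v ^ 2 = u * v * (1 - 2 * w * u) - u ^ 2 * (1 - w * u) := by
    linear_combination w * h - (v ^ 2 - u * v + u ^ 2) * hw
  induction n with
  | zero => exact ⟨0, 1, 0, 0, by simp, by simp⟩
  | succ n ih =>
    obtain ⟨s, t, a, b, h₁, h₂⟩ := ih
    refine ⟨-t, s + t, -b + w * (t + b * u), a + b - 2 * w * (t + b * u), ?_, ?_⟩
    · rw [pow_succ v, h₁]
      push_cast
      linear_combination u ^ n * (t + b * u) * hv
    · rcases h₂ with ⟨h, rfl, ht⟩ | ⟨h, rfl, ht⟩ | ⟨h, rfl, hs⟩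
      · exact Or.inr (Or.inl ⟨by omega, by simp, by simpa⟩)
      · exact Or.inr (Or.inr ⟨by omega, by simp, by simpa⟩)
      · exact Or.inl ⟨by omega, by simp, by simpa⟩

universe u

section

open Polynomial

/-- The algebra `k[u] / (u ^ q)`, described by its universal property. -/
theorem exists_truncated_polynomial_algebra (k : Type u) [Field k] {q : ℕ} (hq : 0 < q) :
    ∃ (B : Type u) (_ : CommRing B) (_ : Algebra k B) (u : B),
      Module.Finite k B ∧ Module.finrank k B = q ∧ u ^ q = 0 ∧ u ^ (q - 1) ≠ 0 ∧
      Algebra.adjoin k {u} = ⊤ ∧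
      ∀ (D : Type u) [CommRing D] [Algebra k D] (x : D), x ^ q = 0 →
        ∃ φ : B →ₐ[k] D, φ u = x := by
  have hmon : (X ^ q : k[X]).Monic := monic_X_pow q
  refine ⟨AdjoinRoot (X ^ q : k[X]), inferInstance, inferInstance, AdjoinRoot.root _,
    hmon.finite_adjoinRoot, ?_, ?_, ?_, AdjoinRoot.adjoinRoot_eq_top, ?_⟩
  · rw [(AdjoinRoot.powerBasis' hmon).finrank]
    simp
  · simpa using AdjoinRoot.eval₂_root (X ^ q : k[X])
  · intro h
    have h' : AdjoinRoot.mk (X ^ q : k[X]) (X ^ (q - 1)) = 0 := by simpa using h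
    rw [AdjoinRoot.mk_eq_zero, pow_dvd_pow_iff X_ne_zero not_isUnit_X] at h'
    omega
  · intro D _ _ x hx
    exact ⟨AdjoinRoot.liftAlgHom _ (Algebra.ofId k D) x (by simpa using hx),
      AdjoinRoot.liftAlgHom_root ..⟩

/-- The algebra `B[v] / (v² + b v + c)`, described by its universal property. -/
theorem exists_monic_quadratic_extension (k : Type u) [CommRing k] {B : Type u} [CommRing B]
    [Nontrivial B] [Algebra k B] (b c : B) :
    ∃ (A : Type u) (_ : CommRing A) (_ : Algebra k A) (_ : Algebra B A)
      (_ : IsScalarTower k B A) (v : A),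
      Module.Finite B A ∧ Module.Free B A ∧ Module.finrank B A = 2 ∧
      v ^ 2 + algebraMap B A b * v + algebraMap B A c = 0 ∧
      (∀ r : B, algebraMap B A r * v = 0 → r = 0) ∧ Algebra.adjoin B {v} = ⊤ ∧
      ∀ (D : Type u) [CommRing D] [Algebra k D] (φ : B →ₐ[k] D) (y : D),
        y ^ 2 + φ b * y + φ c = 0 →
        ∃ ψ : A →ₐ[k] D, (∀ r, ψ (algebraMap B A r) = φ r) ∧ ψ v = y := by
  obtain ⟨g, hgdef⟩ : ∃ g : B[X], g = X ^ 2 + C b * X + C c := ⟨_, rfl⟩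
  have hg : g.Monic := by rw [hgdef]; monicity!
  have hgd : g.natDegree = 2 := by rw [hgdef]; compute_degree!
  refine ⟨AdjoinRoot g, inferInstance, inferInstance, inferInstance, inferInstance,
    AdjoinRoot.root g, hg.finite_adjoinRoot, hg.free_adjoinRoot, ?_, ?_, ?_,
    AdjoinRoot.adjoinRoot_eq_top, ?_⟩
  · rw [(AdjoinRoot.powerBasis' hg).finrank]
    simp [hgd]
  · have h : AdjoinRoot.mk g (X ^ 2 + C b * X + C c) = 0 := hgdef ▸ AdjoinRoot.mk_self
    simpa using h
  · intro r hr
    by_contra hr0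
    refine AdjoinRoot.mk_ne_zero_of_natDegree_lt hg (g := C r * X) ?_ ?_ (by simpa using hr)
    · exact fun h0 => hr0 (by simpa using congrArg (coeff · 1) h0)
    · rw [natDegree_C_mul_X r hr0, hgd]
      norm_num
  · intro D _ _ φ y hy
    exact ⟨AdjoinRoot.liftAlgHom g φ y (by simpa [hgdef] using hy),
      AdjoinRoot.liftAlgHom_of _ _ _ _, AdjoinRoot.liftAlgHom_root ..⟩

end

/-- The algebra `k[u, v] / (2(u² - uv + v²) + uv(u + v), u ^ q)` is free of rank `2` over
`k[u] / (u ^ q)` because `2 + u` is invertible there. -/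
theorem exists_curve_truncation {k : Type u} [Field k] (h2 : (2 : k) ≠ 0) {q : ℕ} (hq : 0 < q) :
    ∃ (A : Type u) (_ : CommRing A) (_ : Algebra k A) (u v w : A),
      Module.Finite k A ∧ Module.finrank k A = 2 * q ∧ u ^ q = 0 ∧ w * (2 + u) = 1 ∧
      2 * (u ^ 2 - u * v + v ^ 2) + u * v * (u + v) = 0 ∧ u ^ (q - 1) * v ≠ 0 ∧
      Algebra.adjoin k {u, v} = ⊤ ∧
      ∀ (D : Type u) [CommRing D] [Algebra k D] (x y : D), x ^ q = 0 →
        2 * (x ^ 2 - x * y + y ^ 2) + x * y * (x + y) = 0 →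
        ∃ φ : A →ₐ[k] D, φ u = x ∧ φ v = y := by
  obtain ⟨B, _, _, e, hBf, hBr, he, he', hBadj, hBlift⟩ := exists_truncated_polynomial_algebra k hq
  have : Nontrivial B := ⟨⟨_, _, he'⟩⟩
  obtain ⟨w, hw⟩ : ∃ w : B, w * (2 + e) = 1 := by
    refine (IsNilpotent.isUnit_add_left_of_commute ⟨q, he⟩ ?_ (Commute.all _ _)).exists_left_inv
    rw [← map_ofNat (algebraMap k B) 2]
    exact (IsUnit.mk0 (2 : k) h2).map (algebraMap k B)
  obtain ⟨A, _, _, _, _, v, hAf, hAfr, hAr, hv, hvinj, hAadj, hAlift⟩ :=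
    exists_monic_quadratic_extension k (w * (e ^ 2 - 2 * e)) (2 * w * e ^ 2)
  have hw' : algebraMap B A w * (2 + algebraMap B A e) = 1 := by
    rw [← map_ofNat (algebraMap B A) 2, ← map_add, ← map_mul, hw, map_one]
  refine ⟨A, inferInstance, inferInstance, algebraMap B A e, v, algebraMap B A w,
    Module.Finite.trans B A, ?_, ?_, hw', ?_, ?_, ?_, ?_⟩
  · rw [← Module.finrank_mul_finrank k B A, hBr, hAr, mul_comm]
  · rw [← map_pow, he, map_zero]
  · simp only [map_mul, map_sub, map_pow, map_ofNat] at hv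
    linear_combination (2 + algebraMap B A e) * hv - (2 * algebraMap B A e ^ 2 +
      (algebraMap B A e ^ 2 - 2 * algebraMap B A e) * v) * hw'
  · rw [← map_pow]
    exact fun h => he' (hvinj _ h)
  · have hB (b : B) : algebraMap B A b ∈ Algebra.adjoin k {algebraMap B A e, v} := by
      have hb : b ∈ Algebra.adjoin k {e} := hBadj ▸ Algebra.mem_top
      induction hb using Algebra.adjoin_induction with
      | mem x hx =>
        rw [Set.mem_singleton_iff.1 hx]
        exact Algebra.subset_adjoin (by simp)
      | algebraMap r =>
        rw [← IsScalarTower.algebraMap_apply]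
        exact Subalgebra.algebraMap_mem _ r
      | add x y _ _ hx hy => exact map_add (algebraMap B A) x y ▸ add_mem hx hy
      | mul x y _ _ hx hy => exact map_mul (algebraMap B A) x y ▸ mul_mem hx hy
    rw [eq_top_iff]
    rintro a -
    have ha : a ∈ Algebra.adjoin B {v} := hAadj ▸ Algebra.mem_top
    induction ha using Algebra.adjoin_induction with
    | mem x hx =>
      rw [Set.mem_singleton_iff.1 hx]
      exact Algebra.subset_adjoin (by simp)
    | algebraMap r => exact hB r
    | add x y _ _ hx hy => exact add_mem hx hy
    | mul x y _ _ hx hy => exact mul_mem hx hy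
  · intro D _ _ x y hx hxy
    obtain ⟨φ, hφe⟩ := hBlift D x hx
    have hφw : φ w * (2 + x) = 1 := by
      rw [← hφe, ← map_ofNat φ 2, ← map_add, ← map_mul, hw, map_one]
    obtain ⟨ψ, hψ, hψv⟩ := hAlift D φ y (by
      simp only [map_mul, map_sub, map_pow, map_ofNat, hφe]
      linear_combination φ w * hxy - y ^ 2 * hφw)
    exact ⟨ψ, (hψ e).trans hφe, hψv⟩

/-- In the truncated curve algebra, `v ^ q` spans a one-dimensional ideal and `v ^ (q + 1) = 0`. -/
theorem finrank_quotient_span_pow {k A : Type*} [Field k] [CommRing A] [Algebra k A]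
    [Module.Finite k A] {u v w : A} {q r : ℕ} (hq : 0 < q) (h3 : ¬ 3 ∣ q) (hqr : q ≤ r)
    (hu : u ^ q = 0) (hw : w * (2 + u) = 1)
    (h : 2 * (u ^ 2 - u * v + v ^ 2) + u * v * (u + v) = 0) (hne : u ^ (q - 1) * v ≠ 0)
    (hadj : Algebra.adjoin k {u, v} = ⊤) :
    Module.finrank k (A ⧸ Ideal.span {v ^ r}) =
      if q = r then Module.finrank k A - 1 else Module.finrank k A := by
  have hvq : v ^ (q + 1) = 0 := by
    obtain ⟨s, t, a, b, hv, -⟩ := pow_succ_of_tangent_relation hw h q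
    rw [hv, hu, zero_mul]
  have hdim := Submodule.finrank_quotient_add_finrank
    ((Ideal.span {v ^ r}).restrictScalars k)
  change Module.finrank k (A ⧸ Ideal.span {v ^ r}) + _ = _ at hdim
  split_ifs with hr
  · subst hr
    have hvne : v ^ q ≠ 0 := by
      obtain ⟨s, t, a, b, hv, hst⟩ := pow_succ_of_tangent_relation hw h (q - 1)
      have hu' : u ^ (q - 1) * u = 0 := by rw [← pow_succ, Nat.sub_add_cancel hq, hu]
      have ht : IsUnit t := by
        rcases hst with ⟨-, -, ht⟩ | ⟨-, -, ht⟩ | ⟨hmod, -⟩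
        · exact ht
        · exact ht
        · omega
      rw [Nat.sub_add_cancel hq] at hv
      have hv' : v ^ q = (t : A) * (u ^ (q - 1) * v) := by
        linear_combination hv + (s + a * u + b * v) * hu'
      rw [hv']
      exact fun h0 => hne (((ht.map (Int.castRingHom A)).mul_right_eq_zero).1 h0)
    have huv : u * v ^ q = 0 := by
      obtain ⟨s, t, a, b, hv, -⟩ := pow_succ_of_tangent_relation hw h (q - 1)
      have hu' : u ^ (q - 1) * u = 0 := by rw [← pow_succ, Nat.sub_add_cancel hq, hu]
      rw [Nat.sub_add_cancel hq] at hv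
      rw [hv, ← mul_assoc, mul_comm u, hu', zero_mul]
    have hspan : (Ideal.span {v ^ q}).restrictScalars k = Submodule.span k {v ^ q} := by
      ext z
      rw [Submodule.restrictScalars_mem, Ideal.mem_span_singleton', Submodule.mem_span_singleton]
      constructor
      · rintro ⟨a, rfl⟩
        have ha : a ∈ Algebra.adjoin k {u, v} := hadj ▸ Algebra.mem_top
        induction ha using Algebra.adjoin_induction with
        | mem x hx =>
          refine ⟨0, ?_⟩
          rcases hx with rfl | rfl
          · rw [huv, zero_smul]
          · rw [← pow_succ', hvq, zero_smul]
        | algebraMap c => exact ⟨c, Algebra.smul_def c _⟩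
        | add x y _ _ hx hy =>
          obtain ⟨c, hc⟩ := hx
          obtain ⟨d, hd⟩ := hy
          exact ⟨c + d, by rw [add_smul, hc, hd, add_mul]⟩
        | mul x y _ _ hx hy =>
          obtain ⟨c, hc⟩ := hx
          obtain ⟨d, hd⟩ := hy
          exact ⟨d * c, by rw [mul_smul, hc, mul_assoc, ← hd, mul_smul_comm]⟩
      · rintro ⟨c, rfl⟩
        exact ⟨algebraMap k A c, (Algebra.smul_def c _).symm⟩
    rw [hspan, finrank_span_singleton hvne] at hdim
    omega
  · have hvr : v ^ r = 0 := pow_eq_zero_of_le (by omega) hvq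
    have hbot : (Ideal.span {v ^ r}).restrictScalars k = ⊥ := by simp [hvr]
    rw [hbot, finrank_bot] at hdim
    exact hdim

open MvPolynomial

/-- The dimension formula when the exponent of `x` is at most that of `y`, obtained from the
truncated curve algebra by the substitution `x = 1 + u`, `y = 1 + v`. -/
theorem finrank_triangular_laplacian_quotient_of_le (p : ℕ) (hp : p.Prime) (hp3 : 3 < p) {m n : ℕ}
    (hmn : m ≤ n) :
    Module.finrank (ZMod p)
      (MvPolynomial (Fin 2) (ZMod p) ⧸
        Ideal.span {(X 0 ^ 2 * X 1 + X 0 * X 1 ^ 2 + X 0 ^ 2 + X 1 ^ 2 + X 0 + X 1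
            - 6 * X 0 * X 1 : MvPolynomial (Fin 2) (ZMod p)),
          X 0 ^ p ^ m - 1, X 1 ^ p ^ n - 1}) =
      if m = n then 2 * p ^ m - 1 else 2 * p ^ m := by
  have : Fact p.Prime := ⟨hp⟩
  have h2 : (2 : ZMod p) ≠ 0 := fun h =>
    absurd (Nat.le_of_dvd two_pos ((ZMod.natCast_eq_zero_iff 2 p).1 h)) (by omega)
  have h3 : ¬ 3 ∣ p ^ m := fun h =>
    hp3.ne ((Nat.prime_dvd_prime_iff_eq Nat.prime_three hp).1 (Nat.prime_three.dvd_of_dvd_pow h))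
  obtain ⟨A, _, _, u, v, w, _, hrank, hu, hw, huv, hne, hadj, hlift⟩ :=
    exists_curve_truncation h2 (pow_pos hp.pos m)
  have hpow : p ^ m = p ^ n ↔ m = n := Nat.pow_right_inj hp.two_le
  rw [← hrank, ← if_congr hpow rfl rfl, ← finrank_quotient_span_pow (pow_pos hp.pos m) h3
    (Nat.pow_le_pow_right hp.pos hmn) hu hw huv hne hadj]
  obtain ⟨I, hI⟩ : ∃ I : Ideal (MvPolynomial (Fin 2) (ZMod p)), I = Ideal.span
      {(X 0 ^ 2 * X 1 + X 0 * X 1 ^ 2 + X 0 ^ 2 + X 1 ^ 2 + X 0 + X 1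
        - 6 * X 0 * X 1 : MvPolynomial (Fin 2) (ZMod p)),
        X 0 ^ p ^ m - 1, X 1 ^ p ^ n - 1} := ⟨_, rfl⟩
  rw [← hI]
  have hmk (a) (ha : a ∈ ({(X 0 ^ 2 * X 1 + X 0 * X 1 ^ 2 + X 0 ^ 2 + X 1 ^ 2 + X 0 + X 1
        - 6 * X 0 * X 1 : MvPolynomial (Fin 2) (ZMod p)),
        X 0 ^ p ^ m - 1, X 1 ^ p ^ n - 1} : Set _)) : Ideal.Quotient.mkₐ (ZMod p) I a = 0 :=
    Ideal.Quotient.eq_zero_iff_mem.2 (hI ▸ Ideal.subset_span ha)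
  let J : Ideal A := Ideal.span {v ^ p ^ n}
  have hJ : Ideal.Quotient.mkₐ (ZMod p) J (v ^ p ^ n) = 0 :=
    Ideal.Quotient.eq_zero_iff_mem.2 (Ideal.mem_span_singleton_self _)
  have : Nontrivial A := ⟨⟨_, _, hne⟩⟩
  have : CharP A p := charP_of_injective_algebraMap (algebraMap (ZMod p) A).injective p
  let E : MvPolynomial (Fin 2) (ZMod p) →ₐ[ZMod p] A ⧸ J :=
    (Ideal.Quotient.mkₐ (ZMod p) J).comp (aeval ![1 + u, 1 + v])
  have hker : ∀ a ∈ I, E a = 0 := by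
    suffices h : I ≤ RingHom.ker E from fun a ha => h ha
    rw [hI, Ideal.span_le]
    rintro a (rfl | rfl | rfl)
    · have h : aeval (R := ZMod p) ![1 + u, 1 + v] (X 0 ^ 2 * X 1 + X 0 * X 1 ^ 2 + X 0 ^ 2 +
          X 1 ^ 2 + X 0 + X 1 - 6 * X 0 * X 1) = 0 := by
        simp only [map_sub, map_add, map_mul, map_pow, map_ofNat, aeval_X, Matrix.cons_val_zero,
          Matrix.cons_val_one]
        linear_combination huv
      simp only [SetLike.mem_coe, RingHom.mem_ker, E, AlgHom.comp_apply, h, map_zero]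
    · have h : aeval (R := ZMod p) ![1 + u, 1 + v] (X 0 ^ p ^ m - 1) = 0 := by
        simp [add_pow_char_pow, hu]
      simp only [SetLike.mem_coe, RingHom.mem_ker, E, AlgHom.comp_apply, h, map_zero]
    · have h : aeval (R := ZMod p) ![1 + u, 1 + v] (X 1 ^ p ^ n - 1) = v ^ p ^ n := by
        simp [add_pow_char_pow]
      simp only [SetLike.mem_coe, RingHom.mem_ker, E, AlgHom.comp_apply, h, hJ]
  let x : MvPolynomial (Fin 2) (ZMod p) ⧸ I := Ideal.Quotient.mkₐ (ZMod p) I (X 0 - 1)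
  let y : MvPolynomial (Fin 2) (ZMod p) ⧸ I := Ideal.Quotient.mkₐ (ZMod p) I (X 1 - 1)
  obtain ⟨φ, hφu, hφv⟩ := hlift _ x y
    (by rw [← map_pow, sub_pow_char_pow, one_pow]; exact hmk _ (by simp))
    (by
      refine Eq.trans ?_ (hmk _ (Set.mem_insert _ _))
      simp only [x, y, map_sub, map_add, map_mul, map_pow, map_ofNat, map_one]
      ring)
  have hφJ : ∀ a ∈ J, φ a = 0 := by
    suffices h : J ≤ RingHom.ker φ from fun a ha => h ha
    rw [Ideal.span_singleton_le_iff_mem, RingHom.mem_ker, map_pow, hφv, ← map_pow,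
      sub_pow_char_pow, one_pow]
    exact hmk _ (by simp)
  let Φ := Ideal.Quotient.liftₐ I E hker
  let Ψ := Ideal.Quotient.liftₐ J φ hφJ
  have hΦ (P) : Φ (Ideal.Quotient.mkₐ (ZMod p) I P) = E P := rfl
  have hΨ (a) : Ψ (Ideal.Quotient.mkₐ (ZMod p) J a) = φ a := rfl
  have hE0 : E (X 0) = Ideal.Quotient.mkₐ (ZMod p) J (1 + u) := by
    simp only [E, AlgHom.comp_apply, aeval_X, Matrix.cons_val_zero]
  have hE1 : E (X 1) = Ideal.Quotient.mkₐ (ZMod p) J (1 + v) := by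
    simp only [E, AlgHom.comp_apply, aeval_X, Matrix.cons_val_one, Matrix.cons_val_zero]
  refine (AlgEquiv.ofAlgHom Φ Ψ ?_ ?_).toLinearEquiv.finrank_eq
  · refine Ideal.Quotient.algHom_ext _ (AlgHom.ext_of_adjoin_eq_top hadj fun a ha => ?_)
    change Φ (Ψ (Ideal.Quotient.mkₐ (ZMod p) J a)) = Ideal.Quotient.mkₐ (ZMod p) J a
    rw [hΨ]
    rcases ha with ha | ha
    · rw [ha, hφu, hΦ, map_sub, map_one, hE0, map_add, map_one, add_sub_cancel_left]
    · rw [ha, hφv, hΦ, map_sub, map_one, hE1, map_add, map_one, add_sub_cancel_left]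
  · refine Ideal.Quotient.algHom_ext _ (MvPolynomial.algHom_ext fun i => ?_)
    change Ψ (Φ (Ideal.Quotient.mkₐ (ZMod p) I (X i))) = Ideal.Quotient.mkₐ (ZMod p) I (X i)
    rw [hΦ]
    fin_cases i
    · change Ψ (E (X 0)) = Ideal.Quotient.mkₐ (ZMod p) I (X 0)
      rw [hE0, hΨ, map_add, map_one, hφu]
      simp only [x, map_sub, map_one, add_sub_cancel]
    · change Ψ (E (X 1)) = Ideal.Quotient.mkₐ (ZMod p) I (X 1)
      rw [hE1, hΨ, map_add, map_one, hφv]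
      simp only [y, map_sub, map_one, add_sub_cancel]

/-- For a prime `p > 3`, the dimension over `ZMod p` of the quotient of `(ZMod p)[x,y]` by
the ideal generated by the triangular-lattice Laplacian polynomial
`f = x²y + xy² + x² + y² + x + y - 6xy`, `x^(p^kx) - 1`, and `y^(p^ky) - 1`
equals `2·p^(min kx ky) - 1` when `kx = ky`, and `2·p^(min kx ky)` otherwise. -/
theorem triangular_laplacian_gsd_mod_p (p : ℕ) (hp : p.Prime) (hp3 : 3 < p) (kx ky : ℕ) :
    Module.finrank (ZMod p)
      (MvPolynomial (Fin 2) (ZMod p) ⧸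
        Ideal.span {(X 0 ^ 2 * X 1 + X 0 * X 1 ^ 2 + X 0 ^ 2 + X 1 ^ 2 + X 0 + X 1
            - 6 * X 0 * X 1 : MvPolynomial (Fin 2) (ZMod p)),
          X 0 ^ p ^ kx - 1, X 1 ^ p ^ ky - 1}) =
      if kx = ky then 2 * p ^ min kx ky - 1 else 2 * p ^ min kx ky := by
  rcases le_total kx ky with h | h
  · rw [min_eq_left h]
    exact finrank_triangular_laplacian_quotient_of_le p hp hp3 h
  · rw [min_eq_right h, ← if_congr (eq_comm (a := ky) (b := kx)) rfl rfl,
      ← finrank_triangular_laplacian_quotient_of_le p hp hp3 h]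
    refine (Ideal.quotientEquivAlg _ _ (renameEquiv (ZMod p) (Equiv.swap (0 : Fin 2) 1))
      ?_).toLinearEquiv.finrank_eq
    rw [Ideal.map_span, Set.image_insert_eq, Set.image_pair, Set.pair_comm]
    simp only [RingHom.coe_coe, renameEquiv_apply, map_sub, map_add, map_mul, map_pow, map_one,
      map_ofNat, rename_X, Equiv.swap_apply_left, Equiv.swap_apply_right]
    rw [show (X 1 ^ 2 * X 0 + X 1 * X 0 ^ 2 + X 1 ^ 2 + X 0 ^ 2 + X 1 + X 0 - 6 * X 1 * X 0 :
      MvPolynomial (Fin 2) (ZMod p)) = X 0 ^ 2 * X 1 + X 0 * X 1 ^ 2 + X 0 ^ 2 + X 1 ^ 2 + X 0 + X 1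
        - 6 * X 0 * X 1 by ring]
end

section
/- Let p be an odd prime, q an odd prime, and m ≥ 1 an integer such that p is a primitive root modulo q^m. Let F be the algebraic closure of ZMod p. If (a,b) ∈ F × F satisfies f(a,b) = 0, a^(q^m) = 1, and b^(q^m) = 1, then a = 1 and b = 1. -/
/-- If `p` is a primitive root modulo `n`, every integer coprime to `n` is congruent to a power
of `p` modulo `n`. -/
theorem exists_pow_modEq_of_orderOf_eq_totient {n p k : ℕ} [NeZero n] (hp : p.Coprime n)
    (hord : orderOf (p : ZMod n) = n.totient) (hk : k.Coprime n) :
    ∃ r : ℕ, p ^ r ≡ k [MOD n] := by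
  have hcard : orderOf (ZMod.unitOfCoprime p hp) = Nat.card (ZMod n)ˣ := by
    rw [← orderOf_units, ZMod.coe_unitOfCoprime, hord, Nat.card_eq_fintype_card,
      ZMod.card_units_eq_totient]
  have htop : Subgroup.zpowers (ZMod.unitOfCoprime p hp) = ⊤ :=
    Subgroup.eq_top_of_card_eq _ ((Nat.card_zpowers _).trans hcard)
  obtain ⟨r, hr⟩ := mem_powers_iff_mem_zpowers.mpr
    (htop.ge (Subgroup.mem_top (ZMod.unitOfCoprime k hk)))
  refine ⟨r, (ZMod.natCast_eq_natCast_iff _ _ _).mp ?_⟩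
  simpa using congrArg Units.val hr

/-- In a field of characteristic different from two, a zero of the triangular-lattice Laplacian
polynomial with nonzero coordinates whose coordinatewise square is again a zero has first
coordinate `1`. -/
theorem eq_one_of_triangular_laplacian_sq {K : Type*} [Field K] (h2 : (2 : K) ≠ 0) {a b : K}
    (ha : a ≠ 0) (hb : b ≠ 0)
    (h : a ^ 2 * b + a * b ^ 2 + a ^ 2 + b ^ 2 + a + b - 6 * a * b = 0)
    (hsq : (a ^ 2) ^ 2 * b ^ 2 + a ^ 2 * (b ^ 2) ^ 2 + (a ^ 2) ^ 2 + (b ^ 2) ^ 2 + a ^ 2 + b ^ 2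
      - 6 * a ^ 2 * b ^ 2 = 0) :
    a = 1 := by
  obtain ⟨u, hu⟩ : ∃ u, u = a + a⁻¹ := ⟨_, rfl⟩
  obtain ⟨v, hv⟩ : ∃ v, v = b + b⁻¹ := ⟨_, rfl⟩
  obtain ⟨w, hw⟩ : ∃ w, w = a * b⁻¹ + b * a⁻¹ := ⟨_, rfl⟩
  have hsum : u + v + w = 6 := by
    have : u + v + w - 6 = 0 := by
      rw [← mul_right_inj' (mul_ne_zero ha hb), mul_zero, ← h, hu, hv, hw]
      field_simp
      ring
    linear_combination this
  have hsum_sq : u ^ 2 + v ^ 2 + w ^ 2 = 12 := by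
    have : u ^ 2 + v ^ 2 + w ^ 2 - 12 = 0 := by
      rw [← mul_right_inj' (mul_ne_zero (pow_ne_zero 2 ha) (pow_ne_zero 2 hb)), mul_zero,
        ← hsq, hu, hv, hw]
      field_simp
      ring
    linear_combination this
  have hmarkov : u ^ 2 + v ^ 2 + w ^ 2 - u * v * w = 4 := by
    rw [hu, hv, hw]
    field_simp
    ring
  have hpairs : u * v + v * w + w * u = 12 := by
    apply mul_left_cancel₀ h2
    linear_combination (u + v + w + 6) * hsum - hsum_sq
  have hcube : (u - 2) ^ 3 = 0 := by
    linear_combination u ^ 2 * hsum - u * hpairs + hsum_sq - hmarkov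
  have hu2 : u - 2 = 0 := pow_eq_zero_iff three_ne_zero |>.mp hcube
  have hsq_zero : (a - 1) ^ 2 = 0 := by
    have : (a - 1) ^ 2 = a * (u - 2) := by
      rw [hu]
      field_simp
      ring
    rw [this, hu2, mul_zero]
  exact sub_eq_zero.mp (pow_eq_zero_iff two_ne_zero |>.mp hsq_zero)

/-- If `p` is an odd prime, `q` an odd prime, and `m ≥ 1` is such that `p` is a primitive
root modulo `q^m`, then the only common root `(a,b)` in the algebraic closure of `ZMod p` of
the triangular-lattice Laplacian polynomial `f(x,y) = x²y + xy² + x² + y² + x + y - 6xy`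
with `a^(q^m) = 1` and `b^(q^m) = 1` is `(1,1)`. -/
theorem triangular_laplacian_only_trivial_root (p q m : ℕ) [Fact p.Prime] (hpodd : Odd p)
    (hq : q.Prime) (hqodd : Odd q) (hm : 1 ≤ m)
    (hcop : Nat.Coprime p (q ^ m))
    (hord : orderOf ((p : ℕ) : ZMod (q ^ m)) = Nat.totient (q ^ m))
    (a b : AlgebraicClosure (ZMod p))
    (hf : a ^ 2 * b + a * b ^ 2 + a ^ 2 + b ^ 2 + a + b - 6 * a * b = 0)
    (ha : a ^ q ^ m = 1) (hb : b ^ q ^ m = 1) :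
    a = 1 ∧ b = 1 := by
  have hn : q ^ m ≠ 0 := pow_ne_zero m hq.ne_zero
  have : NeZero (q ^ m) := ⟨hn⟩
  obtain ⟨r, hr⟩ := exists_pow_modEq_of_orderOf_eq_totient hcop hord
    (Nat.coprime_two_left.mpr hqodd.pow)
  have hfrob : ∀ x : AlgebraicClosure (ZMod p), x ^ q ^ m = 1 →
      iterateFrobenius (AlgebraicClosure (ZMod p)) p r x = x ^ 2 := by
    intro x hx
    rw [iterateFrobenius_def, ← pow_mod_orderOf, hr.of_dvd (orderOf_dvd_of_pow_eq_one hx),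
      pow_mod_orderOf]
  have hsq := congrArg (iterateFrobenius (AlgebraicClosure (ZMod p)) p r) hf
  simp only [map_sub, map_add, map_mul, map_pow, map_ofNat, map_zero, hfrob a ha,
    hfrob b hb] at hsq
  have h2 : (2 : AlgebraicClosure (ZMod p)) ≠ 0 := by
    refine Ring.two_ne_zero ?_
    rw [ringChar.eq (AlgebraicClosure (ZMod p)) p]
    exact hpodd.ne_two_of_dvd_nat dvd_rfl
  have ha0 : a ≠ 0 := (IsUnit.of_pow_eq_one ha hn).ne_zero
  have hb0 : b ≠ 0 := (IsUnit.of_pow_eq_one hb hn).ne_zero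
  exact ⟨eq_one_of_triangular_laplacian_sq h2 ha0 hb0 hf hsq,
    eq_one_of_triangular_laplacian_sq h2 hb0 ha0 (by linear_combination hf)
      (by linear_combination hsq)⟩
end

section
/- Let q be an odd prime with q ≠ 3 and m ≥ 0 an integer such that, if m ≥ 1, then 3 is a primitive root modulo q^m. Let k_x, k_y be nonnegative integers with max(k_x,k_y) ≥ 1, and set L_x = 3^k_x · q^m and L_y = 3^k_y · q^m. Then the dimension over ZMod 3 of (ZMod 3)[x,y] / (f, x^L_x − 1, y^L_y − 1) equals 2 · 3^(min(k_x,k_y)). -/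
open MvPolynomial

theorem exists_dvd_three_pow_add_one {q m : ℕ} (hq : q.Prime)
    (hprim : 1 ≤ m → Nat.Coprime 3 (q ^ m) ∧
      orderOf ((3 : ℕ) : ZMod (q ^ m)) = Nat.totient (q ^ m)) :
    ∃ r, q ^ m ∣ 3 ^ r + 1 := by
  rcases Nat.eq_zero_or_pos m with rfl | hm
  · exact ⟨0, by simp⟩
  obtain ⟨hc, ho⟩ := hprim hm
  have : NeZero (q ^ m) := ⟨pow_ne_zero _ hq.ne_zero⟩
  have hcard : orderOf (ZMod.unitOfCoprime 3 hc) = Nat.card (ZMod (q ^ m))ˣ := by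
    rw [← orderOf_units, ZMod.coe_unitOfCoprime, ho, Nat.card_eq_fintype_card,
      ZMod.card_units_eq_totient]
  have hmem : (-1 : (ZMod (q ^ m))ˣ) ∈ Submonoid.powers (ZMod.unitOfCoprime 3 hc) := by
    rw [mem_powers_iff_mem_zpowers]
    have htop : Subgroup.zpowers (ZMod.unitOfCoprime 3 hc) = ⊤ :=
      Subgroup.eq_top_of_card_eq _ (by rw [Nat.card_zpowers, hcard])
    rw [htop]
    trivial
  obtain ⟨r, hr⟩ := hmem
  refine ⟨r, (ZMod.natCast_eq_zero_iff _ _).mp ?_⟩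
  have := congrArg Units.val hr
  simp only [Units.val_pow_eq_pow_val, ZMod.coe_unitOfCoprime, Units.val_neg,
    Units.val_one] at this
  push_cast at this ⊢
  rw [this]
  ring

theorem laplacian_eq_mul {S : Type*} [CommRing S] [CharP S 3] (x y : S) :
    x ^ 2 * y + x * y ^ 2 + x ^ 2 + y ^ 2 + x + y - 6 * x * y =
      (x + y + 1) * (x * y + x + y) := by
  have h3 : (3 : S) = 0 := by exact_mod_cast CharP.cast_eq_zero S 3
  linear_combination (-3 * x * y) * h3

theorem eq_one_of_add_add_one_eq_zero {F : Type*} [Field F] [CharP F 3] {x y : F}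
    (h : x + y + 1 = 0) (h' : x * y + x + y = 0) : x = 1 := by
  have h3 : (3 : F) = 0 := by exact_mod_cast CharP.cast_eq_zero F 3
  have hsq : (x - 1) ^ 2 = 0 := by linear_combination (1 + x) * h - h' - x * h3
  exact sub_eq_zero.mp (pow_eq_zero_iff two_ne_zero |>.mp hsq)

theorem eq_one_of_laplacian_eq_zero {F : Type*} [Field F] [CharP F 3] {x y : F} {n r : ℕ}
    (hn : n ∣ 3 ^ r + 1) (hx : x ^ n = 1) (hy : y ^ n = 1)
    (hf : (x + y + 1) * (x * y + x + y) = 0) : x = 1 := by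
  have : Fact (Nat.Prime 3) := ⟨Nat.prime_three⟩
  obtain ⟨c, hc⟩ := hn
  have hx' : x ^ 3 ^ r * x = 1 := by rw [← pow_succ, hc, pow_mul, hx, one_pow]
  have hy' : y ^ 3 ^ r * y = 1 := by rw [← pow_succ, hc, pow_mul, hy, one_pow]
  rcases mul_eq_zero.mp hf with h | h
  · refine eq_one_of_add_add_one_eq_zero h ?_
    have hF := congrArg (· ^ 3 ^ r) h
    simp only [add_pow_char_pow, one_pow, zero_pow (pow_ne_zero r three_ne_zero)] at hF
    linear_combination x * y * hF - y * hx' - x * hy'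
  · refine eq_one_of_add_add_one_eq_zero ?_ h
    have hF := congrArg (· ^ 3 ^ r) h
    simp only [add_pow_char_pow, mul_pow, zero_pow (pow_ne_zero r three_ne_zero)] at hF
    linear_combination x * y * hF - (y ^ 3 ^ r * y + y) * hx' - (1 + x) * hy'

theorem pow_eq_one_of_pow_three_pow_mul {S : Type*} [CommRing S] [IsReduced S] [CharP S 3]
    {x : S} {k n : ℕ} (h : x ^ (3 ^ k * n) = 1) : x ^ n = 1 := by
  have : ExpChar S 3 := ExpChar.prime Nat.prime_three
  rw [mul_comm, pow_mul] at h
  exact (iterateFrobenius_inj S 3 k) (by simpa [iterateFrobenius_def] using h)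

theorem sub_one_pow_eq_zero {S : Type*} [CommRing S] [CharP S 3] {x y : S} {n r k l : ℕ}
    (hn : n ∣ 3 ^ r + 1) (hn3 : Nat.Coprime 3 n)
    (hx : x ^ (3 ^ k * n) = 1) (hy : y ^ (3 ^ l * n) = 1)
    (hf : (x + y + 1) * (x * y + x + y) = 0) : (x - 1) ^ 3 ^ k = 0 := by
  have : Fact (Nat.Prime 3) := ⟨Nat.prime_three⟩
  have hnil : IsNilpotent (x - 1) := by
    rw [nilpotent_iff_mem_prime]
    intro P hP
    let φ := (algebraMap (S ⧸ P) (FractionRing (S ⧸ P))).comp (Ideal.Quotient.mk P)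
    have : CharP (FractionRing (S ⧸ P)) 3 := by
      have h3 : ((3 : ℕ) : FractionRing (S ⧸ P)) = 0 := by
        have := congrArg φ (CharP.cast_eq_zero S 3)
        rwa [map_natCast, map_zero] at this
      exact (CharP.charP_iff_prime_eq_zero Nat.prime_three).mpr h3
    have h1 : φ x = 1 := by
      refine eq_one_of_laplacian_eq_zero (y := φ y) hn
        (pow_eq_one_of_pow_three_pow_mul (k := k) ?_)
        (pow_eq_one_of_pow_three_pow_mul (k := l) ?_) ?_
      · rw [← map_pow, hx, map_one]
      · rw [← map_pow, hy, map_one]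
      · simpa using congrArg φ hf
    have h0 : φ (x - 1) = 0 := by rw [map_sub, h1, map_one, sub_self]
    rw [← Ideal.Quotient.eq_zero_iff_mem]
    exact (IsFractionRing.injective (S ⧸ P) (FractionRing (S ⧸ P))) (by simpa [φ] using h0)
  have hnu : IsUnit (n : S) :=
    (CharP.isUnit_natCast_iff Nat.prime_three).mpr ((Nat.prime_three.coprime_iff_not_dvd).mp hn3)
  have hu : IsUnit (∑ i ∈ Finset.range n, x ^ i) := by
    have hd : x - 1 ∣ (∑ i ∈ Finset.range n, x ^ i) - n := by
      have : (∑ i ∈ Finset.range n, x ^ i) - (n : S) = ∑ i ∈ Finset.range n, (x ^ i - 1) := by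
        simp
      rw [this]
      exact Finset.dvd_sum fun i _ => sub_one_dvd_pow_sub_one x i
    obtain ⟨c, hc⟩ := hd
    rw [← sub_add_cancel (∑ i ∈ Finset.range n, x ^ i) (n : S), hc]
    exact ((Commute.all _ _).isNilpotent_mul_right hnil).isUnit_add_right_of_commute hnu
      (Commute.all _ _)
  have hz : (∑ i ∈ Finset.range n, x ^ i) ^ 3 ^ k * (x - 1) ^ 3 ^ k = 0 := by
    rw [← mul_pow, geom_sum_mul, sub_pow_char_pow, ← pow_mul, mul_comm n, hx, one_pow, sub_self]
  exact (hu.pow _).mul_right_eq_zero.mp hz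

theorem pow_eq_zero_of_add_sq_eq {S : Type*} [CommRing S] [CharP S 3] {u v : S} {N b : ℕ}
    (hb : 1 ≤ b) (hN : N ≤ 3 ^ b) (hu : u ^ N = 0)
    (h : (u + v) ^ 2 = u * v * (u + v)) : v ^ 3 ^ b = 0 := by
  have : Fact (Nat.Prime 3) := ⟨Nat.prime_three⟩
  have hpow : ∀ n, (u + v) ^ (n + 1) = (u * v) ^ n * (u + v) := by
    intro n
    induction n with
    | zero => simp
    | succ n ih => rw [pow_succ, ih, mul_assoc, ← sq, h]; ring
  have h3 : 3 ≤ 3 ^ b := Nat.le_self_pow (by omega) 3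
  obtain ⟨M, hM⟩ : ∃ M, 3 ^ b = M + 1 := ⟨3 ^ b - 1, by omega⟩
  have huM : u ^ (M + 1) = 0 := by rw [← hM]; exact pow_eq_zero_of_le hN hu
  have hE := hpow M
  rw [← hM, add_pow_char_pow, hM] at hE
  have hunit : IsUnit (1 - u ^ M) :=
    IsNilpotent.isUnit_one_sub ⟨N, by rw [← pow_mul, mul_comm, pow_mul, hu, zero_pow (by omega)]⟩
  rw [hM]
  refine hunit.mul_right_eq_zero.mp ?_
  rw [mul_pow] at hE
  linear_combination hE + (v ^ M - 1) * huM

theorem finrank_adjoinRoot_adjoinRoot {K : Type*} [Field K] {g : Polynomial K}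
    (hg : g.Monic) (hg0 : g.natDegree ≠ 0) {p : Polynomial (AdjoinRoot g)} (hp : p.Monic) :
    Module.finrank K (AdjoinRoot p) = g.natDegree * p.natDegree := by
  have : Nontrivial (AdjoinRoot g) :=
    AdjoinRoot.nontrivial g fun h => hg0 (Polynomial.natDegree_eq_zero_iff_degree_le_zero.mpr h.le)
  have : Module.Free (AdjoinRoot g) (AdjoinRoot p) :=
    .of_basis (AdjoinRoot.powerBasis' hp).basis
  rw [← Module.finrank_mul_finrank K (AdjoinRoot g) (AdjoinRoot p),
    (AdjoinRoot.powerBasis' hg).finrank, (AdjoinRoot.powerBasis' hp).finrank,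
    AdjoinRoot.powerBasis'_dim, AdjoinRoot.powerBasis'_dim]

theorem three_eq_zero_of_algebra_zmod (S : Type*) [CommRing S] [Algebra (ZMod 3) S] :
    (3 : S) = 0 := by
  rw [← map_ofNat (algebraMap (ZMod 3) S) 3, show (OfNat.ofNat 3 : ZMod 3) = 0 from rfl, map_zero]

theorem finrank_quotient_span_laplacian {N : ℕ} (hN : N ≠ 0) :
    Module.finrank (ZMod 3) (MvPolynomial (Fin 2) (ZMod 3) ⧸
      Ideal.span {((X 0 + X 1 + 1) * (X 0 * X 1 + X 0 + X 1) : MvPolynomial (Fin 2) (ZMod 3)),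
        (X 0 - 1) ^ N}) = 2 * N := by
  have : Fact (Nat.Prime 3) := ⟨Nat.prime_three⟩
  set J := Ideal.span {((X 0 + X 1 + 1) * (X 0 * X 1 + X 0 + X 1) :
    MvPolynomial (Fin 2) (ZMod 3)), (X 0 - 1) ^ N} with hJ
  let g : Polynomial (ZMod 3) := (Polynomial.X - Polynomial.C 1) ^ N
  have hg : g.Monic := (Polynomial.monic_X_sub_C 1).pow N
  have hgN : g.natDegree = N := by
    simp only [g, Polynomial.natDegree_pow, Polynomial.natDegree_X_sub_C, mul_one]
  let a := AdjoinRoot.root g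
  have ha : (a - 1) ^ N = 0 := by
    have := AdjoinRoot.eval₂_root g
    simpa [g, Polynomial.eval₂_pow] using this
  have hau : IsUnit (a + 1) := by
    have h2 : IsUnit (2 : AdjoinRoot g) := by
      refine IsUnit.of_mul_eq_one 2 ?_
      linear_combination three_eq_zero_of_algebra_zmod (AdjoinRoot g)
    have := IsNilpotent.isUnit_add_left_of_commute ⟨N, ha⟩ h2 (Commute.all _ _)
    rwa [show 2 + (a - 1) = a + 1 by ring] at this
  obtain ⟨c, hc⟩ := hau.exists_right_inv
  let p : Polynomial (AdjoinRoot g) :=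
    Polynomial.X ^ 2 + Polynomial.C (c * (a ^ 2 + 1)) * Polynomial.X + Polynomial.C a
  have : Nontrivial (AdjoinRoot g) :=
    AdjoinRoot.nontrivial g fun h => hN
      (hgN ▸ Polynomial.natDegree_eq_zero_iff_degree_le_zero.mpr h.le)
  have hp2 : p.natDegree = 2 := by simp only [p]; compute_degree!
  have hp : p.Monic := by simp only [p]; monicity!
  let b := AdjoinRoot.root p
  have hb : b ^ 2 + AdjoinRoot.of p (c * (a ^ 2 + 1)) * b + AdjoinRoot.of p a = 0 := by
    have := AdjoinRoot.eval₂_root p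
    simpa only [p, Polynomial.eval₂_add, Polynomial.eval₂_mul, Polynomial.eval₂_pow,
      Polynomial.eval₂_X, Polynomial.eval₂_C] using this
  have h3B : (3 : AdjoinRoot p) = 0 := three_eq_zero_of_algebra_zmod _
  have hcB := congrArg (AdjoinRoot.of p) hc
  let φ₀ : MvPolynomial (Fin 2) (ZMod 3) →+* AdjoinRoot p :=
    (aeval ![AdjoinRoot.of p a, b]).toRingHom
  have hφx : φ₀ (X 0) = AdjoinRoot.of p a := by simp [φ₀]
  have hφy : φ₀ (X 1) = b := by simp [φ₀]
  let φ : MvPolynomial (Fin 2) (ZMod 3) ⧸ J →+* AdjoinRoot p := Ideal.Quotient.lift J φ₀ (by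
    suffices J ≤ RingHom.ker φ₀ from fun z hz => this hz
    rw [hJ, Ideal.span_le]
    rintro z (rfl | rfl)
    · simp only [SetLike.mem_coe, RingHom.mem_ker, map_mul, map_add, map_one, hφx, hφy]
      simp only [map_mul, map_add, map_pow, map_one] at hb hcB
      generalize AdjoinRoot.of p a = α at *
      generalize AdjoinRoot.of p c = γ at *
      linear_combination (α + 1) * hb - (α ^ 2 + 1) * b * hcB + α * b * h3B
    · simp only [SetLike.mem_coe, RingHom.mem_ker, map_pow, map_sub, map_one, hφx]
      rw [← map_one (AdjoinRoot.of p), ← map_sub, ← map_pow, ha, map_zero])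
  let x : MvPolynomial (Fin 2) (ZMod 3) ⧸ J := Ideal.Quotient.mk J (X 0)
  let y : MvPolynomial (Fin 2) (ZMod 3) ⧸ J := Ideal.Quotient.mk J (X 1)
  have hf : (x + y + 1) * (x * y + x + y) = 0 := by
    have : Ideal.Quotient.mk J ((X 0 + X 1 + 1) * (X 0 * X 1 + X 0 + X 1)) = 0 :=
      Ideal.Quotient.eq_zero_iff_mem.mpr (Ideal.subset_span (by simp))
    simpa using this
  have hx : (x - 1) ^ N = 0 := by
    have : Ideal.Quotient.mk J ((X 0 - 1) ^ N) = 0 :=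
      Ideal.Quotient.eq_zero_iff_mem.mpr (Ideal.subset_span (by simp))
    simpa using this
  have h3Q : (3 : MvPolynomial (Fin 2) (ZMod 3) ⧸ J) = 0 := three_eq_zero_of_algebra_zmod _
  let ψ₀ : AdjoinRoot g →+* MvPolynomial (Fin 2) (ZMod 3) ⧸ J :=
    AdjoinRoot.lift (algebraMap _ _) x (by simpa [g, Polynomial.eval₂_pow] using hx)
  have hψa : ψ₀ a = x := AdjoinRoot.lift_root _
  have hcQ : (x + 1) * ψ₀ c = 1 := by simpa [hψa] using congrArg ψ₀ hc
  let ψ : AdjoinRoot p →+* MvPolynomial (Fin 2) (ZMod 3) ⧸ J :=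
    AdjoinRoot.lift ψ₀ y (by
      simp only [p, Polynomial.eval₂_add, Polynomial.eval₂_mul, Polynomial.eval₂_pow,
        Polynomial.eval₂_X, Polynomial.eval₂_C, Polynomial.eval₂_one,
        map_mul, map_add, map_pow, map_one, hψa]
      linear_combination ψ₀ c * hf - (y ^ 2 + x) * hcQ - ψ₀ c * x * y * h3Q)
  have hψb : ψ b = y := AdjoinRoot.lift_root _
  have hψof (z) : ψ (AdjoinRoot.of p z) = ψ₀ z := AdjoinRoot.lift_of _
  have h₁ : φ.comp ψ = RingHom.id _ := by
    refine AdjoinRoot.ringHom_ext (AdjoinRoot.ringHom_ext (Subsingleton.elim _ _) ?_) ?_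
    · change φ (ψ (AdjoinRoot.of p a)) = AdjoinRoot.of p a
      rw [hψof, hψa]
      exact hφx
    · change φ (ψ b) = b
      rw [hψb]
      exact hφy
  have h₂ : ψ.comp φ = RingHom.id _ := by
    refine Ideal.Quotient.ringHom_ext (MvPolynomial.ringHom_ext' (Subsingleton.elim _ _) ?_)
    intro i
    fin_cases i
    · change ψ (φ₀ (X 0)) = x
      rw [hφx, hψof, hψa]
    · change ψ (φ₀ (X 1)) = y
      rw [hφy, hψb]
  let e : AdjoinRoot p ≃+* MvPolynomial (Fin 2) (ZMod 3) ⧸ J := RingEquiv.ofRingHom ψ φ h₂ h₁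
  have hlin := LinearEquiv.finrank_eq
    (LinearEquiv.ofBijective (e.toAddEquiv.toAddMonoidHom.toZModLinearMap 3) e.bijective)
  rw [← hlin, finrank_adjoinRoot_adjoinRoot hg (hgN ▸ hN) hp, hgN, hp2, mul_comm]

theorem span_laplacian_eq {n r k l : ℕ} (hn : n ∣ 3 ^ r + 1) (hn3 : Nat.Coprime 3 n)
    (hl : 1 ≤ l) (hkl : k ≤ l) :
    Ideal.span {((X 0 + X 1 + 1) * (X 0 * X 1 + X 0 + X 1) : MvPolynomial (Fin 2) (ZMod 3)),
        X 0 ^ (3 ^ k * n) - 1, X 1 ^ (3 ^ l * n) - 1} =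
      Ideal.span {((X 0 + X 1 + 1) * (X 0 * X 1 + X 0 + X 1) : MvPolynomial (Fin 2) (ZMod 3)),
        (X 0 - 1) ^ 3 ^ k} := by
  have : Fact (Nat.Prime 3) := ⟨Nat.prime_three⟩
  have hpow (z : MvPolynomial (Fin 2) (ZMod 3)) (j : ℕ) :
      (z - 1) ^ 3 ^ j ∣ z ^ (3 ^ j * n) - 1 := by
    have h := pow_dvd_pow_of_dvd (sub_one_dvd_pow_sub_one z n) (3 ^ j)
    rwa [sub_pow_char_pow (z ^ n), one_pow, ← pow_mul, mul_comm n] at h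
  apply le_antisymm
  · set J := Ideal.span {((X 0 + X 1 + 1) * (X 0 * X 1 + X 0 + X 1) :
      MvPolynomial (Fin 2) (ZMod 3)), (X 0 - 1) ^ 3 ^ k} with hJ
    have hfJ : ((X 0 + X 1 + 1) * (X 0 * X 1 + X 0 + X 1) : MvPolynomial (Fin 2) (ZMod 3)) ∈ J :=
      Ideal.subset_span (by simp)
    have hxJ : ((X 0 - 1) ^ 3 ^ k : MvPolynomial (Fin 2) (ZMod 3)) ∈ J :=
      Ideal.subset_span (by simp)
    have hyJ : ((X 1 - 1) ^ 3 ^ l : MvPolynomial (Fin 2) (ZMod 3)) ∈ J := by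
      rw [← Ideal.Quotient.eq_zero_iff_mem] at hfJ hxJ ⊢
      rcases subsingleton_or_nontrivial (MvPolynomial (Fin 2) (ZMod 3) ⧸ J)
      · exact Subsingleton.elim _ _
      have : CharP (MvPolynomial (Fin 2) (ZMod 3) ⧸ J) 3 :=
        charP_of_injective_algebraMap (algebraMap (ZMod 3) _).injective 3
      simp only [map_pow, map_mul, map_add, map_sub, map_one] at hfJ hxJ ⊢
      refine pow_eq_zero_of_add_sq_eq hl (Nat.pow_le_pow_right three_pos hkl) hxJ ?_
      have h3 := three_eq_zero_of_algebra_zmod (MvPolynomial (Fin 2) (ZMod 3) ⧸ J)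
      generalize Ideal.Quotient.mk J (X 0) = x at *
      generalize Ideal.Quotient.mk J (X 1) = y at *
      linear_combination -hfJ + (x ^ 2 + y ^ 2 + 3 * x * y - 2 * x - 2 * y + 2) * h3
    rw [Ideal.span_le]
    rintro z (rfl | rfl | rfl)
    · exact hfJ
    · exact J.mem_of_dvd (hpow _ _) hxJ
    · exact J.mem_of_dvd (hpow _ _) hyJ
  · set I := Ideal.span {((X 0 + X 1 + 1) * (X 0 * X 1 + X 0 + X 1) :
      MvPolynomial (Fin 2) (ZMod 3)), X 0 ^ (3 ^ k * n) - 1, X 1 ^ (3 ^ l * n) - 1} with hI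
    have hfI : ((X 0 + X 1 + 1) * (X 0 * X 1 + X 0 + X 1) : MvPolynomial (Fin 2) (ZMod 3)) ∈ I :=
      Ideal.subset_span (by simp)
    rw [Ideal.span_le]
    rintro z (rfl | rfl)
    · exact hfI
    have hxI : (X 0 ^ (3 ^ k * n) - 1 : MvPolynomial (Fin 2) (ZMod 3)) ∈ I :=
      Ideal.subset_span (by simp)
    have hyI : (X 1 ^ (3 ^ l * n) - 1 : MvPolynomial (Fin 2) (ZMod 3)) ∈ I :=
      Ideal.subset_span (by simp)
    rw [SetLike.mem_coe]
    rw [← Ideal.Quotient.eq_zero_iff_mem] at hfI hxI hyI ⊢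
    rcases subsingleton_or_nontrivial (MvPolynomial (Fin 2) (ZMod 3) ⧸ I)
    · exact Subsingleton.elim _ _
    have : CharP (MvPolynomial (Fin 2) (ZMod 3) ⧸ I) 3 :=
      charP_of_injective_algebraMap (algebraMap (ZMod 3) _).injective 3
    simp only [map_pow, map_mul, map_add, map_sub, map_one, sub_eq_zero] at hfI hxI hyI ⊢
    exact sub_one_pow_eq_zero hn hn3 hxI hyI hfI

theorem finrank_quotient_span_laplacian_swap (s t : ℕ) :
    Module.finrank (ZMod 3) (MvPolynomial (Fin 2) (ZMod 3) ⧸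
      Ideal.span {((X 0 + X 1 + 1) * (X 0 * X 1 + X 0 + X 1) : MvPolynomial (Fin 2) (ZMod 3)),
        X 0 ^ s - 1, X 1 ^ t - 1}) =
    Module.finrank (ZMod 3) (MvPolynomial (Fin 2) (ZMod 3) ⧸
      Ideal.span {((X 0 + X 1 + 1) * (X 0 * X 1 + X 0 + X 1) : MvPolynomial (Fin 2) (ZMod 3)),
        X 0 ^ t - 1, X 1 ^ s - 1}) := by
  refine (Ideal.quotientEquivAlg _ _ (renameEquiv (ZMod 3) (Equiv.swap (0 : Fin 2) 1))
    ?_).toLinearEquiv.finrank_eq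
  rw [Ideal.map_span]
  congr 1
  simp only [Set.image_insert_eq, Set.image_singleton, RingHom.coe_coe, renameEquiv_apply,
    map_mul, map_add, map_sub, map_pow, map_one, rename_X, Equiv.swap_apply_left,
    Equiv.swap_apply_right]
  rw [Set.pair_comm, add_comm (X 1 : MvPolynomial (Fin 2) (ZMod 3)) (X 0), mul_comm (X 1) (X 0),
    add_right_comm (X 0 * X 1) (X 1) (X 0)]

/-- For an odd prime `q ≠ 3`, an integer `m ≥ 0` such that `3` is a primitive root modulo
`q^m` whenever `m ≥ 1`, and nonnegative integers `kx, ky` with `max kx ky ≥ 1`, setting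
`Lx = 3^kx · q^m` and `Ly = 3^ky · q^m`, the dimension over `ZMod 3` of the quotient of
`(ZMod 3)[x,y]` by the ideal generated by the triangular-lattice Laplacian polynomial
`f = x²y + xy² + x² + y² + x + y - 6xy`, `x^Lx - 1`, and `y^Ly - 1`
equals `2 · 3^(min kx ky)`. -/
theorem triangular_laplacian_gsd_mod_three_general (q m : ℕ) (hq : q.Prime) (hqodd : Odd q)
    (hq3 : q ≠ 3)
    (hprim : 1 ≤ m → Nat.Coprime 3 (q ^ m) ∧
      orderOf ((3 : ℕ) : ZMod (q ^ m)) = Nat.totient (q ^ m))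
    (kx ky : ℕ) (hk : 1 ≤ max kx ky) :
    Module.finrank (ZMod 3)
      (MvPolynomial (Fin 2) (ZMod 3) ⧸
        Ideal.span {(X 0 ^ 2 * X 1 + X 0 * X 1 ^ 2 + X 0 ^ 2 + X 1 ^ 2 + X 0 + X 1
            - 6 * X 0 * X 1 : MvPolynomial (Fin 2) (ZMod 3)),
          X 0 ^ (3 ^ kx * q ^ m) - 1, X 1 ^ (3 ^ ky * q ^ m) - 1}) =
      2 * 3 ^ min kx ky := by
  have hq3' : Nat.Coprime 3 (q ^ m) :=
    Nat.Coprime.pow_right m ((Nat.coprime_primes Nat.prime_three hq).mpr hq3.symm)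
  obtain ⟨r, hr⟩ := exists_dvd_three_pow_add_one hq hprim
  rw [laplacian_eq_mul]
  rcases le_total kx ky with h | h
  · rw [span_laplacian_eq hr hq3' (by omega) h,
      finrank_quotient_span_laplacian (pow_ne_zero _ three_ne_zero), min_eq_left h]
  · rw [finrank_quotient_span_laplacian_swap, span_laplacian_eq hr hq3' (by omega) h,
      finrank_quotient_span_laplacian (pow_ne_zero _ three_ne_zero), min_eq_right h]
end

section
/- Let p be a prime with p > 3, q an odd prime distinct from p, and m ≥ 0 an integer such that, if m ≥ 1, then p is a primitive root modulo q^m. Let k_x, k_y be nonnegative integers, and set L_x = p^k_x · q^m and L_y = p^k_y · q^m. Then the dimension over ZMod p of (ZMod p)[x,y] / (f, x^L_x − 1, y^L_y − 1) equals 2 · p^(min(k_x,k_y)) − 1 if k_x = k_y, and 2 · p^(min(k_x,k_y)) if k_x ≠ k_y. -/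
open MvPolynomial

namespace TriangularLaplacian

open Finset in
open scoped Classical in
/-- Averaging over the translates `z * a ^ s` by a `q`-th root of unity `a`. -/
theorem sum_range_mul_pow_eq_ite {K : Type*} [Field K] {q : ℕ} (z : K) {a : K} (ha : a ^ q = 1) :
    ∑ s ∈ range q, z * a ^ s = if a = 1 then q * z else 0 := by
  rw [← mul_sum]
  split_ifs with h
  · simp [h, mul_comm]
  · rw [geom_sum_eq h, ha]; simp

/-- The sum of the six nearest-neighbour Laurent monomials of the triangular lattice. -/
def neighborSum {K : Type*} [Field K] (x y : K) : K :=
  x + x⁻¹ + y + y⁻¹ + x * y⁻¹ + y * x⁻¹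

theorem neighborSum_frobenius {K : Type*} [Field K] (p : ℕ) [Fact p.Prime] [CharP K p] {x y : K}
    (h : neighborSum x y = 6) (i : ℕ) : neighborSum (x ^ p ^ i) (y ^ p ^ i) = 6 := by
  have h6 : iterateFrobenius K p i 6 = 6 := map_ofNat _ 6
  rw [← h6, ← h]
  simp only [neighborSum, map_add, map_mul, map_inv₀]
  simp [iterateFrobenius_def]

theorem exists_pow_modEq_of_primitiveRoot {p n : ℕ} [NeZero n] (hc : p.Coprime n)
    (ho : orderOf (p : ZMod n) = n.totient) {t : ℕ} (ht : t.Coprime n) :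
    ∃ i, p ^ i ≡ t [MOD n] := by
  have ho' : orderOf (ZMod.unitOfCoprime p hc) = Nat.card (ZMod n)ˣ := by
    rw [← orderOf_units, Nat.card_eq_fintype_card, ZMod.card_units_eq_totient]
    simpa using ho
  have htop : Subgroup.zpowers (ZMod.unitOfCoprime p hc) = ⊤ :=
    (Subgroup.card_eq_iff_eq_top _).1 (by rw [Nat.card_zpowers, ho'])
  obtain ⟨i, hi⟩ := mem_powers_iff_mem_zpowers.2
    (htop ▸ Subgroup.mem_top (ZMod.unitOfCoprime t ht))
  refine ⟨i, ?_⟩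
  rw [← ZMod.natCast_eq_natCast_iff]
  simpa using congrArg Units.val hi

/-- An element of odd order differs from `-1`. -/
theorem ne_neg_one_of_pow_eq_one {K : Type*} [Field K] (h2 : (2 : K) ≠ 0) {n : ℕ} (hn : Odd n)
    {z : K} (hz : z ^ n = 1) : z ≠ -1 := by
  rintro rfl
  rw [hn.neg_one_pow] at hz
  exact h2 (by linear_combination -hz)

theorem eq_one_of_forall_neighborSum_eq {K : Type*} [Field K] {q : ℕ} (hq : q.Prime)
    (hqodd : Odd q) (h6 : (6 : K) ≠ 0) (hqK : (q : K) ≠ 0) {x y : K}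
    (h : ∀ t : ℕ, t.Coprime q → neighborSum (x ^ t) (y ^ t) = 6) (j : ℕ)
    (hx : x ^ q ^ j = 1) (hy : y ^ q ^ j = 1) : x = 1 ∧ y = 1 := by
  induction j with
  | zero => simpa using And.intro hx hy
  | succ j ih =>
    by_cases hX : x ^ q ^ j = 1 ∧ y ^ q ^ j = 1
    · exact ih hX.1 hX.2
    exfalso
    have h2 : (2 : K) ≠ 0 := fun h => h6 (by linear_combination 3 * h)
    have hodd : Odd (q ^ (j + 1)) := hqodd.pow
    have hx0 : x ≠ 0 := by rintro rfl; simp [hq.ne_zero] at hx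
    have hy0 : y ≠ 0 := by rintro rfl; simp [hq.ne_zero] at hy
    have hroot : ∀ z : K, z ^ q ^ (j + 1) = 1 → (z ^ q ^ j) ^ q = 1 := fun z hz => by
      rw [← pow_mul, ← pow_succ, hz]
    have hsum : ∑ s ∈ Finset.range q,
        neighborSum (x ^ (1 + q ^ j * s)) (y ^ (1 + q ^ j * s)) = 6 * q := by
      rw [Finset.sum_congr rfl (g := fun _ => (6 : K))]
      · simp [mul_comm]
      intro s _
      by_cases hc : (1 + q ^ j * s).Coprime q
      · exact h _ hc
      have hdvd : q ∣ 1 + q ^ j * s := by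
        by_contra hnd
        exact hc ((hq.coprime_iff_not_dvd.2 hnd).symm)
      rcases j with _ | j
      · obtain ⟨c, hc⟩ := hdvd
        simp only [zero_add, pow_one] at hx hy
        rw [hc, pow_mul, pow_mul, hx, hy]
        norm_num [neighborSum]
      · have : q ∣ 1 :=
          (Nat.dvd_add_left (Dvd.dvd.mul_right (dvd_pow_self q j.succ_ne_zero) s)).1 hdvd
        exact absurd (Nat.dvd_one.1 this) hq.ne_one
    have hexp : ∀ s, neighborSum (x ^ (1 + q ^ j * s)) (y ^ (1 + q ^ j * s)) =
        x * (x ^ q ^ j) ^ s + x⁻¹ * (x⁻¹ ^ q ^ j) ^ s + y * (y ^ q ^ j) ^ s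
        + y⁻¹ * (y⁻¹ ^ q ^ j) ^ s + (x * y⁻¹) * ((x * y⁻¹) ^ q ^ j) ^ s
        + (y * x⁻¹) * ((y * x⁻¹) ^ q ^ j) ^ s := fun s => by
      simp only [neighborSum, ← pow_mul, pow_add, pow_one, mul_pow, inv_pow, mul_inv]
      ring
    simp_rw [hexp, Finset.sum_add_distrib] at hsum
    rw [sum_range_mul_pow_eq_ite _ (hroot _ hx), sum_range_mul_pow_eq_ite _ (hroot _ hy),
      sum_range_mul_pow_eq_ite _ (hroot x⁻¹ (by simp [hx])),
      sum_range_mul_pow_eq_ite _ (hroot y⁻¹ (by simp [hy])),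
      sum_range_mul_pow_eq_ite _ (hroot (x * y⁻¹) (by simp [mul_pow, hx, hy])),
      sum_range_mul_pow_eq_ite _ (hroot (y * x⁻¹) (by simp [mul_pow, hx, hy]))] at hsum
    have hXY : (x * y⁻¹) ^ q ^ j = 1 ↔ x ^ q ^ j = y ^ q ^ j := by
      rw [mul_pow, inv_pow, mul_inv_eq_one₀ (pow_ne_zero _ hy0)]
    have hYX : (y * x⁻¹) ^ q ^ j = 1 ↔ x ^ q ^ j = y ^ q ^ j := by
      rw [mul_pow, inv_pow, mul_inv_eq_one₀ (pow_ne_zero _ hx0), eq_comm]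
    have hXi : x⁻¹ ^ q ^ j = 1 ↔ x ^ q ^ j = 1 := by rw [inv_pow, inv_eq_one]
    have hYi : y⁻¹ ^ q ^ j = 1 ↔ y ^ q ^ j = 1 := by rw [inv_pow, inv_eq_one]
    have h1 := h 1 (Nat.coprime_one_left q)
    simp only [pow_one, neighborSum] at h1
    by_cases hX1 : x ^ q ^ j = 1
    · have hY1 : y ^ q ^ j ≠ 1 := fun hY => hX ⟨hX1, hY⟩
      have hE : x ^ q ^ j ≠ y ^ q ^ j := fun hE => hY1 (hE.symm.trans hX1)
      rw [if_pos hX1, if_pos (hXi.2 hX1), if_neg hY1, if_neg (mt hYi.1 hY1), if_neg (mt hXY.1 hE),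
        if_neg (mt hYX.1 hE)] at hsum
      have hs : x + x⁻¹ = 6 := mul_left_cancel₀ hqK (by linear_combination hsum)
      have hf : (x + 1) * (y ^ 2 * x⁻¹ + 1) = 0 := by
        field_simp at h1 hs ⊢
        linear_combination h1 - y * hs
      rcases mul_eq_zero.1 hf with hf | hf
      · exact ne_neg_one_of_pow_eq_one h2 hodd hx (by linear_combination hf)
      · refine ne_neg_one_of_pow_eq_one h2 hodd (z := y ^ 2 * x⁻¹) ?_ (by linear_combination hf)
        rw [mul_pow, inv_pow, hx, pow_right_comm, hy]; simp
    by_cases hY1 : y ^ q ^ j = 1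
    · have hE : x ^ q ^ j ≠ y ^ q ^ j := fun hE => hX1 (hE.trans hY1)
      rw [if_neg hX1, if_neg (mt hXi.1 hX1), if_pos hY1, if_pos (hYi.2 hY1), if_neg (mt hXY.1 hE),
        if_neg (mt hYX.1 hE)] at hsum
      have hs : y + y⁻¹ = 6 := mul_left_cancel₀ hqK (by linear_combination hsum)
      have hf : (y + 1) * (x ^ 2 * y⁻¹ + 1) = 0 := by
        field_simp at h1 hs ⊢
        linear_combination h1 - x * hs
      rcases mul_eq_zero.1 hf with hf | hf
      · exact ne_neg_one_of_pow_eq_one h2 hodd hy (by linear_combination hf)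
      · refine ne_neg_one_of_pow_eq_one h2 hodd (z := x ^ 2 * y⁻¹) ?_ (by linear_combination hf)
        rw [mul_pow, inv_pow, hy, pow_right_comm, hx]; simp
    by_cases hE : x ^ q ^ j = y ^ q ^ j
    · rw [if_neg hX1, if_neg (mt hXi.1 hX1), if_neg hY1, if_neg (mt hYi.1 hY1), if_pos (hXY.2 hE),
        if_pos (hYX.2 hE)] at hsum
      have hs : x * y⁻¹ + y * x⁻¹ = 6 := mul_left_cancel₀ hqK (by linear_combination hsum)
      have hf : (x * y⁻¹ + 1) * (x * y + 1) = 0 := by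
        field_simp at h1 hs ⊢
        linear_combination h1 - hs
      rcases mul_eq_zero.1 hf with hf | hf
      · refine ne_neg_one_of_pow_eq_one h2 hodd (z := x * y⁻¹) ?_ (by linear_combination hf)
        simp [mul_pow, hx, hy]
      · refine ne_neg_one_of_pow_eq_one h2 hodd (z := x * y) ?_ (by linear_combination hf)
        simp [mul_pow, hx, hy]
    · rw [if_neg hX1, if_neg (mt hXi.1 hX1), if_neg hY1, if_neg (mt hYi.1 hY1), if_neg (mt hXY.1 hE),
        if_neg (mt hYX.1 hE)] at hsum
      exact mul_ne_zero h6 hqK (by linear_combination -hsum)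

/-- The torus zero locus of the Laplacian polynomial contains no nontrivial `q ^ m`-torsion point
when `p` is a primitive root modulo `q ^ m`. -/
theorem eq_one_of_laplacian_eq_zero {K : Type*} [Field K] {p q m : ℕ} (hp : p.Prime) (hp3 : 3 < p)
    [CharP K p] (hq : q.Prime) (hqodd : Odd q) (hqp : q ≠ p)
    (hprim : 1 ≤ m → Nat.Coprime p (q ^ m) ∧
      orderOf ((p : ℕ) : ZMod (q ^ m)) = Nat.totient (q ^ m)) {x y : K}
    (hx : x ^ q ^ m = 1) (hy : y ^ q ^ m = 1)
    (h : x ^ 2 * y + x * y ^ 2 + x ^ 2 + y ^ 2 + x + y - 6 * x * y = 0) : x = 1 ∧ y = 1 := by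
  have : Fact p.Prime := ⟨hp⟩
  have hqm : q ^ m ≠ 0 := pow_ne_zero _ hq.ne_zero
  have : NeZero (q ^ m) := ⟨hqm⟩
  have hx0 : x ≠ 0 := by rintro rfl; simp [zero_pow hqm] at hx
  have hy0 : y ≠ 0 := by rintro rfl; simp [zero_pow hqm] at hy
  have h6 : (6 : K) ≠ 0 := by
    intro h6
    have h6' : p ∣ 2 * 3 := (CharP.cast_eq_zero_iff K p 6).1 (by exact_mod_cast h6)
    rcases (hp.dvd_mul).1 h6' with hd | hd <;> have := Nat.le_of_dvd (by norm_num) hd <;> omega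
  have hqK : (q : K) ≠ 0 := by
    rw [Ne, CharP.cast_eq_zero_iff K p, Nat.prime_dvd_prime_iff_eq hp hq]
    exact hqp.symm
  have h1 : neighborSum x y = 6 := by
    unfold neighborSum
    field_simp
    linear_combination h
  rcases Nat.eq_zero_or_pos m with rfl | hm
  · simpa using And.intro hx hy
  refine eq_one_of_forall_neighborSum_eq hq hqodd h6 hqK (fun t ht => ?_) m hx hy
  obtain ⟨i, hi⟩ := exists_pow_modEq_of_primitiveRoot (hprim hm).1 (hprim hm).2 (ht.pow_right m)
  have := neighborSum_frobenius p h1 i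
  rwa [pow_eq_pow_of_modEq hi hx, pow_eq_pow_of_modEq hi hy] at this

theorem isUnit_geom_sum {B : Type*} [CommRing B] {p q m : ℕ} [Algebra (ZMod p) B] (hp : p.Prime)
    (hp3 : 3 < p) (hq : q.Prime) (hqodd : Odd q) (hqp : q ≠ p)
    (hprim : 1 ≤ m → Nat.Coprime p (q ^ m) ∧
      orderOf ((p : ℕ) : ZMod (q ^ m)) = Nat.totient (q ^ m)) {kx ky : ℕ} {x y : B}
    (hx : x ^ (p ^ kx * q ^ m) = 1) (hy : y ^ (p ^ ky * q ^ m) = 1)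
    (h : x ^ 2 * y + x * y ^ 2 + x ^ 2 + y ^ 2 + x + y - 6 * x * y = 0) :
    IsUnit (∑ i ∈ Finset.range (q ^ m), x ^ i) := by
  have : Fact p.Prime := ⟨hp⟩
  by_contra hnu
  obtain ⟨M, hM, hmem⟩ := exists_max_ideal_of_mem_nonunits hnu
  let := Ideal.Quotient.field M
  have : CharP (B ⧸ M) p :=
    charP_of_injective_algebraMap (algebraMap (ZMod p) (B ⧸ M)).injective p
  have hroot : ∀ {z : B ⧸ M} {k : ℕ}, z ^ (p ^ k * q ^ m) = 1 → z ^ q ^ m = 1 := by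
    intro z k hz
    rw [mul_comm, pow_mul] at hz
    have : (z ^ q ^ m - 1) ^ p ^ k = 0 := by rw [sub_pow_char_pow, hz, one_pow, sub_self]
    exact sub_eq_zero.1 (eq_zero_of_pow_eq_zero this)
  let π := Ideal.Quotient.mk M
  have hxy := eq_one_of_laplacian_eq_zero hp hp3 hq hqodd hqp hprim (x := π x) (y := π y)
    (hroot (by rw [← map_pow, hx, map_one])) (hroot (by rw [← map_pow, hy, map_one]))
    (by simpa only [map_sub, map_add, map_mul, map_pow, map_zero, map_ofNat] using congrArg π h)
  have h0 := Ideal.Quotient.eq_zero_iff_mem.2 hmem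
  change π _ = 0 at h0
  simp only [map_sum, map_pow, hxy.1, one_pow, Finset.sum_const, Finset.card_range, nsmul_eq_mul,
    mul_one] at h0
  rw [CharP.cast_eq_zero_iff (B ⧸ M) p] at h0
  exact hqp ((Nat.prime_dvd_prime_iff_eq hp hq).1 (hp.dvd_of_dvd_pow h0)).symm

theorem sub_one_pow_mul_geom_sum_pow {B : Type*} [CommRing B] {p : ℕ} [Fact p.Prime] [CharP B p]
    (x : B) (k n : ℕ) :
    (x - 1) ^ p ^ k * (∑ i ∈ Finset.range n, x ^ i) ^ p ^ k = x ^ (p ^ k * n) - 1 := by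
  rw [← mul_pow, mul_geom_sum, sub_pow_char_pow, one_pow, ← pow_mul, mul_comm]

theorem sub_one_pow_eq_zero {B : Type*} [CommRing B] {p q m : ℕ} [Algebra (ZMod p) B]
    (hp : p.Prime) (hp3 : 3 < p) (hq : q.Prime) (hqodd : Odd q) (hqp : q ≠ p)
    (hprim : 1 ≤ m → Nat.Coprime p (q ^ m) ∧
      orderOf ((p : ℕ) : ZMod (q ^ m)) = Nat.totient (q ^ m)) {kx ky : ℕ} {x y : B}
    (hx : x ^ (p ^ kx * q ^ m) = 1) (hy : y ^ (p ^ ky * q ^ m) = 1)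
    (h : x ^ 2 * y + x * y ^ 2 + x ^ 2 + y ^ 2 + x + y - 6 * x * y = 0) :
    (x - 1) ^ p ^ kx = 0 := by
  have : Fact p.Prime := ⟨hp⟩
  nontriviality B
  have : CharP B p := charP_of_injective_algebraMap (algebraMap (ZMod p) B).injective p
  have hu := (isUnit_geom_sum hp hp3 hq hqodd hqp hprim hx hy h).pow (p ^ kx)
  rw [← hu.mul_left_eq_zero, sub_one_pow_mul_geom_sum_pow, hx, sub_self]

/-- The ideal defining the finite scheme is unchanged by dropping the prime-to-`p` parts of the
side lengths. -/
theorem span_laplacian_eq {p q m : ℕ} (hp : p.Prime)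
    (hp3 : 3 < p) (hq : q.Prime) (hqodd : Odd q) (hqp : q ≠ p)
    (hprim : 1 ≤ m → Nat.Coprime p (q ^ m) ∧
      orderOf ((p : ℕ) : ZMod (q ^ m)) = Nat.totient (q ^ m)) (kx ky : ℕ) :
    Ideal.span {(X 0 ^ 2 * X 1 + X 0 * X 1 ^ 2 + X 0 ^ 2 + X 1 ^ 2 + X 0 + X 1
            - 6 * X 0 * X 1 : MvPolynomial (Fin 2) (ZMod p)),
          X 0 ^ (p ^ kx * q ^ m) - 1, X 1 ^ (p ^ ky * q ^ m) - 1} =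
    Ideal.span {(X 0 ^ 2 * X 1 + X 0 * X 1 ^ 2 + X 0 ^ 2 + X 1 ^ 2 + X 0 + X 1
            - 6 * X 0 * X 1 : MvPolynomial (Fin 2) (ZMod p)),
          (X 0 - 1) ^ p ^ kx, (X 1 - 1) ^ p ^ ky} := by
  have : Fact p.Prime := ⟨hp⟩
  apply le_antisymm
  · rw [Ideal.span_le]
    rintro z (rfl | rfl | rfl)
    · exact Ideal.subset_span (by simp)
    all_goals
      rw [← sub_one_pow_mul_geom_sum_pow]
      exact Ideal.mul_mem_right _ _ (Ideal.subset_span (by simp))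
  · generalize hI : Ideal.span {(X 0 ^ 2 * X 1 + X 0 * X 1 ^ 2 + X 0 ^ 2 + X 1 ^ 2 + X 0 + X 1
            - 6 * X 0 * X 1 : MvPolynomial (Fin 2) (ZMod p)),
          X 0 ^ (p ^ kx * q ^ m) - 1, X 1 ^ (p ^ ky * q ^ m) - 1} = I
    have hf := Ideal.Quotient.eq_zero_iff_mem.2 (hI ▸ Ideal.subset_span (by simp) :
      (X 0 ^ 2 * X 1 + X 0 * X 1 ^ 2 + X 0 ^ 2 + X 1 ^ 2 + X 0 + X 1
            - 6 * X 0 * X 1 : MvPolynomial (Fin 2) (ZMod p)) ∈ I)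
    have hx := Ideal.Quotient.eq_zero_iff_mem.2 (hI ▸ Ideal.subset_span (by simp) :
      (X 0 ^ (p ^ kx * q ^ m) - 1 : MvPolynomial (Fin 2) (ZMod p)) ∈ I)
    have hy := Ideal.Quotient.eq_zero_iff_mem.2 (hI ▸ Ideal.subset_span (by simp) :
      (X 1 ^ (p ^ ky * q ^ m) - 1 : MvPolynomial (Fin 2) (ZMod p)) ∈ I)
    simp only [map_sub, map_add, map_mul, map_pow, map_one, map_ofNat] at hf hx hy
    rw [sub_eq_zero] at hx hy
    rw [Ideal.span_le]
    rintro z (rfl | rfl | rfl)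
    · exact hI ▸ Ideal.subset_span (by simp)
    · rw [SetLike.mem_coe, ← Ideal.Quotient.eq_zero_iff_mem, map_pow, map_sub, map_one]
      exact sub_one_pow_eq_zero hp hp3 hq hqodd hqp hprim hx hy hf
    · rw [SetLike.mem_coe, ← Ideal.Quotient.eq_zero_iff_mem, map_pow, map_sub, map_one]
      exact sub_one_pow_eq_zero hp hp3 hq hqodd hqp hprim hy hx (by linear_combination hf)


/-- The equation of the Laplacian curve in the second coordinate `v = y - 1`, made monic over
`k[u] / (u ^ P)` with `u = x - 1` by the inverse `c` of its leading coefficient `2 + u`. -/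
noncomputable def localEquation {k : Type*} [Field k] {P : ℕ}
    (c : AdjoinRoot (Polynomial.X ^ P : Polynomial k)) :
    Polynomial (AdjoinRoot (Polynomial.X ^ P : Polynomial k)) :=
  Polynomial.X ^ 2 +
    (Polynomial.C (c * (AdjoinRoot.root (Polynomial.X ^ P) ^ 2 -
        2 * AdjoinRoot.root (Polynomial.X ^ P))) * Polynomial.X +
      Polynomial.C (2 * c * AdjoinRoot.root (Polynomial.X ^ P) ^ 2))

section LocalRing

variable {S : Type*} [CommRing S] {u v c : S}

theorem exists_pow_succ_eq (hc : c * (2 + u) = 1)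
    (hv : (2 + u) * v ^ 2 = (2 * u - u ^ 2) * v - 2 * u ^ 2) (n : ℕ) :
    ∃ a b, v ^ (n + 1) = a * (u ^ n * v) + b * u ^ (n + 1) := by
  induction n with
  | zero => exact ⟨1, 0, by ring⟩
  | succ n ih =>
    obtain ⟨a, b, h⟩ := ih
    refine ⟨a * c * (2 - u) + b, -2 * a * c, ?_⟩
    rw [pow_succ, h]
    linear_combination a * u ^ n * c * hv - a * u ^ n * v ^ 2 * hc

theorem pow_eq_zero_of_lt (hc : c * (2 + u) = 1)
    (hv : (2 + u) * v ^ 2 = (2 * u - u ^ 2) * v - 2 * u ^ 2) {P Q : ℕ} (hu : u ^ P = 0)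
    (hPQ : P < Q) : v ^ Q = 0 := by
  obtain ⟨n, rfl⟩ := Nat.exists_eq_add_one_of_ne_zero (Nat.ne_zero_of_lt hPQ)
  obtain ⟨a, b, h⟩ := exists_pow_succ_eq hc hv n
  rw [h, pow_eq_zero_of_le (by omega) hu, pow_eq_zero_of_le (by omega) hu]
  ring

theorem exists_isUnit_pow_eq (hc : c * (2 + u) = 1)
    (hv : (2 + u) * v ^ 2 = (2 * u - u ^ 2) * v - 2 * u ^ 2) {P : ℕ} (hu : u ^ P = 0)
    (h3 : ¬ 3 ∣ P) : ∃ e : S, IsUnit e ∧ v ^ P = e * (u ^ (P - 1) * v) := by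
  have hun : IsNilpotent u := ⟨P, hu⟩
  have hvn : IsNilpotent v := ⟨P + 1, pow_eq_zero_of_lt hc hv hu (Nat.lt_succ_self P)⟩
  have hv2 : v ^ 2 = c * ((2 * u - u ^ 2) * v - 2 * u ^ 2) := by
    linear_combination c * hv - v ^ 2 * hc
  set α := c * (2 - u) with hα
  have hα1 : α = -2 * c * u + 1 := by rw [hα]; linear_combination hc
  have hβ1 : 2 * c = -c * u + 1 := by linear_combination hc
  have hαu : IsUnit α := by
    rw [hα1]
    exact (Commute.isNilpotent_mul_left (Commute.all _ _) hun).isUnit_add_one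
  set ε := (-3 * c + 4 * c ^ 2 * u) * v - α * (2 * c) with hε
  have hεu : IsUnit ε := by
    have h1 : ε = -(α * (2 * c)) + (-3 * c + 4 * c ^ 2 * u) * v := by rw [hε]; ring
    have h2 : IsUnit (2 * c) := by
      rw [hβ1]
      exact (Commute.isNilpotent_mul_left (Commute.all _ _) hun).isUnit_add_one
    rw [h1]
    exact (Commute.isNilpotent_mul_left (Commute.all _ _) hvn).isUnit_add_left_of_commute
      (hαu.mul h2).neg (Commute.all _ _)
  have hvα : v ^ 2 = α * u * v - 2 * c * u ^ 2 := by rw [hv2]; ring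
  have hv3 : v ^ 3 = u ^ 3 * ε := by
    have : v ^ 3 = (α ^ 2 - 2 * c) * u ^ 2 * v - α * (2 * c) * u ^ 3 := by
      linear_combination (v + α * u) * hvα
    rw [this, hε]
    linear_combination (α + 1 - 2 * c * u) * u ^ 2 * v * hα1 - u ^ 2 * v * hβ1
  obtain ⟨n, hn⟩ : ∃ n, P = 3 * n + 1 ∨ P = 3 * n + 2 := ⟨P / 3, by omega⟩
  rcases hn with rfl | rfl
  · refine ⟨ε ^ n, hεu.pow n, ?_⟩
    rw [pow_succ, pow_mul, hv3, mul_pow, ← pow_mul]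
    simp only [Nat.add_sub_cancel]
    ring
  · refine ⟨ε ^ n * α, (hεu.pow n).mul hαu, ?_⟩
    rw [pow_add, pow_mul, hv3, hvα, mul_pow, ← pow_mul]
    have : 3 * n + 2 - 1 = 3 * n + 1 := by omega
    rw [this]
    linear_combination -2 * c * ε ^ n * hu

end LocalRing

section Model

open AdjoinRoot
open Polynomial (monic_X_pow)

variable {k : Type*} [Field k] {P : ℕ} {c : AdjoinRoot (Polynomial.X ^ P : Polynomial k)}

theorem nontrivial_truncated (hP : 0 < P) :
    Nontrivial (AdjoinRoot (Polynomial.X ^ P : Polynomial k)) :=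
  AdjoinRoot.nontrivial _ (by simp [hP.ne'])

theorem monic_localEquation : (localEquation c).Monic :=
  Polynomial.monic_X_pow_add Polynomial.degree_linear_lt

theorem natDegree_localEquation (hP : 0 < P) : (localEquation c).natDegree = 2 := by
  have := nontrivial_truncated (k := k) hP
  refine Polynomial.natDegree_eq_of_degree_eq_some ?_
  rw [localEquation, Polynomial.degree_add_eq_left_of_degree_lt, Polynomial.degree_X_pow]
  exact Polynomial.degree_linear_lt.trans_eq (Polynomial.degree_X_pow 2).symm

theorem eval₂_localEquation {T : Type*} [CommRing T]
    (φ : AdjoinRoot (Polynomial.X ^ P : Polynomial k) →+* T) (z : T) :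
    (localEquation c).eval₂ φ z =
      z ^ 2 + (φ c * (φ (root (Polynomial.X ^ P)) ^ 2 - 2 * φ (root (Polynomial.X ^ P))) * z +
        2 * φ c * φ (root (Polynomial.X ^ P)) ^ 2) := by
  simp only [localEquation, Polynomial.eval₂_add, Polynomial.eval₂_mul, Polynomial.eval₂_pow,
    Polynomial.eval₂_X, Polynomial.eval₂_C, map_mul φ, map_sub φ, map_pow φ, map_ofNat φ]

theorem finite_model : Module.Finite k (AdjoinRoot (localEquation c)) := by
  have : Module.Finite k (AdjoinRoot (Polynomial.X ^ P : Polynomial k)) :=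
    (monic_X_pow P).finite_adjoinRoot
  have : Module.Finite (AdjoinRoot (Polynomial.X ^ P : Polynomial k))
      (AdjoinRoot (localEquation c)) :=
    monic_localEquation.finite_adjoinRoot
  exact Module.Finite.trans (AdjoinRoot (Polynomial.X ^ P : Polynomial k)) _

theorem finrank_model (hP : 0 < P) :
    Module.finrank k (AdjoinRoot (localEquation c)) = 2 * P := by
  have := nontrivial_truncated (k := k) hP
  have : Module.Free (AdjoinRoot (Polynomial.X ^ P : Polynomial k))
      (AdjoinRoot (localEquation c)) :=
    monic_localEquation.free_adjoinRoot
  rw [← Module.finrank_mul_finrank k (AdjoinRoot (Polynomial.X ^ P : Polynomial k)),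
    (powerBasis' monic_localEquation).finrank, (powerBasis' (monic_X_pow P)).finrank,
    powerBasis'_dim, powerBasis'_dim, natDegree_localEquation hP, Polynomial.natDegree_X_pow,
    mul_comm]

theorem of_root_pow : of (localEquation c) (root (Polynomial.X ^ P)) ^ P = 0 := by
  have h : root (Polynomial.X ^ P : Polynomial k) ^ P = 0 := by
    rw [← mk_X, ← map_pow, mk_self]
  rw [← map_pow, h, map_zero]

theorem root_localEquation (hc : c * (2 + root (Polynomial.X ^ P)) = 1) :
    (2 + of (localEquation c) (root (Polynomial.X ^ P))) * root (localEquation c) ^ 2 =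
      (2 * of (localEquation c) (root (Polynomial.X ^ P)) -
        of (localEquation c) (root (Polynomial.X ^ P)) ^ 2) * root (localEquation c) -
        2 * of (localEquation c) (root (Polynomial.X ^ P)) ^ 2 := by
  have h := eval₂_root (localEquation c)
  have hc' := congrArg (of (localEquation c)) hc
  rw [eval₂_localEquation] at h
  generalize of (localEquation c) = φ at *
  simp only [map_mul φ, map_add φ, map_ofNat φ, map_one φ] at hc'
  linear_combination (2 + φ (root (Polynomial.X ^ P))) * h - (((φ (root (Polynomial.X ^ P))) ^ 2 -
    2 * φ (root (Polynomial.X ^ P))) * root (localEquation c) +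
      2 * φ (root (Polynomial.X ^ P)) ^ 2) * hc'

theorem socle_ne_zero (hP : 0 < P) :
    of (localEquation c) (root (Polynomial.X ^ P)) ^ (P - 1) * root (localEquation c) ≠ 0 := by
  have := nontrivial_truncated (k := k) hP
  have hr : root (Polynomial.X ^ P : Polynomial k) ^ (P - 1) ≠ 0 := by
    rw [← mk_X, ← map_pow]
    refine mk_ne_zero_of_natDegree_lt (monic_X_pow P) (by simp) ?_
    rw [Polynomial.natDegree_X_pow, Polynomial.natDegree_X_pow]
    omega
  rw [← map_pow, ← mk_C, ← mk_X (f := localEquation c), ← map_mul]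
  refine mk_ne_zero_of_natDegree_lt monic_localEquation ?_ ?_
  · rw [Polynomial.C_mul_X_eq_monomial]
    exact mt (Polynomial.monomial_eq_zero_iff _ _).1 hr
  · rw [Polynomial.natDegree_C_mul_X _ hr, natDegree_localEquation hP]
    norm_num

/-- The finite scheme cut out of the Laplacian curve by `(x - 1) ^ P` and `(y - 1) ^ Q` is the
quotient of the model by `v ^ Q`. -/
theorem nonempty_quotient_equiv_model (hc : c * (2 + root (Polynomial.X ^ P)) = 1) (Q : ℕ) :
    Nonempty ((MvPolynomial (Fin 2) k ⧸
      Ideal.span {(X 0 ^ 2 * X 1 + X 0 * X 1 ^ 2 + X 0 ^ 2 + X 1 ^ 2 + X 0 + X 1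
        - 6 * X 0 * X 1 : MvPolynomial (Fin 2) k), (X 0 - 1) ^ P, (X 1 - 1) ^ Q}) ≃ₐ[k]
      (AdjoinRoot (localEquation c) ⧸ Ideal.span {root (localEquation c) ^ Q})) := by
  have hroot := root_localEquation hc
  have hpow := of_root_pow (c := c)
  generalize hJ : Ideal.span {(X 0 ^ 2 * X 1 + X 0 * X 1 ^ 2 + X 0 ^ 2 + X 1 ^ 2 + X 0 + X 1
        - 6 * X 0 * X 1 : MvPolynomial (Fin 2) k), (X 0 - 1) ^ P, (X 1 - 1) ^ Q} = J
  let N := Ideal.span {root (localEquation c) ^ Q}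
  let φ : MvPolynomial (Fin 2) k →ₐ[k] AdjoinRoot (localEquation c) :=
    aeval ![1 + of (localEquation c) (root (Polynomial.X ^ P)), 1 + root (localEquation c)]
  have hφ0 : φ (X 0) = 1 + of (localEquation c) (root (Polynomial.X ^ P)) := by simp [φ]
  have hφ1 : φ (X 1) = 1 + root (localEquation c) := by simp [φ]
  let Φ : (MvPolynomial (Fin 2) k ⧸ J) →ₐ[k] (AdjoinRoot (localEquation c) ⧸ N) :=
    Ideal.Quotient.liftₐ J ((Ideal.Quotient.mkₐ k N).comp φ) (by
      have hle : J ≤ RingHom.ker ((Ideal.Quotient.mkₐ k N).comp φ) := by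
        rw [← hJ, Ideal.span_le]
        rintro z (rfl | rfl | rfl) <;>
          rw [SetLike.mem_coe, RingHom.mem_ker, AlgHom.comp_apply]
        · refine (congrArg (Ideal.Quotient.mkₐ k N) (?_ : φ _ = 0)).trans (map_zero _)
          simp only [map_sub, map_add, map_mul, map_pow, map_ofNat, hφ0, hφ1]
          linear_combination hroot
        · rw [map_pow φ, map_sub, map_one, hφ0, add_sub_cancel_left, hpow, map_zero]
        · rw [map_pow φ, map_sub, map_one, hφ1, add_sub_cancel_left]
          exact Ideal.Quotient.eq_zero_iff_mem.2 (Ideal.subset_span rfl)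
      exact fun a ha => hle ha)
  have hf := Ideal.Quotient.eq_zero_iff_mem.2 (hJ ▸ Ideal.subset_span (by simp) :
      (X 0 ^ 2 * X 1 + X 0 * X 1 ^ 2 + X 0 ^ 2 + X 1 ^ 2 + X 0 + X 1
            - 6 * X 0 * X 1 : MvPolynomial (Fin 2) k) ∈ J)
  have hx := Ideal.Quotient.eq_zero_iff_mem.2 (hJ ▸ Ideal.subset_span (by simp) :
      ((X 0 - 1) ^ P : MvPolynomial (Fin 2) k) ∈ J)
  have hy := Ideal.Quotient.eq_zero_iff_mem.2 (hJ ▸ Ideal.subset_span (by simp) :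
      ((X 1 - 1) ^ Q : MvPolynomial (Fin 2) k) ∈ J)
  simp only [map_sub, map_add, map_mul, map_pow, map_one, map_ofNat] at hf hx hy
  let ρ : AdjoinRoot (Polynomial.X ^ P : Polynomial k) →ₐ[k] (MvPolynomial (Fin 2) k ⧸ J) :=
    liftAlgHom _ (Algebra.ofId k _) (Ideal.Quotient.mk J (X 0) - 1) (by simp [hx])
  have hρ : ρ (root (Polynomial.X ^ P)) = Ideal.Quotient.mk J (X 0) - 1 := liftAlgHom_root ..
  have hρc := congrArg ρ hc
  simp only [map_mul, map_add, map_ofNat, map_one, hρ] at hρc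
  let σ : AdjoinRoot (localEquation c) →ₐ[k] (MvPolynomial (Fin 2) k ⧸ J) :=
    liftAlgHom _ ρ (Ideal.Quotient.mk J (X 1) - 1) (by
      rw [eval₂_localEquation]
      simp only [RingHom.coe_coe, hρ]
      set x := Ideal.Quotient.mk J (X 0)
      set y := Ideal.Quotient.mk J (X 1)
      linear_combination ρ c * hf - (y - 1) ^ 2 * hρc)
  have hσ1 : σ (root (localEquation c)) = Ideal.Quotient.mk J (X 1) - 1 := liftAlgHom_root ..
  have hσ0 : ∀ r, σ (of (localEquation c) r) = ρ r := fun r => liftAlgHom_of ..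
  let Ψ : (AdjoinRoot (localEquation c) ⧸ N) →ₐ[k] (MvPolynomial (Fin 2) k ⧸ J) :=
    Ideal.Quotient.liftₐ N σ (by
      have hle : N ≤ RingHom.ker σ := by
        rw [Ideal.span_le]
        rintro z rfl
        rw [SetLike.mem_coe, RingHom.mem_ker, map_pow, hσ1, hy]
      exact fun a ha => hle ha)
  have hΦ : ∀ a, Φ (Ideal.Quotient.mk J a) = Ideal.Quotient.mk N (φ a) := fun a => rfl
  have hΨ : ∀ a, Ψ (Ideal.Quotient.mk N a) = σ a := fun a => rfl
  refine ⟨AlgEquiv.ofAlgHom Φ Ψ ?_ ?_⟩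
  · apply Ideal.Quotient.algHom_ext
    apply AdjoinRoot.algHom_ext'
    · apply AdjoinRoot.algHom_ext
      change Φ (Ψ (Ideal.Quotient.mk N (of _ (root _)))) = Ideal.Quotient.mk N (of _ (root _))
      rw [hΨ, hσ0, hρ, map_sub, map_one, hΦ, hφ0, map_add, map_one, add_sub_cancel_left]
    · change Φ (Ψ (Ideal.Quotient.mk N (root _))) = Ideal.Quotient.mk N (root _)
      rw [hΨ, hσ1, map_sub, map_one, hΦ, hφ1, map_add, map_one, add_sub_cancel_left]
  · apply Ideal.Quotient.algHom_ext
    apply MvPolynomial.algHom_ext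
    intro i
    change Ψ (Φ (Ideal.Quotient.mk J (X i))) = Ideal.Quotient.mk J (X i)
    rw [hΦ]
    fin_cases i
    · change Ψ (Ideal.Quotient.mk N (φ (X 0))) = Ideal.Quotient.mk J (X 0)
      rw [hφ0, hΨ, map_add, map_one, hσ0, hρ, add_sub_cancel]
    · change Ψ (Ideal.Quotient.mk N (φ (X 1))) = Ideal.Quotient.mk J (X 1)
      rw [hφ1, hΨ, map_add, map_one, hσ1, add_sub_cancel]

/-- The ideal of the model generated by `u ^ (P - 1) * v` is one-dimensional. -/
theorem finrank_span_socle (hP : 0 < P) (hc : c * (2 + root (Polynomial.X ^ P)) = 1) :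
    Module.finrank k ((Ideal.span {of (localEquation c) (root (Polynomial.X ^ P)) ^ (P - 1) *
      root (localEquation c)}).restrictScalars k) = 1 := by
  have hne := socle_ne_zero (c := c) hP
  have hroot := root_localEquation hc
  have hpow := of_root_pow (c := c)
  have hc' : of (localEquation c) c * (2 + of (localEquation c) (root (Polynomial.X ^ P))) = 1 := by
    have := congrArg (of (localEquation c)) hc
    simpa only [map_mul, map_add, map_ofNat, map_one] using this
  have hexp : ∀ z : AdjoinRoot (localEquation c), z ^ P = z ^ (P - 1) * z := fun z => by
    rw [← pow_succ, Nat.sub_add_cancel hP]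
  rw [hexp] at hpow
  have key : ∀ s : AdjoinRoot (localEquation c), ∃ (a : k) (r t : AdjoinRoot (localEquation c)),
      s = algebraMap k _ a + of (localEquation c) (root (Polynomial.X ^ P)) * r +
        root (localEquation c) * t := by
    intro s
    induction s using AdjoinRoot.induction_on with
    | ih f =>
      obtain ⟨r, hr⟩ := AdjoinRoot.mk_surjective (f.coeff 0)
      refine ⟨r.coeff 0, of _ (mk _ r.divX), mk _ f.divX, ?_⟩
      have hr' := congrArg (mk (Polynomial.X ^ P)) (Polynomial.X_mul_divX_add r)
      have hf := congrArg (mk (localEquation c)) (Polynomial.X_mul_divX_add f)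
      rw [map_add, map_mul, mk_X, mk_C] at hr' hf
      rw [← hf, ← hr, ← hr', map_add, map_mul]
      have : algebraMap k (AdjoinRoot (localEquation c)) (r.coeff 0) =
        of (localEquation c) (of (Polynomial.X ^ P) (r.coeff 0)) := rfl
      rw [this]
      ring
  generalize of (localEquation c) (root (Polynomial.X ^ P)) = u at *
  generalize root (localEquation c) = v at *
  generalize of (localEquation c) c = d at *
  have huw : u * (u ^ (P - 1) * v) = 0 := by linear_combination v * hpow
  have hvw : v * (u ^ (P - 1) * v) = 0 := by
    linear_combination (d * ((2 - u) * v - 2 * u)) * hpow + d * u ^ (P - 1) * hroot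
      - u ^ (P - 1) * v ^ 2 * hc'
  have hspan : (Ideal.span {u ^ (P - 1) * v}).restrictScalars k =
      Submodule.span k {u ^ (P - 1) * v} := by
    ext z
    rw [Submodule.restrictScalars_mem, Ideal.mem_span_singleton', Submodule.mem_span_singleton]
    constructor
    · rintro ⟨s, rfl⟩
      obtain ⟨a, r, t, rfl⟩ := key s
      refine ⟨a, ?_⟩
      rw [Algebra.smul_def]
      linear_combination -r * huw - t * hvw
    · rintro ⟨a, rfl⟩
      exact ⟨algebraMap k _ a, (Algebra.smul_def _ _).symm⟩
  rw [hspan, finrank_span_singleton hne]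

theorem finrank_model_quotient_add (hP : 0 < P) (N : Ideal (AdjoinRoot (localEquation c))) :
    Module.finrank k (AdjoinRoot (localEquation c) ⧸ N) +
      Module.finrank k (N.restrictScalars k) = 2 * P := by
  have := finite_model (c := c)
  rw [← finrank_model hP (c := c),
    ← Submodule.finrank_quotient_add_finrank (N.restrictScalars k),
    (Submodule.Quotient.restrictScalarsEquiv k N).finrank_eq]

theorem finrank_quotient_of_le (h2 : (2 : k) ≠ 0) (hP : 0 < P) {Q : ℕ} (hPQ : P ≤ Q)
    (h3 : ¬ 3 ∣ P) :
    Module.finrank k (MvPolynomial (Fin 2) k ⧸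
      Ideal.span {(X 0 ^ 2 * X 1 + X 0 * X 1 ^ 2 + X 0 ^ 2 + X 1 ^ 2 + X 0 + X 1
        - 6 * X 0 * X 1 : MvPolynomial (Fin 2) k), (X 0 - 1) ^ P, (X 1 - 1) ^ Q}) =
      if P = Q then 2 * P - 1 else 2 * P := by
  obtain ⟨c, hc⟩ : ∃ c, c * (2 + root (Polynomial.X ^ P : Polynomial k)) = 1 := by
    have hnil : IsNilpotent (root (Polynomial.X ^ P : Polynomial k)) :=
      ⟨P, by rw [← mk_X, ← map_pow, mk_self]⟩
    have hu : IsUnit (2 : AdjoinRoot (Polynomial.X ^ P : Polynomial k)) := by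
      have := (IsUnit.mk0 _ h2).map (of (Polynomial.X ^ P : Polynomial k))
      rwa [map_ofNat] at this
    exact (hnil.isUnit_add_left_of_commute hu (Commute.all _ _)).exists_left_inv
  have hc' : of (localEquation c) c * (2 + of (localEquation c) (root (Polynomial.X ^ P))) = 1 := by
    have := congrArg (of (localEquation c)) hc
    simpa only [map_mul, map_add, map_ofNat, map_one] using this
  obtain ⟨e⟩ := nonempty_quotient_equiv_model hc Q
  have hadd := finrank_model_quotient_add hP (Ideal.span {root (localEquation c) ^ Q})
  rw [e.toLinearEquiv.finrank_eq]
  split_ifs with h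
  · subst h
    obtain ⟨ε, hε, h⟩ := exists_isUnit_pow_eq hc' (root_localEquation hc) of_root_pow h3
    have hN : Ideal.span {root (localEquation c) ^ P} = Ideal.span
        {of (localEquation c) (root (Polynomial.X ^ P)) ^ (P - 1) * root (localEquation c)} := by
      rw [h, Ideal.span_singleton_mul_left_unit hε]
    rw [hN] at hadd ⊢
    rw [finrank_span_socle hP hc] at hadd
    omega
  · have hN : Ideal.span {root (localEquation c) ^ Q} = ⊥ := by
      rw [pow_eq_zero_of_lt hc' (root_localEquation hc) of_root_pow (lt_of_le_of_ne hPQ h)]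
      simp
    rw [hN] at hadd ⊢
    rwa [Submodule.restrictScalars_bot, finrank_bot, add_zero] at hadd

end Model

theorem finrank_quotient_swap (k : Type*) [Field k] (P Q : ℕ) :
    Module.finrank k (MvPolynomial (Fin 2) k ⧸
      Ideal.span {(X 0 ^ 2 * X 1 + X 0 * X 1 ^ 2 + X 0 ^ 2 + X 1 ^ 2 + X 0 + X 1
        - 6 * X 0 * X 1 : MvPolynomial (Fin 2) k), (X 0 - 1) ^ P, (X 1 - 1) ^ Q}) =
    Module.finrank k (MvPolynomial (Fin 2) k ⧸
      Ideal.span {(X 0 ^ 2 * X 1 + X 0 * X 1 ^ 2 + X 0 ^ 2 + X 1 ^ 2 + X 0 + X 1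
        - 6 * X 0 * X 1 : MvPolynomial (Fin 2) k), (X 0 - 1) ^ Q, (X 1 - 1) ^ P}) := by
  refine (Ideal.quotientEquivAlg _ _ (renameEquiv k (Equiv.swap 0 1)) ?_).toLinearEquiv.finrank_eq
  rw [Ideal.map_span, Set.image_insert_eq, Set.image_pair, Set.pair_comm]
  congr 2
  · simp only [RingHom.coe_coe, renameEquiv_apply, map_sub, map_add, map_mul, map_pow, map_ofNat,
      rename_X, Equiv.swap_apply_left, Equiv.swap_apply_right]
    ring
  · simp

end TriangularLaplacian

/-- For a prime `p > 3`, an odd prime `q ≠ p`, an integer `m ≥ 0` such that `p` is a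
primitive root modulo `q^m` whenever `m ≥ 1`, and nonnegative integers `kx, ky`, setting
`Lx = p^kx · q^m` and `Ly = p^ky · q^m`, the dimension over `ZMod p` of the quotient of
`(ZMod p)[x,y]` by the ideal generated by the triangular-lattice Laplacian polynomial
`f = x²y + xy² + x² + y² + x + y - 6xy`, `x^Lx - 1`, and `y^Ly - 1`
equals `2·p^(min kx ky) - 1` when `kx = ky`, and `2·p^(min kx ky)` otherwise. -/
theorem triangular_laplacian_gsd_mod_p_general (p q m : ℕ) (hp : p.Prime) (hp3 : 3 < p)
    (hq : q.Prime) (hqodd : Odd q) (hqp : q ≠ p)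
    (hprim : 1 ≤ m → Nat.Coprime p (q ^ m) ∧
      orderOf ((p : ℕ) : ZMod (q ^ m)) = Nat.totient (q ^ m))
    (kx ky : ℕ) :
    Module.finrank (ZMod p)
      (MvPolynomial (Fin 2) (ZMod p) ⧸
        Ideal.span {(X 0 ^ 2 * X 1 + X 0 * X 1 ^ 2 + X 0 ^ 2 + X 1 ^ 2 + X 0 + X 1
            - 6 * X 0 * X 1 : MvPolynomial (Fin 2) (ZMod p)),
          X 0 ^ (p ^ kx * q ^ m) - 1, X 1 ^ (p ^ ky * q ^ m) - 1}) =
      if kx = ky then 2 * p ^ min kx ky - 1 else 2 * p ^ min kx ky := by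
  have : Fact p.Prime := ⟨hp⟩
  rw [TriangularLaplacian.span_laplacian_eq hp hp3 hq hqodd hqp hprim kx ky]
  have h2 : (2 : ZMod p) ≠ 0 := by
    intro h
    have := Nat.le_of_dvd two_pos ((ZMod.natCast_eq_zero_iff 2 p).1 (by exact_mod_cast h))
    omega
  have h3 : ∀ k, ¬ 3 ∣ p ^ k := fun k hk => by
    have := (Nat.prime_dvd_prime_iff_eq Nat.prime_three hp).1 (Nat.prime_three.dvd_of_dvd_pow hk)
    omega
  have hinj : ∀ {a b : ℕ}, p ^ a = p ^ b ↔ a = b := Nat.pow_right_inj hp.one_lt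
  rcases le_total kx ky with hle | hle
  · rw [TriangularLaplacian.finrank_quotient_of_le h2 (pow_pos hp.pos kx)
      (Nat.pow_le_pow_right hp.pos hle) (h3 kx), min_eq_left hle]
    simp only [hinj]
  · rw [TriangularLaplacian.finrank_quotient_swap,
      TriangularLaplacian.finrank_quotient_of_le h2 (pow_pos hp.pos ky)
      (Nat.pow_le_pow_right hp.pos hle) (h3 ky), min_eq_right hle]
    simp only [hinj, eq_comm]
end

section
/- Let L_x, L_y ≥ 1 be integers. The dimension over ZMod 2 of the quotient ring (ZMod 2)[x,y] / (f, x^L_x − 1, y^L_y − 1) equals L_x + L_y + gcd(L_x, L_y) − 2, where f(x,y) = x^2·y + x·y^2 + x^2 + y^2 + x + y. -/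
open MvPolynomial

universe u

section GeomSum

variable {R : Type*} [CommRing R]

/-- Modulo `1 + x + ⋯ + x ^ (m - 1)`, geometric sums in `x` depend only on the length mod `m`. -/
theorem exists_geom_sum_add_mul (x : R) (m r k : ℕ) :
    ∃ c, ∑ i ∈ Finset.range (r + m * k), x ^ i =
      ∑ i ∈ Finset.range r, x ^ i + c * ∑ i ∈ Finset.range m, x ^ i := by
  induction k with
  | zero => exact ⟨0, by simp⟩
  | succ k ih =>
    obtain ⟨c, hc⟩ := ih
    refine ⟨c + x ^ (r + m * k), ?_⟩
    rw [show r + m * (k + 1) = (r + m * k) + m by ring, Finset.sum_range_add, hc]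
    simp only [pow_add x (r + m * k), ← Finset.mul_sum]
    ring

/-- The ideal generated by two geometric sums is generated by the one of length their `gcd`. -/
theorem span_geom_sum_pair (x : R) (m n : ℕ) :
    Ideal.span {∑ i ∈ Finset.range m, x ^ i, ∑ i ∈ Finset.range n, x ^ i} =
      Ideal.span {∑ i ∈ Finset.range (m.gcd n), x ^ i} := by
  induction m, n using Nat.gcd.induction with
  | H0 n => simp
  | H1 m n _ ih =>
    obtain ⟨c, hc⟩ := exists_geom_sum_add_mul x m (n % m) (n / m)
    rw [Nat.mod_add_div] at hc
    rw [Nat.gcd_rec, ← ih, hc, Ideal.span_pair_comm,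
      Ideal.span_pair_add_mul_right]

end GeomSum

section Rank

variable {K : Type u} [Field K]

theorem natDegree_geom_sum_X (n : ℕ) :
    (∑ i ∈ Finset.range n, (Polynomial.X : Polynomial K) ^ i).natDegree = n - 1 := by
  rcases Nat.eq_zero_or_pos n with rfl | hn
  · simp
  have h := congrArg Polynomial.natDegree (geom_sum_mul (Polynomial.X : Polynomial K) n)
  have hs : ∑ i ∈ Finset.range n, (Polynomial.X : Polynomial K) ^ i ≠ 0 :=
    (Polynomial.monic_X.geom_sum (by simp) hn.ne').ne_zero
  have h1 := Polynomial.natDegree_X_sub_C (1 : K)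
  have hn1 := Polynomial.natDegree_X_pow_sub_C (n := n) (r := (1 : K))
  rw [map_one] at h1 hn1
  rw [Polynomial.natDegree_mul hs (by simpa using Polynomial.X_sub_C_ne_zero (1 : K)),
    h1, hn1] at h
  omega

theorem rank_polynomial_quotient_span {g : Polynomial K} (hg : g ≠ 0) :
    Module.rank K (Polynomial K ⧸ Ideal.span {g}) = g.natDegree := by
  have : Module.Finite K (Polynomial K ⧸ Ideal.span {g}) := (AdjoinRoot.powerBasis hg).finite
  rw [← Module.finrank_eq_rank, finrank_quotient_span_eq_natDegree]

variable {S : Type u} [CommRing S] [Algebra K S]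

/-- Additivity of rank along `0 → S ⧸ J → S ⧸ I → S ⧸ I' → 0`, where `J = (I : b)` and
`I' = I + (b)`. -/
theorem rank_quotient_eq_add_of_colon {I J I' : Ideal S} (b : S)
    (hJ : ∀ u, b * u ∈ I ↔ u ∈ J) (hI' : I' = I ⊔ Ideal.span {b}) :
    Module.rank K (S ⧸ I) = Module.rank K (S ⧸ J) + Module.rank K (S ⧸ I') := by
  have hle : I ≤ I' := hI' ▸ le_sup_left
  let π : (S ⧸ I) →ₗ[K] (S ⧸ I') := (Ideal.Quotient.factorₐ K hle).toLinearMap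
  have hπ : Function.Surjective π := Ideal.Quotient.factor_surjective hle
  let μ : S →ₗ[K] (S ⧸ I) := (Ideal.Quotient.mkₐ K I).toLinearMap ∘ₗ LinearMap.mulLeft K b
  have hμ : LinearMap.ker μ = J.restrictScalars K := by
    ext u
    rw [Submodule.restrictScalars_mem, ← hJ u]
    exact Ideal.Quotient.eq_zero_iff_mem
  have hker : LinearMap.ker π = LinearMap.range μ := by
    ext z
    obtain ⟨u, rfl⟩ := Ideal.Quotient.mk_surjective z
    have : π (Ideal.Quotient.mk I u) = Ideal.Quotient.mk I' u := rfl
    rw [LinearMap.mem_ker, this, Ideal.Quotient.eq_zero_iff_mem, hI', Submodule.mem_sup]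
    constructor
    · rintro ⟨v, hv, w, hw, rfl⟩
      obtain ⟨c, rfl⟩ := Ideal.mem_span_singleton.1 hw
      exact ⟨c, by simp [μ, Ideal.Quotient.eq_zero_iff_mem.2 hv]⟩
    · rintro ⟨c, hc⟩
      have hc' : Ideal.Quotient.mk I (b * c) = Ideal.Quotient.mk I u := hc
      refine ⟨u - b * c, Ideal.Quotient.eq.1 hc'.symm, b * c, ?_, by ring⟩
      exact Ideal.mem_span_singleton.2 (dvd_mul_right b c)
  have e : (S ⧸ J) ≃ₗ[K] LinearMap.ker π :=
    (Submodule.quotEquivOfEq _ _ hμ.symm).trans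
      (μ.quotKerEquivRange.trans (LinearEquiv.ofEq _ _ hker.symm))
  rw [e.rank_eq, LinearMap.rank_eq_of_surjective hπ, add_comm]

/-- If `φ` is a surjection onto a univariate polynomial ring, then `S ⧸ I` has rank `deg g` for any
ideal `I` containing `ker φ` with image `(g)`. -/
theorem rank_quotient_of_map_eq_span (φ : S →ₐ[K] Polynomial K) (hφ : Function.Surjective φ)
    {I : Ideal S} (hker : RingHom.ker φ ≤ I) {g : Polynomial K} (hg : g ≠ 0)
    (hI : I.map φ = Ideal.span {g}) :
    Module.rank K (S ⧸ I) = g.natDegree := by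
  have hcomap : (I.map φ).comap φ = I := by
    rw [Ideal.comap_map_of_surjective' φ hφ, sup_eq_left.2 hker]
  rw [← rank_polynomial_quotient_span hg, ← hI]
  let ψ : S →ₐ[K] (Polynomial K ⧸ I.map φ) := (Ideal.Quotient.mkₐ K (I.map φ)).comp φ
  have hψ : Function.Surjective ψ := (Ideal.Quotient.mkₐ_surjective K _).comp hφ
  have hkψ : I = RingHom.ker ψ := by
    ext u
    rw [RingHom.mem_ker, AlgHom.comp_apply, Ideal.Quotient.mkₐ_eq_mk,
      Ideal.Quotient.eq_zero_iff_mem, ← Ideal.mem_comap, hcomap]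
  exact ((Ideal.quotientEquivAlgOfEq K hkψ).trans
    (Ideal.quotientKerAlgEquivOfSurjective hψ)).toLinearEquiv.rank_eq

/-- Splitting off the component `b = 0`, where `b` generates the kernel of a surjection `φ` onto a
univariate polynomial ring. -/
theorem rank_quotient_span_triple [IsDomain S] (φ : S →ₐ[K] Polynomial K)
    (hφ : Function.Surjective φ) {b : S} (hb : b ≠ 0) (hker : RingHom.ker φ = Ideal.span {b})
    (c d w : S) (hw : φ w ≠ 0) :
    Module.rank K (S ⧸ Ideal.span {b * c, w, b * d}) =
      Module.rank K (S ⧸ Ideal.span {c, w, d}) + (φ w).natDegree := by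
  have hφb : φ b = 0 := by
    rw [← RingHom.mem_ker, hker]
    exact Ideal.mem_span_singleton_self b
  have hI' : Ideal.span {b, w} = Ideal.span {b * c, w, b * d} ⊔ Ideal.span {b} := by
    apply le_antisymm
    · rw [Ideal.span_le, Set.insert_subset_iff, Set.singleton_subset_iff]
      exact ⟨Ideal.mem_sup_right (Ideal.mem_span_singleton_self b),
        Ideal.mem_sup_left (Ideal.subset_span (by simp))⟩
    · have hb' : b ∈ Ideal.span {b, w} := Ideal.subset_span (by simp)
      rw [sup_le_iff, Ideal.span_le, Ideal.span_singleton_le_iff_mem, Set.insert_subset_iff,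
        Set.insert_subset_iff, Set.singleton_subset_iff]
      exact ⟨⟨Ideal.mul_mem_right _ _ hb', Ideal.subset_span (by simp),
        Ideal.mul_mem_right _ _ hb'⟩, hb'⟩
  rw [rank_quotient_eq_add_of_colon (J := Ideal.span {c, w, d}) b _ hI',
    rank_quotient_of_map_eq_span φ hφ (I := Ideal.span {b, w}) _ hw]
  · rw [Ideal.map_span, Set.image_pair, hφb, Ideal.span_insert_zero]
  · rw [hker]
    exact Ideal.span_mono (by simp)
  · intro u
    simp only [Ideal.span, Submodule.mem_span_triple, smul_eq_mul]
    constructor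
    · rintro ⟨α, β, γ, h⟩
      have hβ : φ β = 0 := by
        have := congrArg φ h
        simpa [hφb, hw] using this
      rw [← RingHom.mem_ker, hker, Ideal.mem_span_singleton] at hβ
      obtain ⟨δ, rfl⟩ := hβ
      exact ⟨α, δ, γ, mul_left_cancel₀ hb (by rw [← h]; ring)⟩
    · rintro ⟨α, β, γ, rfl⟩
      exact ⟨α, b * β, γ, by ring⟩

end Rank

section Bivariate

variable {K : Type u} [Field K]

/-- A substitution `φ` has kernel `(b)` when it kills `b` and has a section `s` such that `s ∘ φ`
is the identity on the variables modulo `b`. -/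
theorem ker_eq_span_of_section {σ : Type*} (φ : MvPolynomial σ K →ₐ[K] Polynomial K)
    (s : Polynomial K →ₐ[K] MvPolynomial σ K) {b : MvPolynomial σ K} (hb : φ b = 0)
    (h : ∀ i, b ∣ X i - s (φ (X i))) : RingHom.ker φ = Ideal.span {b} := by
  apply le_antisymm
  · have key : Ideal.Quotient.mkₐ K (Ideal.span {b}) =
        ((Ideal.Quotient.mkₐ K (Ideal.span {b})).comp s).comp φ := by
      apply MvPolynomial.algHom_ext
      intro i
      exact Ideal.Quotient.eq.2 (Ideal.mem_span_singleton.2 (h i))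
    intro u hu
    have hu' := AlgHom.congr_fun key u
    rw [AlgHom.comp_apply, (RingHom.mem_ker).1 hu, map_zero] at hu'
    exact Ideal.Quotient.eq_zero_iff_mem.1 hu'
  · rwa [Ideal.span_singleton_le_iff_mem, RingHom.mem_ker]

theorem surjective_of_apply_X {σ : Type*} (φ : MvPolynomial σ K →ₐ[K] Polynomial K) (i : σ)
    (h : φ (X i) = Polynomial.X) : Function.Surjective φ := by
  have hid : φ.comp (Polynomial.aeval (X i)) = AlgHom.id K _ :=
    Polynomial.algHom_ext (by simp [h])
  exact fun g => ⟨Polynomial.aeval (X i) g, AlgHom.congr_fun hid g⟩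

/-- The rank of the quotient by `((x - 1) (y - 1) (x - y), x ^ m - 1, y ^ n - 1)`. -/
theorem rank_quotient_three_lines {m n : ℕ} (hm : 1 ≤ m) (hn : 1 ≤ n) :
    Module.rank K (MvPolynomial (Fin 2) K ⧸
      Ideal.span {(X 1 - 1) * ((X 0 - 1) * (X 0 - X 1) : MvPolynomial (Fin 2) K),
        X 0 ^ m - 1, X 1 ^ n - 1}) = ((m + n + m.gcd n - 2 : ℕ) : Cardinal) := by
  let T : Polynomial K := Polynomial.X
  let φ (v : Fin 2 → Polynomial K) : MvPolynomial (Fin 2) K →ₐ[K] Polynomial K := aeval v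
  have hne (i : Fin 2) : (X i - 1 : MvPolynomial (Fin 2) K) ≠ 0 := fun h => by
    simpa using congrArg (aeval (fun _ => (0 : K))) h
  have hgeom {k : ℕ} (hk : 1 ≤ k) : ∑ i ∈ Finset.range k, T ^ i ≠ 0 :=
    (Polynomial.monic_X.geom_sum (by simp) (by omega)).ne_zero
  have hTm : T ^ m - 1 ≠ 0 := (Polynomial.monic_X_pow_sub_C (1 : K) (by omega)).ne_zero
  have hdeg : (T ^ m - 1).natDegree = m := Polynomial.natDegree_X_pow_sub_C (r := (1 : K))
  have hy := rank_quotient_span_triple (φ ![T, 1])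
    (surjective_of_apply_X _ 0 (by simp [φ, T])) (hne 1)
    (ker_eq_span_of_section _ (Polynomial.aeval (X 0)) (by simp [φ])
      (by simp [Fin.forall_fin_two, φ, T]))
    ((X 0 - 1) * (X 0 - X 1)) (∑ i ∈ Finset.range n, X 1 ^ i) (X 0 ^ m - 1)
    (by simpa [φ] using hTm)
  have hx := rank_quotient_span_triple (φ ![1, T])
    (surjective_of_apply_X _ 1 (by simp [φ, T])) (hne 0)
    (ker_eq_span_of_section _ (Polynomial.aeval (X 1)) (by simp [φ])
      (by simp [Fin.forall_fin_two, φ, T]))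
    (X 0 - X 1) (∑ i ∈ Finset.range m, X 0 ^ i) (∑ i ∈ Finset.range n, X 1 ^ i)
    (by simpa [φ] using hgeom hn)
  have hd := rank_quotient_of_map_eq_span (φ ![T, T])
    (surjective_of_apply_X _ 0 (by simp [φ, T]))
    (I := Ideal.span {X 0 - X 1, ∑ i ∈ Finset.range n, X 1 ^ i, ∑ i ∈ Finset.range m, X 0 ^ i})
    (g := ∑ i ∈ Finset.range (m.gcd n), T ^ i)
    (by
      rw [ker_eq_span_of_section (φ ![T, T]) (Polynomial.aeval (X 1)) (b := X 0 - X 1)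
        (by simp [φ]) (by simp [Fin.forall_fin_two, φ, T])]
      exact Ideal.span_mono (by simp))
    (hgeom (Nat.gcd_pos_of_pos_left n hm))
    (by
      rw [Ideal.map_span, Set.image_insert_eq, Set.image_pair, Nat.gcd_comm, ← span_geom_sum_pair]
      simp [φ])
  have hφy : φ ![T, 1] (X 0 ^ m - 1) = T ^ m - 1 := by simp [φ]
  have hφx : φ ![1, T] (∑ i ∈ Finset.range n, X 1 ^ i) = ∑ i ∈ Finset.range n, T ^ i := by
    simp [φ]
  rw [hφy, hdeg, mul_geom_sum] at hy
  rw [hφx, natDegree_geom_sum_X, hd, natDegree_geom_sum_X, mul_geom_sum] at hx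
  rw [hy, Set.pair_comm (X 0 ^ m - 1 : MvPolynomial (Fin 2) K), hx]
  have := Nat.gcd_pos_of_pos_left n hm
  norm_cast
  omega

end Bivariate

/-- For integers `Lx, Ly ≥ 1`, the dimension over `ZMod 2` of the quotient of
`(ZMod 2)[x,y]` by the ideal generated by the mod-2 triangular-lattice Laplacian polynomial
`f = x²y + xy² + x² + y² + x + y`, `x^Lx - 1`, and `y^Ly - 1`
equals `Lx + Ly + gcd(Lx, Ly) - 2`. -/
theorem triangular_laplacian_gsd_mod_two (Lx Ly : ℕ) (hLx : 1 ≤ Lx) (hLy : 1 ≤ Ly) :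
    Module.finrank (ZMod 2)
      (MvPolynomial (Fin 2) (ZMod 2) ⧸
        Ideal.span {(X 0 ^ 2 * X 1 + X 0 * X 1 ^ 2 + X 0 ^ 2 + X 1 ^ 2 + X 0 + X 1 :
            MvPolynomial (Fin 2) (ZMod 2)),
          X 0 ^ Lx - 1, X 1 ^ Ly - 1}) =
      Lx + Ly + Nat.gcd Lx Ly - 2 := by
  have hf : (X 0 ^ 2 * X 1 + X 0 * X 1 ^ 2 + X 0 ^ 2 + X 1 ^ 2 + X 0 + X 1 :
      MvPolynomial (Fin 2) (ZMod 2)) = (X 1 - 1) * ((X 0 - 1) * (X 0 - X 1)) := by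
    linear_combination (X 0 * X 1 ^ 2 + X 0 ^ 2 + X 1) *
      (CharTwo.two_eq_zero : (2 : MvPolynomial (Fin 2) (ZMod 2)) = 0)
  rw [hf]
  exact Module.finrank_eq_of_rank_eq (rank_quotient_three_lines hLx hLy)
end

section
/- Let q be an odd prime and m ≥ 0 an integer such that, if m ≥ 1, then 3 is a primitive root modulo q^m. Let k_x, k_y be nonnegative integers, and set L_x = 3^k_x · q^m and L_y = 3^k_y · q^m. Then the dimension over ZMod 3 of (ZMod 3)[x,y] / (1 + x + y, x^L_x − 1, y^L_y − 1) equals 3^(min(k_x,k_y)). -/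
open MvPolynomial

/-- The relation `1 + x + y = 0` is stable under the iterated Frobenius in characteristic `3`. -/
theorem one_add_pow_three_pow_add_pow_three_pow {R : Type*} [CommRing R] (h3 : (3 : R) = 0)
    {x y : R} (h : 1 + x + y = 0) (n : ℕ) : 1 + x ^ 3 ^ n + y ^ 3 ^ n = 0 := by
  induction n with
  | zero => simpa using h
  | succ n ih =>
    rw [pow_succ, pow_mul, pow_mul]
    generalize x ^ 3 ^ n = a at *
    generalize y ^ 3 ^ n = b at *
    linear_combination (1 + a ^ 2 + b ^ 2 - a - b - a * b) * ih + a * b * h3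

/-- If `-1` is a positive power of `3` modulo `N`, then the only solution of `1 + x + y = 0` in
characteristic `3` with `x ^ N = 1` and `y ^ (3 ^ d * N) = 1` is `x = y = 1`. -/
theorem eq_one_of_one_add_add_eq_zero {R : Type*} [CommRing R] (h3 : (3 : R) = 0) {N s d : ℕ}
    (hN : Nat.Coprime 3 N) (hs : 1 ≤ s) (hNs : N ∣ 3 ^ s + 1) {x y : R} (h : 1 + x + y = 0)
    (hx : x ^ N = 1) (hy : y ^ (3 ^ d * N) = 1) : x = 1 := by
  have inv_of_pow (z : R) (hz : z ^ N = 1) : z ^ 3 ^ s * z = 1 := by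
    obtain ⟨c, hc⟩ := hNs
    rw [← pow_succ, hc, pow_mul, hz, one_pow]
  have hxs := inv_of_pow x hx
  have hys : y ^ 3 ^ s * x = y := by
    linear_combination x * one_add_pow_three_pow_add_pow_three_pow h3 h s - hxs - h
  have hxx : x ^ 3 ^ (s + s) = x := by
    have h1 : x ^ 3 ^ (s + s) * x ^ 3 ^ s = 1 := by
      rw [pow_add, pow_mul, ← mul_pow, hxs, one_pow]
    linear_combination x * h1 - x ^ 3 ^ (s + s) * hxs
  have hyy : y ^ 3 ^ (s + s) = y := by
    linear_combination one_add_pow_three_pow_add_pow_three_pow h3 h (s + s) - h - hxx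
  have hyt (t : ℕ) : y ^ 3 ^ ((s + s) * t) = y := by
    induction t with
    | zero => simp
    | succ t ih => rw [Nat.mul_succ, pow_add, pow_mul, ih, hyy]
  have hyN : y ^ N = 1 := by
    obtain ⟨c, hc⟩ := Nat.exists_eq_add_of_le (show d ≤ (s + s) * d by nlinarith)
    rw [← hyt d, hc, pow_add, ← pow_mul, mul_right_comm, pow_mul, hy, one_pow]
  have hxy : x = y ^ 2 := by
    linear_combination y * hys - x * inv_of_pow y hyN
  have hy3 : y ^ 3 = 1 := by
    linear_combination (y - 1) * h - (y - 1) * hxy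
  have hy1 : y = 1 := by
    simpa [hN.gcd_eq_one] using pow_gcd_eq_one.mpr ⟨hy3, hyN⟩
  linear_combination h - hy1 - h3

/-- The relations of the fractal spin liquid force `x ^ 3 ^ min kx ky = 1`. -/
theorem pow_three_pow_min_eq_one {R : Type*} [CommRing R] (h3 : (3 : R) = 0) {N s kx ky : ℕ}
    (hN : Nat.Coprime 3 N) (hs : 1 ≤ s) (hNs : N ∣ 3 ^ s + 1) {x y : R} (h : 1 + x + y = 0)
    (hx : x ^ (3 ^ kx * N) = 1) (hy : y ^ (3 ^ ky * N) = 1) : x ^ 3 ^ min kx ky = 1 := by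
  rcases le_total kx ky with hk | hk
  · obtain ⟨d, rfl⟩ := Nat.exists_eq_add_of_le hk
    rw [min_eq_left hk]
    refine eq_one_of_one_add_add_eq_zero (d := d) h3 hN hs hNs
      (one_add_pow_three_pow_add_pow_three_pow h3 h kx) (by rwa [← pow_mul]) ?_
    rwa [← pow_mul, ← mul_assoc, ← pow_add]
  · obtain ⟨d, rfl⟩ := Nat.exists_eq_add_of_le hk
    rw [min_eq_right hk]
    have hp := one_add_pow_three_pow_add_pow_three_pow h3 h ky
    have hy1 : y ^ 3 ^ ky = 1 := by
      refine eq_one_of_one_add_add_eq_zero (d := d) h3 hN hs hNs (y := x ^ 3 ^ ky)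
        (by linear_combination hp) (by rwa [← pow_mul]) ?_
      rwa [← pow_mul, ← mul_assoc, ← pow_add]
    linear_combination hp - hy1 - h3

/-- If `a` is a primitive root modulo `n`, then `-1` is a positive power of `a` modulo `n`. -/
theorem exists_dvd_pow_add_one_of_orderOf_eq_totient {a n : ℕ} [NeZero n] (hc : Nat.Coprime a n)
    (ho : orderOf (a : ZMod n) = n.totient) : ∃ s, 1 ≤ s ∧ n ∣ a ^ s + 1 := by
  have hu : orderOf (ZMod.unitOfCoprime a hc) = Nat.card (ZMod n)ˣ := by
    rw [← orderOf_units, ZMod.coe_unitOfCoprime, ho, Nat.card_eq_fintype_card,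
      ZMod.card_units_eq_totient]
  have hmem : (-1 : (ZMod n)ˣ) ∈ Submonoid.powers (ZMod.unitOfCoprime a hc) := by
    rw [mem_powers_iff_mem_zpowers, Subgroup.eq_top_of_card_eq _ ((Nat.card_zpowers _).trans hu)]
    trivial
  obtain ⟨t, ht⟩ := hmem
  refine ⟨t + n.totient, by have := Nat.totient_pos.mpr (NeZero.pos n); omega, ?_⟩
  have ht' : (a : ZMod n) ^ t = -1 := by simpa using congrArg Units.val ht
  rw [← ZMod.natCast_eq_zero_iff]
  push_cast
  rw [pow_add, ht', ← ho, pow_orderOf_eq_one]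
  ring

/-- When `-1` is a positive power of `3` modulo `N`, the coordinate ring of the fractal spin
liquid is the algebra `(ZMod 3)[x] / (x ^ 3 ^ min kx ky - 1)`. -/
noncomputable def fractalQuotientEquiv {N s : ℕ} (kx ky : ℕ) (hN : Nat.Coprime 3 N) (hs : 1 ≤ s)
    (hNs : N ∣ 3 ^ s + 1) :
    (MvPolynomial (Fin 2) (ZMod 3) ⧸
        Ideal.span {(1 + X 0 + X 1 : MvPolynomial (Fin 2) (ZMod 3)),
          X 0 ^ (3 ^ kx * N) - 1, X 1 ^ (3 ^ ky * N) - 1}) ≃ₐ[ZMod 3]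
      AdjoinRoot (Polynomial.X ^ 3 ^ min kx ky - 1 : Polynomial (ZMod 3)) := by
  set I := Ideal.span {(1 + X 0 + X 1 : MvPolynomial (Fin 2) (ZMod 3)),
          X 0 ^ (3 ^ kx * N) - 1, X 1 ^ (3 ^ ky * N) - 1} with hI
  set f := (Polynomial.X ^ 3 ^ min kx ky - 1 : Polynomial (ZMod 3)) with hf
  have three_eq_zero (A : Type) [CommRing A] [Algebra (ZMod 3) A] : (3 : A) = 0 := by
    have h := congrArg (algebraMap (ZMod 3) A) (show (3 : ZMod 3) = 0 from rfl)
    rwa [map_ofNat, map_zero] at h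
  have hr : AdjoinRoot.root f ^ 3 ^ min kx ky = 1 := by
    have h := AdjoinRoot.eval₂_root f
    rw [hf, Polynomial.eval₂_sub, Polynomial.eval₂_X_pow, Polynomial.eval₂_one] at h
    exact sub_eq_zero.mp h
  have hr' : (-1 - AdjoinRoot.root f) ^ 3 ^ min kx ky = 1 := by
    have h3 := three_eq_zero (AdjoinRoot f)
    have h := one_add_pow_three_pow_add_pow_three_pow h3
      (show 1 + AdjoinRoot.root f + (-1 - AdjoinRoot.root f) = 0 by ring) (min kx ky)
    linear_combination h - hr - h3
  have pow_eq_one {z : AdjoinRoot f} (hz : z ^ 3 ^ min kx ky = 1) {k : ℕ}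
      (hk : min kx ky ≤ k) : z ^ (3 ^ k * N) = 1 := by
    obtain ⟨c, hc⟩ := (pow_dvd_pow 3 hk).mul_right N
    rw [hc, pow_mul, hz, one_pow]
  let φ : MvPolynomial (Fin 2) (ZMod 3) →ₐ[ZMod 3] AdjoinRoot f :=
    aeval ![AdjoinRoot.root f, -1 - AdjoinRoot.root f]
  have hφ0 : φ (X 0) = AdjoinRoot.root f := by simp [φ]
  have hφ1 : φ (X 1) = -1 - AdjoinRoot.root f := by simp [φ]
  have hφ : ∀ a ∈ I, φ a = 0 := by
    change I ≤ RingHom.ker φ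
    rw [hI, Ideal.span_le]
    rintro p (rfl | rfl | rfl)
    · simp [hφ0, hφ1]
    · simp [hφ0, pow_eq_one hr (min_le_left kx ky)]
    · simp [hφ1, pow_eq_one hr' (min_le_right kx ky)]
  have mk_eq_zero {p : MvPolynomial (Fin 2) (ZMod 3)}
      (hp : p ∈ ({(1 + X 0 + X 1 : MvPolynomial (Fin 2) (ZMod 3)),
        X 0 ^ (3 ^ kx * N) - 1, X 1 ^ (3 ^ ky * N) - 1} : Set _)) :
      Ideal.Quotient.mkₐ (ZMod 3) I p = 0 :=
    Ideal.Quotient.eq_zero_iff_mem.mpr (Ideal.subset_span hp)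
  have h1 := mk_eq_zero (Or.inl rfl)
  have h2 := mk_eq_zero (Or.inr (Or.inl rfl))
  have h4 := mk_eq_zero (Or.inr (Or.inr rfl))
  rw [map_add, map_add, map_one] at h1
  rw [map_sub, map_pow, map_one, sub_eq_zero] at h2 h4
  have hx := pow_three_pow_min_eq_one (three_eq_zero _) hN hs hNs h1 h2 h4
  let ψ : AdjoinRoot f →ₐ[ZMod 3] MvPolynomial (Fin 2) (ZMod 3) ⧸ I :=
    AdjoinRoot.liftAlgHom f (Algebra.ofId _ _) (Ideal.Quotient.mkₐ (ZMod 3) I (X 0)) (by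
      rw [hf, Polynomial.eval₂_sub, Polynomial.eval₂_X_pow, Polynomial.eval₂_one, hx, sub_self])
  have hψ : ψ (AdjoinRoot.root f) = Ideal.Quotient.mkₐ (ZMod 3) I (X 0) :=
    AdjoinRoot.liftAlgHom_root ..
  refine AlgEquiv.ofAlgHom (Ideal.Quotient.liftₐ I φ hφ) ψ ?_ ?_
  · ext
    rw [AlgHom.comp_apply, hψ]
    exact hφ0
  · refine Ideal.Quotient.algHom_ext _ (MvPolynomial.algHom_ext fun i => ?_)
    fin_cases i
    · change ψ (φ (X 0)) = Ideal.Quotient.mkₐ (ZMod 3) I (X 0)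
      rw [hφ0, hψ]
    · change ψ (φ (X 1)) = Ideal.Quotient.mkₐ (ZMod 3) I (X 1)
      rw [hφ1, map_sub, map_neg, map_one, hψ]
      linear_combination -h1

/-- For an odd prime `q`, an integer `m ≥ 0` such that `3` is a primitive root modulo `q^m`
whenever `m ≥ 1`, and nonnegative integers `kx, ky`, setting `Lx = 3^kx · q^m` and
`Ly = 3^ky · q^m`, the dimension over `ZMod 3` of the quotient of `(ZMod 3)[x,y]` by the
ideal generated by the fractal-spin-liquid polynomial `1 + x + y`, `x^Lx - 1`, and
`y^Ly - 1` equals `3^(min kx ky)`. -/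
theorem fractal_spin_liquid_gsd (q m : ℕ) (hq : q.Prime) (hqodd : Odd q)
    (hprim : 1 ≤ m → Nat.Coprime 3 (q ^ m) ∧
      orderOf ((3 : ℕ) : ZMod (q ^ m)) = Nat.totient (q ^ m))
    (kx ky : ℕ) :
    Module.finrank (ZMod 3)
      (MvPolynomial (Fin 2) (ZMod 3) ⧸
        Ideal.span {(1 + X 0 + X 1 : MvPolynomial (Fin 2) (ZMod 3)),
          X 0 ^ (3 ^ kx * q ^ m) - 1, X 1 ^ (3 ^ ky * q ^ m) - 1}) =
      3 ^ min kx ky := by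
  obtain ⟨hN, s, hs, hNs⟩ : Nat.Coprime 3 (q ^ m) ∧ ∃ s, 1 ≤ s ∧ q ^ m ∣ 3 ^ s + 1 := by
    rcases Nat.eq_zero_or_pos m with rfl | hm
    · exact ⟨by simp, 1, le_rfl, by simp⟩
    · have : NeZero (q ^ m) := ⟨pow_ne_zero m hq.ne_zero⟩
      obtain ⟨hc, ho⟩ := hprim hm
      exact ⟨hc, exists_dvd_pow_add_one_of_orderOf_eq_totient hc ho⟩
  rw [(fractalQuotientEquiv kx ky hN hs hNs).toLinearEquiv.finrank_eq]
  refine finrank_quotient_span_eq_natDegree.trans ?_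
  rw [← Polynomial.C_1, Polynomial.natDegree_X_pow_sub_C]
end

section
/- Let q be an odd prime and m ≥ 1 an integer such that 3 is a primitive root modulo q^m. Let F be the algebraic closure of ZMod 3. If (a,b) ∈ F × F satisfies 1 + a + b = 0, a^(q^m) = 1, and b^(q^m) = 1, then a = 1 and b = 1. -/
/-- If `p` is a primitive root modulo `n`, then `n` divides `p ^ k + 1` for some `k`. -/
theorem exists_dvd_pow_add_one_of_orderOf_eq_totient_s7 {p n : ℕ} [NeZero n]
    (hcop : Nat.Coprime p n) (hord : orderOf (p : ZMod n) = Nat.totient n) :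
    ∃ k : ℕ, n ∣ p ^ k + 1 := by
  have hu : orderOf (ZMod.unitOfCoprime p hcop) = Nat.card (ZMod n)ˣ := by
    rw [← orderOf_units, ZMod.coe_unitOfCoprime, hord, Nat.card_eq_fintype_card,
      ZMod.card_units_eq_totient]
  have htop : Subgroup.zpowers (ZMod.unitOfCoprime p hcop) = ⊤ :=
    Subgroup.eq_top_of_card_eq _ (by rw [Nat.card_zpowers, hu])
  have hneg : (-1 : (ZMod n)ˣ) ∈ Submonoid.powers (ZMod.unitOfCoprime p hcop) := by
    rw [mem_powers_iff_mem_zpowers, htop]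
    trivial
  obtain ⟨k, hk⟩ := hneg
  refine ⟨k, (ZMod.natCast_eq_zero_iff _ _).1 ?_⟩
  have hval := congrArg Units.val hk
  simp only [Units.val_pow_eq_pow_val, ZMod.coe_unitOfCoprime, Units.val_neg,
    Units.val_one] at hval
  push_cast
  rw [hval, neg_add_cancel]

/-- In characteristic three, if some power of Frobenius inverts both `a` and `b`, then
`1 + a + b = 0` forces `a = b = 1`. -/
theorem eq_one_and_eq_one_of_pow_three_pow_add_one {F : Type*} [Field F] [CharP F 3] {k : ℕ}
    {a b : F} (hf : 1 + a + b = 0) (ha : a ^ (3 ^ k + 1) = 1) (hb : b ^ (3 ^ k + 1) = 1) :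
    a = 1 ∧ b = 1 := by
  have : Fact (Nat.Prime 3) := ⟨Nat.prime_three⟩
  have h3 : (3 : F) = 0 := by exact_mod_cast CharP.cast_eq_zero F 3
  have hfrob : 1 + a ^ 3 ^ k + b ^ 3 ^ k = 0 := by
    have h := congrArg (· ^ 3 ^ k) hf
    simpa [add_pow_char_pow] using h
  rw [pow_succ] at ha hb
  have hab : a * b = 1 := by
    linear_combination (a * b) * hfrob - b * ha - a * hb - hf
  have hsq : (a - 1) ^ 2 = 0 := by
    linear_combination a * hf - hab - a * h3
  have ha1 : a = 1 := sub_eq_zero.1 (pow_eq_zero_iff two_ne_zero |>.1 hsq)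
  exact ⟨ha1, by simpa [ha1] using hab⟩

/-- If `q` is an odd prime and `m ≥ 1` is such that `3` is a primitive root modulo `q^m`,
then the only solution `(a,b)` in the algebraic closure of `ZMod 3` of
`1 + a + b = 0`, `a^(q^m) = 1`, `b^(q^m) = 1` is `(1,1)`. -/
theorem fractal_spin_liquid_only_trivial_root (q m : ℕ) (hq : q.Prime) (hqodd : Odd q)
    (hm : 1 ≤ m) (hcop : Nat.Coprime 3 (q ^ m))
    (hord : orderOf ((3 : ℕ) : ZMod (q ^ m)) = Nat.totient (q ^ m))
    (a b : AlgebraicClosure (ZMod 3))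
    (hf : 1 + a + b = 0) (ha : a ^ q ^ m = 1) (hb : b ^ q ^ m = 1) :
    a = 1 ∧ b = 1 := by
  have : NeZero (q ^ m) := ⟨pow_ne_zero m hq.ne_zero⟩
  have : CharP (AlgebraicClosure (ZMod 3)) 3 :=
    charP_of_injective_algebraMap (algebraMap (ZMod 3) _).injective 3
  obtain ⟨k, c, hc⟩ := exists_dvd_pow_add_one_of_orderOf_eq_totient_s7 hcop hord
  refine eq_one_and_eq_one_of_pow_three_pow_add_one (k := k) hf ?_ ?_
  · rw [hc, pow_mul, ha, one_pow]
  · rw [hc, pow_mul, hb, one_pow]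
end

section
/- Let p be an odd prime. The polynomial f(x,y) = x·(y−1)^2 + y·(x−1)^2 is irreducible in the polynomial ring (ZMod p)[x,y]. -/
open MvPolynomial

/-- A sum `a * d + b * c` with `a * c = b * d = y`, `y` irreducible and `a` a unit, is either
divisible by `y` or of the form `u + u⁻¹ * y ^ 2` with `u` a unit. -/
theorem dvd_or_eq_unit_add_of_mul_eq {R : Type*} [CommRing R] {y a b c d : R}
    (hy : Irreducible y) (hac : a * c = y) (hbd : b * d = y) (ha : IsUnit a) :
    y ∣ a * d + b * c ∨ ∃ u : Rˣ, a * d + b * c = u + ↑u⁻¹ * y ^ 2 := by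
  obtain ⟨a, rfl⟩ := ha
  have hc : c = ↑a⁻¹ * y := by simp [← hac]
  rcases hy.isUnit_or_isUnit hbd.symm with ⟨b, rfl⟩ | ⟨d, rfl⟩
  · have hd : d = ↑b⁻¹ * y := by simp [← hbd]
    exact .inl ⟨a * ↑b⁻¹ + b * ↑a⁻¹, by rw [hc, hd]; ring⟩
  · have hb : b = ↑d⁻¹ * y := by simp [← hbd, mul_comm b]
    refine .inr ⟨a * d, ?_⟩
    rw [hc, hb, mul_inv]
    push_cast
    ring

/-- A palindromic quadratic `y * X ^ 2 + m * X + y` over a domain, with `y` irreducible, is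
irreducible unless `y ∣ m` or `m = u + u⁻¹ * y ^ 2` for some unit `u`. -/
theorem Polynomial.irreducible_palindromic_quadratic {R : Type*} [CommRing R] [IsDomain R]
    {y m : R} (hy : Irreducible y) (hym : ¬ y ∣ m) (hm : ∀ u : Rˣ, m ≠ u + ↑u⁻¹ * y ^ 2) :
    Irreducible (C y * X ^ 2 + C m * X + C y : Polynomial R) := by
  have hdeg : (C y * X ^ 2 + C m * X + C y : Polynomial R).natDegree = 2 :=
    natDegree_quadratic hy.ne_zero
  have isUnit_of_dvd (c : R) (h : C c ∣ C y * X ^ 2 + C m * X + C y) : IsUnit c := by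
    rw [C_dvd_iff_dvd_coeff] at h
    have h₀ : c ∣ y := by simpa using h 0
    have h₁ : c ∣ m := by simpa [coeff_X, coeff_C] using h 1
    obtain ⟨e, he⟩ := h₀
    refine (hy.isUnit_or_isUnit he).resolve_right fun hu => hym ?_
    exact (he ▸ hu.mul_right_dvd.2 dvd_rfl : y ∣ c).trans h₁
  refine ⟨fun hu => ?_, fun g h hgh => ?_⟩
  · simp [natDegree_eq_zero_of_isUnit hu] at hdeg
  have hne : g * h ≠ 0 := by
    rw [← hgh]
    intro h0
    simp [h0] at hdeg
  have hsum : g.natDegree + h.natDegree = 2 := by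
    rw [← natDegree_mul (left_ne_zero_of_mul hne) (right_ne_zero_of_mul hne), ← hgh, hdeg]
  rcases Nat.eq_zero_or_pos g.natDegree with hg | hg
  · rw [natDegree_eq_zero] at hg
    obtain ⟨c, rfl⟩ := hg
    exact .inl ((isUnit_of_dvd c ⟨h, hgh⟩).map C)
  rcases Nat.eq_zero_or_pos h.natDegree with hh | hh
  · rw [natDegree_eq_zero] at hh
    obtain ⟨c, rfl⟩ := hh
    exact .inr ((isUnit_of_dvd c ⟨g, hgh.trans (mul_comm _ _)⟩).map C)
  exfalso
  obtain ⟨a, b, rfl⟩ := exists_eq_X_add_C_of_natDegree_le_one (show g.natDegree ≤ 1 by lia)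
  obtain ⟨c, d, rfl⟩ := exists_eq_X_add_C_of_natDegree_le_one (show h.natDegree ≤ 1 by lia)
  have hprod : (C a * X + C b) * (C c * X + C d) =
      C (a * c) * X ^ 2 + C (a * d + b * c) * X + C (b * d) := by
    simp only [C_add, C_mul]
    ring
  rw [hprod] at hgh
  have hbd : b * d = y := by simpa using (congrArg (coeff · 0) hgh).symm
  have had : m = a * d + b * c := by
    simpa [coeff_X, coeff_C, -map_add, -map_mul] using congrArg (coeff · 1) hgh
  have hac : a * c = y := by
    simpa [coeff_X, coeff_C, -map_add, -map_mul] using (congrArg (coeff · 2) hgh).symm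
  rcases hy.isUnit_or_isUnit hac.symm with ha | hc
  · rcases dvd_or_eq_unit_add_of_mul_eq hy hac hbd ha with h | ⟨u, h⟩
    · exact hym (had ▸ h)
    · exact hm u (had.trans h)
  · have had' : m = c * b + d * a := by rw [had]; ring
    rcases dvd_or_eq_unit_add_of_mul_eq hy ((mul_comm c a).trans hac)
      ((mul_comm d b).trans hbd) hc with h | ⟨u, h⟩
    · exact hym (had' ▸ h)
    · exact hm u (had'.trans h)

/-- For an odd prime `p`, the square-lattice Laplacian polynomial
`f(x,y) = x·(y-1)² + y·(x-1)²` is irreducible in `(ZMod p)[x,y]`. -/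
theorem square_laplacian_irreducible (p : ℕ) (hp : p.Prime) (hpodd : Odd p) :
    Irreducible (X 0 * (X 1 - 1) ^ 2 + X 1 * (X 0 - 1) ^ 2 :
      MvPolynomial (Fin 2) (ZMod p)) := by
  have : Fact p.Prime := ⟨hp⟩
  rw [← MulEquiv.irreducible_iff (finSuccEquiv (ZMod p) 1)]
  have hX1 : finSuccEquiv (ZMod p) 1 (X 1) = Polynomial.C (X 0) :=
    finSuccEquiv_X_succ (j := (0 : Fin 1))
  have himage : finSuccEquiv (ZMod p) 1 (X 0 * (X 1 - 1) ^ 2 + X 1 * (X 0 - 1) ^ 2) =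
      Polynomial.C (X 0) * Polynomial.X ^ 2 +
        Polynomial.C (X 0 ^ 2 - 4 * X 0 + 1) * Polynomial.X + Polynomial.C (X 0) := by
    simp only [map_add, map_mul, map_sub, map_pow, map_one, hX1, finSuccEquiv_X_zero, map_ofNat]
    ring
  rw [himage]
  refine Polynomial.irreducible_palindromic_quadratic (X_prime (i := (0 : Fin 1))).irreducible
    ?_ fun u hu => ?_
  · rintro ⟨q, hq⟩
    simpa using congrArg (eval 0) hq
  · obtain ⟨r, -, hr⟩ := isUnit_iff_eq_C_of_isReduced.1 u.isUnit
    obtain ⟨s, -, hs⟩ := isUnit_iff_eq_C_of_isReduced.1 u⁻¹.isUnit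
    rw [hr, hs] at hu
    have h4 : (4 : ZMod p) = 0 := by
      have h := congrArg (fun q => eval 0 (pderiv 0 q)) hu
      have hpd : pderiv (0 : Fin 1) (4 : MvPolynomial (Fin 1) (ZMod p)) = 0 :=
        (pderiv 0).map_natCast 4
      simpa [pderiv_mul, pderiv_pow, hpd,
        map_ofNat (constantCoeff (R := ZMod p) (σ := Fin 1)) 4] using h
    have h4' : p ∣ 2 ^ 2 := (ZMod.natCast_eq_zero_iff _ _).1 (by exact_mod_cast h4)
    have h2 : p = 2 := (Nat.prime_dvd_prime_iff_eq hp Nat.prime_two).1 (hp.dvd_of_dvd_pow h4')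
    subst h2
    exact absurd hpodd (by decide)
end

section
/- Let q be an odd prime and m ≥ 0 an integer such that, if m ≥ 1, then 3 is a primitive root modulo q^m. Let k_x, k_y be nonnegative integers, and set L_x = 3^k_x · q^m and L_y = 3^k_y · q^m. Let M be the submodule of the free module ((ZMod 3)[x,y])^2 spanned over (ZMod 3)[x,y] by the six vectors (x − y, x·y − y), (1 − x, x·y − 1), (x^L_x − 1, 0), (0, x^L_x − 1), (y^L_y − 1, 0), (0, y^L_y − 1). Then the dimension over ZMod 3 of the quotient module ((ZMod 3)[x,y])^2 / M equals 2 · 3^(min(k_x,k_y)). -/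
open MvPolynomial

/-- The polynomial ring `(ZMod 3)[x,y]`. -/
noncomputable abbrev Rthree : Type := MvPolynomial (Fin 2) (ZMod 3)

/-- A point `(x, y, j)` of the normalization of the curve cut out by the determinant
of the two translation-invariant generators. -/
structure IsCurvePoint {B : Type*} [CommRing B] (x y j : B) : Prop where
  sq : j ^ 2 = -(x * y)
  mul_x : j * (x - 1) = (y - 1) * x
  mul_y : j * (y - 1) = -((x - 1) * y)

namespace IsCurvePoint

variable {B : Type*} [CommRing B] {x y j : B}

lemma map {C : Type*} [CommRing C] (f : B →+* C) (h : IsCurvePoint x y j) :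
    IsCurvePoint (f x) (f y) (f j) where
  sq := by simpa using congrArg f h.sq
  mul_x := by simpa using congrArg f h.mul_x
  mul_y := by simpa using congrArg f h.mul_y

lemma swap (h : IsCurvePoint x y j) : IsCurvePoint y x (-j) where
  sq := by linear_combination h.sq
  mul_x := by linear_combination -h.mul_y
  mul_y := by linear_combination -h.mul_x

lemma laplacian_eq_zero (h : IsCurvePoint x y j) :
    (y - 1) ^ 2 * x + (x - 1) ^ 2 * y = 0 := by
  linear_combination (x - 1) * h.mul_y - (y - 1) * h.mul_x

lemma y_eq_one (h : IsCurvePoint x y j) (hx : x = 1) : y = 1 := by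
  subst hx
  linear_combination -h.mul_x

lemma pow_char_pow [CharP B 3] (h : IsCurvePoint x y j) (k : ℕ) :
    IsCurvePoint (x ^ 3 ^ k) (y ^ 3 ^ k) (j ^ 3 ^ k) := by
  have : Fact (Nat.Prime 3) := ⟨Nat.prime_three⟩
  simpa only [iterateFrobenius_def] using h.map (iterateFrobenius B 3 k)

lemma eq_one_of_pow_eq_one [CharP B 3] (h : IsCurvePoint x y j) {n i : ℕ}
    (hn : Nat.Coprime 3 n) (hi : 3 ^ i ≡ 2 [MOD n]) (hx : x ^ n = 1) (hy : y ^ n = 1) :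
    x = 1 := by
  have : Fact (Nat.Prime 3) := ⟨Nat.prime_three⟩
  have h3 : (3 : B) = 0 := by exact_mod_cast CharP.cast_eq_zero B 3
  have hn0 : n ≠ 0 := by rintro rfl; simp at hn
  have hx2 : x ^ 3 ^ i = x ^ 2 := pow_eq_pow_of_modEq hi hx
  have hy2 : y ^ 3 ^ i = y ^ 2 := pow_eq_pow_of_modEq hi hy
  have h1 := h.laplacian_eq_zero
  have h2 := (h.pow_char_pow i).laplacian_eq_zero
  rw [hx2, hy2] at h2
  obtain ⟨x', hx'⟩ : ∃ x', x * x' = 1 :=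
    ⟨x ^ (n - 1), by rw [mul_pow_sub_one hn0, hx]⟩
  obtain ⟨y', hy'⟩ : ∃ y', y * y' = 1 :=
    ⟨y ^ (n - 1), by rw [mul_pow_sub_one hn0, hy]⟩
  have hinv (a b a' b' : B) (ha : a * a' = 1) (hb : b * b' = 1)
      (hab : (b - 1) ^ 2 * a + (a - 1) ^ 2 * b = 0) : a + a' + (b + b') = 1 := by
    have e : a' * b' * ((b - 1) ^ 2 * a + (a - 1) ^ 2 * b) = 0 := by rw [hab, mul_zero]
    have e' : a' * b' * ((b - 1) ^ 2 * a + (a - 1) ^ 2 * b) =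
        (a * a') * (b * (b * b') - 2 * (b * b') + b') +
        (b * b') * (a * (a * a') - 2 * (a * a') + a') := by ring
    rw [e', ha, hb] at e
    linear_combination e + h3
  have e1 := hinv x y x' y' hx' hy' h1
  have e2 := hinv (x ^ 2) (y ^ 2) (x' ^ 2) (y' ^ 2) (by rw [← mul_pow, hx', one_pow])
    (by rw [← mul_pow, hy', one_pow]) h2
  have e3 : (x + x' + 1) ^ 2 = 0 := by
    have ht : y + y' = 1 - (x + x') := by linear_combination e1
    have e4 : (x + x') ^ 2 + (y + y') ^ 2 = 5 := by
      linear_combination e2 + 2 * hx' + 2 * hy'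
    rw [ht] at e4
    linear_combination 2 * e4 - (x + x') ^ 2 * h3 + 2 * (x + x') * h3 + 3 * h3
  have e5 : (x - 1) ^ 4 = 0 := by
    have : (x - 1) ^ 2 = x * (x + x' + 1) := by linear_combination -hx' - x * h3
    calc (x - 1) ^ 4 = ((x - 1) ^ 2) ^ 2 := by ring
      _ = 0 := by rw [this, mul_pow, e3, mul_zero]
  have e9 : x ^ 3 ^ 2 = 1 := by
    have : (x - 1) ^ 3 ^ 2 = 0 := pow_eq_zero_of_le (by norm_num) e5
    rwa [sub_pow_char_pow, one_pow, sub_eq_zero] at this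
  have hco : Nat.Coprime (3 ^ 2) n := hn.pow_left 2
  rw [← orderOf_eq_one_iff]
  exact Nat.eq_one_of_dvd_coprimes hco (orderOf_dvd_of_pow_eq_one e9)
    (orderOf_dvd_of_pow_eq_one hx)

lemma sq_add_one_pow_of_le [CharP B 3] (h : IsCurvePoint x y j) {n i a b : ℕ}
    (hn : Nat.Coprime 3 n) (hi : 3 ^ i ≡ 2 [MOD n]) (hab : a ≤ b)
    (hx : x ^ (3 ^ a * n) = 1) (hy : y ^ (3 ^ b * n) = 1) : (j ^ 2 + 1) ^ 3 ^ a = 0 := by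
  have : Fact (Nat.Prime 3) := ⟨Nat.prime_three⟩
  have hX : (x ^ 3 ^ a) ^ n = 1 := by rw [← pow_mul, hx]
  have hXb : x ^ 3 ^ b = 1 := by
    refine (h.pow_char_pow b).eq_one_of_pow_eq_one hn hi ?_ (by rw [← pow_mul, hy])
    obtain ⟨c, rfl⟩ := Nat.exists_eq_add_of_le hab
    rw [pow_add, pow_mul, pow_right_comm, hX, one_pow]
  have hXa : x ^ 3 ^ a = 1 := by
    have hXc : (x ^ 3 ^ a) ^ 3 ^ (b - a) = 1 := by
      rw [← pow_mul, ← pow_add, Nat.add_sub_cancel' hab, hXb]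
    rw [← orderOf_eq_one_iff]
    exact Nat.eq_one_of_dvd_coprimes (hn.pow_left (b - a)) (orderOf_dvd_of_pow_eq_one hXc)
      (orderOf_dvd_of_pow_eq_one hX)
  have hp := h.pow_char_pow a
  have hYa := hp.y_eq_one hXa
  have hs := hp.sq
  rw [hXa, hYa] at hs
  rw [add_pow_char_pow, one_pow, pow_right_comm, hs]
  ring

lemma sq_add_one_pow_min [Algebra (ZMod 3) B] (h : IsCurvePoint x y j) {n i a b : ℕ}
    (hn : Nat.Coprime 3 n) (hi : 3 ^ i ≡ 2 [MOD n])
    (hx : x ^ (3 ^ a * n) = 1) (hy : y ^ (3 ^ b * n) = 1) :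
    (j ^ 2 + 1) ^ 3 ^ min a b = 0 := by
  rcases subsingleton_or_nontrivial B with _ | _
  · exact Subsingleton.elim _ _
  have := charP_of_injective_algebraMap (algebraMap (ZMod 3) B).injective 3
  rcases le_total a b with hab | hab
  · rw [min_eq_left hab]
    exact h.sq_add_one_pow_of_le hn hi hab hx hy
  · rw [min_eq_right hab]
    simpa using h.swap.sq_add_one_pow_of_le hn hi hab hy hx

lemma mem_adjoin [Algebra (ZMod 3) B] (h : IsCurvePoint x y j) {N : ℕ}
    (hN : (j ^ 2 + 1) ^ N = 0) : x ∈ Algebra.adjoin (ZMod 3) {j} := by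
  have hco : IsCoprime (1 + Polynomial.X : Polynomial (ZMod 3))
      ((Polynomial.X ^ 2 + 1) ^ N) := by
    refine IsCoprime.pow_right ⟨Polynomial.X - 1, -1, ?_⟩
    have : (3 : Polynomial (ZMod 3)) = 0 := by
      exact_mod_cast CharP.cast_eq_zero (Polynomial (ZMod 3)) 3
    linear_combination -this
  obtain ⟨u, v, huv⟩ := hco
  have e := congrArg (Polynomial.aeval j) huv
  simp only [map_add, map_mul, map_one, map_pow, Polynomial.aeval_X, hN, mul_zero,
    add_zero] at e
  have hx : x = j * (1 - j) * Polynomial.aeval j u := by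
    have : x * (1 + j) = j * (1 - j) := by linear_combination h.mul_x + h.sq
    linear_combination Polynomial.aeval j u * this - x * e
  have hj : j ∈ Algebra.adjoin (ZMod 3) {j} := Algebra.self_mem_adjoin_singleton _ _
  rw [hx]
  exact mul_mem (mul_mem hj (sub_mem (one_mem _) hj))
    (Polynomial.aeval_mem_adjoin_singleton _ _)

lemma map_mem_adjoin [Algebra (ZMod 3) B] (f : Rthree →+* B)
    (h : IsCurvePoint (f (X 0)) (f (X 1)) j) {N : ℕ} (hN : (j ^ 2 + 1) ^ N = 0)
    (r : Rthree) : f r ∈ Algebra.adjoin (ZMod 3) {j} := by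
  have hneg : Algebra.adjoin (ZMod 3) {-j} ≤ Algebra.adjoin (ZMod 3) {j} :=
    Algebra.adjoin_le (Set.singleton_subset_iff.2
      (neg_mem (Algebra.self_mem_adjoin_singleton (ZMod 3) j)))
  induction r using MvPolynomial.induction_on with
  | C c =>
    rw [show f (C c) = algebraMap (ZMod 3) B c from
      RingHom.congr_fun (RingHom.ext_zmod (f.comp C) _) c]
    exact Subalgebra.algebraMap_mem _ c
  | add p q hp hq => rw [map_add]; exact add_mem hp hq
  | mul_X p i hp =>
    rw [map_mul]
    refine mul_mem hp ?_
    fin_cases i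
    · exact h.mem_adjoin hN
    · exact hneg (h.swap.mem_adjoin (by rwa [neg_sq]))

lemma x_pow_eq_one [CharP B 3] (h : IsCurvePoint x y j) {k : ℕ}
    (hj : (j ^ 2 + 1) ^ 3 ^ k = 0) : x ^ 3 ^ k = 1 := by
  have : Fact (Nat.Prime 3) := ⟨Nat.prime_three⟩
  have h3 : (3 : B) = 0 := by exact_mod_cast CharP.cast_eq_zero B 3
  have hp := h.pow_char_pow k
  rw [add_pow_char_pow, one_pow, pow_right_comm] at hj
  generalize x ^ 3 ^ k = X at *
  generalize y ^ 3 ^ k = Y at *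
  generalize j ^ 3 ^ k = J at *
  have e : (X - 1) * (1 + J) = 0 := by linear_combination hp.mul_x + hp.sq - hj
  linear_combination (J - 1) * e - (X - 1) * hj + (X - 1) * h3

lemma pow_eq_one [CharP B 3] (h : IsCurvePoint x y j) {k : ℕ}
    (hj : (j ^ 2 + 1) ^ 3 ^ k = 0) : x ^ 3 ^ k = 1 ∧ y ^ 3 ^ k = 1 :=
  ⟨h.x_pow_eq_one hj, h.swap.x_pow_eq_one (by simpa using hj)⟩

lemma exists_of_sq_add_one_pow [CharP B 3] {N : ℕ} (hj : (j ^ 2 + 1) ^ N = 0) :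
    ∃ x y : B, IsCurvePoint x y j := by
  have h3 : (3 : B) = 0 := by exact_mod_cast CharP.cast_eq_zero B 3
  have hu : IsUnit ((1 + j) * (1 - j)) := by
    have : (1 + j) * (1 - j) = -(1 + (j ^ 2 + 1)) := by linear_combination h3
    rw [this]
    exact (IsNilpotent.isUnit_one_add ⟨N, hj⟩).neg
  obtain ⟨u, hu'⟩ := isUnit_iff_exists_inv.1 hu
  refine ⟨j * (1 - j) ^ 2 * u, -(j * (1 + j) ^ 2 * u), ?_, ?_, ?_⟩
  · linear_combination -j ^ 2 * ((1 + j) * (1 - j) * u + 1) * hu'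
  · linear_combination (j ^ 2 * ((1 + j) * (1 - j) * u + 1) + j * (1 - j)) * hu'
  · linear_combination (-j ^ 2 * ((1 + j) * (1 - j) * u + 1) + j * (1 + j)) * hu'

end IsCurvePoint

lemma exists_three_pow_modEq_two (q m : ℕ) (hq : q.Prime) (hqodd : Odd q)
    (hprim : 1 ≤ m → Nat.Coprime 3 (q ^ m) ∧
      orderOf ((3 : ℕ) : ZMod (q ^ m)) = Nat.totient (q ^ m)) :
    Nat.Coprime 3 (q ^ m) ∧ ∃ i, 3 ^ i ≡ 2 [MOD q ^ m] := by
  rcases Nat.eq_zero_or_pos m with rfl | hm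
  · simp [Nat.modEq_one]
  obtain ⟨hco, hord⟩ := hprim hm
  refine ⟨hco, ?_⟩
  have : NeZero (q ^ m) := ⟨(pow_pos hq.pos m).ne'⟩
  have h2 : Nat.Coprime 2 (q ^ m) := (Nat.coprime_two_left.2 hqodd).pow_right m
  have hu : orderOf (ZMod.unitOfCoprime 3 hco) = Nat.card (ZMod (q ^ m))ˣ := by
    rw [← orderOf_units, ZMod.coe_unitOfCoprime, hord, Nat.card_eq_fintype_card,
      ZMod.card_units_eq_totient]
  have htop : Subgroup.zpowers (ZMod.unitOfCoprime 3 hco) = ⊤ := by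
    rw [← Subgroup.card_eq_iff_eq_top, Nat.card_zpowers, hu]
  obtain ⟨i, hi⟩ := (Submonoid.mem_powers_iff _ _).1
    (mem_powers_iff_mem_zpowers.2 (htop ▸ Subgroup.mem_top (ZMod.unitOfCoprime 2 h2)))
  refine ⟨i, (ZMod.natCast_eq_natCast_iff _ _ _).1 ?_⟩
  simpa using congrArg Units.val hi

/-- The operator on `R²` that becomes multiplication by the coordinate `j` of the
normalized curve on the quotient. -/
noncomputable def curveOperator : Rthree × Rthree →ₗ[Rthree] Rthree × Rthree :=
  (LinearMap.fst _ _ _ + LinearMap.snd _ _ _).prod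
    (-(1 + X 0 * X 1 : Rthree) • LinearMap.fst _ _ _ - LinearMap.snd _ _ _)

@[simp]
lemma curveOperator_apply (a b : Rthree) :
    curveOperator (a, b) = (a + b, -(1 + X 0 * X 1) * a - b) := by
  simp [curveOperator]

/-- The submodule of relations of the `B` code on an `Lx × Ly` torus. -/
noncomputable abbrev bcodeRelations (Lx Ly : ℕ) : Submodule Rthree (Rthree × Rthree) :=
  Submodule.span Rthree
    ({(X 0 - X 1, X 0 * X 1 - X 1), (1 - X 0, X 0 * X 1 - 1),
      (X 0 ^ Lx - 1, 0), (0, X 0 ^ Lx - 1),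
      (X 1 ^ Ly - 1, 0), (0, X 1 ^ Ly - 1)} : Set (Rthree × Rthree))

lemma rthree_three_eq_zero : (3 : Rthree) = 0 := by
  exact_mod_cast CharP.cast_eq_zero Rthree 3

lemma exists_adjoinRoot_ringHom {B : Type*} [CommRing B] [Algebra (ZMod 3) B] {j : B}
    {g : Polynomial (ZMod 3)} (hj : Polynomial.aeval j g = 0) :
    ∃ θ : AdjoinRoot g →+* B, ∀ s ∈ Algebra.adjoin (ZMod 3) {j}, ∃ c, θ c = s := by
  refine ⟨AdjoinRoot.lift (algebraMap (ZMod 3) B) j hj, fun s hs => ?_⟩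
  rw [Algebra.adjoin_singleton_eq_range_aeval] at hs
  obtain ⟨p, rfl⟩ := hs
  exact ⟨AdjoinRoot.mk g p, AdjoinRoot.lift_mk hj p⟩

section bcodeRelations

variable (Lx Ly : ℕ)

lemma bcodeRelations_mem_first :
    (X 0 - X 1, X 0 * X 1 - X 1) ∈ bcodeRelations Lx Ly :=
  Submodule.subset_span (by simp)

lemma bcodeRelations_mem_second :
    (1 - X 0, X 0 * X 1 - 1) ∈ bcodeRelations Lx Ly :=
  Submodule.subset_span (by simp)

lemma bcodeRelations_mem_x (a b : Rthree) :
    ((X 0 ^ Lx - 1) * a, (X 0 ^ Lx - 1) * b) ∈ bcodeRelations Lx Ly := by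
  have h1 : (X 0 ^ Lx - 1, 0) ∈ bcodeRelations Lx Ly := Submodule.subset_span (by simp)
  have h2 : (0, X 0 ^ Lx - 1) ∈ bcodeRelations Lx Ly := Submodule.subset_span (by simp)
  convert add_mem (Submodule.smul_mem _ a h1) (Submodule.smul_mem _ b h2) using 1
  simp [mul_comm]

lemma bcodeRelations_mem_y (a b : Rthree) :
    ((X 1 ^ Ly - 1) * a, (X 1 ^ Ly - 1) * b) ∈ bcodeRelations Lx Ly := by
  have h1 : (X 1 ^ Ly - 1, 0) ∈ bcodeRelations Lx Ly := Submodule.subset_span (by simp)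
  have h2 : (0, X 1 ^ Ly - 1) ∈ bcodeRelations Lx Ly := Submodule.subset_span (by simp)
  convert add_mem (Submodule.smul_mem _ a h1) (Submodule.smul_mem _ b h2) using 1
  simp [mul_comm]

lemma bcodeRelations_le_comap :
    bcodeRelations Lx Ly ≤ (bcodeRelations Lx Ly).comap curveOperator := by
  have h1 := bcodeRelations_mem_first Lx Ly
  have h2 := bcodeRelations_mem_second Lx Ly
  have h3 := rthree_three_eq_zero
  refine Submodule.span_le.2 ?_
  rintro _ (rfl | rfl | rfl | rfl | rfl | rfl) <;>
    simp only [SetLike.mem_coe, Submodule.mem_comap, curveOperator_apply]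
  · convert add_mem (Submodule.smul_mem _ (X 0) h1)
      (Submodule.smul_mem _ (X 0 + X 1) h2) using 1
    ext1
    · simp only [Prod.fst_add, Prod.smul_fst, smul_eq_mul]
      linear_combination (X 0 * X 1 - X 1) * h3
    · simp only [Prod.snd_add, Prod.smul_snd, smul_eq_mul]
      linear_combination (X 1 - X 0 ^ 2 * X 1) * h3
  · convert Submodule.smul_mem _ (-X 0) (add_mem h1 h2) using 1
    ext1
    · simp only [Prod.fst_add, Prod.smul_fst, smul_eq_mul]
      ring
    · simp only [Prod.snd_add, Prod.smul_snd, smul_eq_mul]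
      linear_combination (X 0 ^ 2 * X 1 - X 0 * X 1) * h3
  · convert bcodeRelations_mem_x Lx Ly 1 (-(1 + X 0 * X 1)) using 2 <;> ring
  · convert bcodeRelations_mem_x Lx Ly 1 (-1) using 2 <;> ring
  · convert bcodeRelations_mem_y Lx Ly 1 (-(1 + X 0 * X 1)) using 2 <;> ring
  · convert bcodeRelations_mem_y Lx Ly 1 (-1) using 2 <;> ring

/-- The operator induced by `curveOperator` on the quotient. -/
noncomputable def curveEnd : Module.End Rthree ((Rthree × Rthree) ⧸ bcodeRelations Lx Ly) :=
  Submodule.mapQ _ _ curveOperator (bcodeRelations_le_comap Lx Ly)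

@[simp]
lemma curveEnd_mk (a b : Rthree) :
    curveEnd Lx Ly (Submodule.Quotient.mk (a, b)) =
      Submodule.Quotient.mk (a + b, -(1 + X 0 * X 1) * a - b) := by
  simp [curveEnd]

open scoped IsMulCommutative

/-- The commutative ring of operators on the quotient generated by translations
and `curveEnd`. -/
noncomputable abbrev curveAlgebra := Algebra.adjoin Rthree {curveEnd Lx Ly}

/-- The operator `curveEnd` as an element of `curveAlgebra`. -/
noncomputable def curveCoord : curveAlgebra Lx Ly :=
  ⟨curveEnd Lx Ly, Algebra.self_mem_adjoin_singleton _ _⟩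

lemma curveAlgebra_ext {s t : curveAlgebra Lx Ly}
    (h : ∀ a b, s.1 (Submodule.Quotient.mk (a, b)) = t.1 (Submodule.Quotient.mk (a, b))) :
    s = t := by
  refine Subtype.ext (LinearMap.ext fun v => ?_)
  obtain ⟨⟨a, b⟩, rfl⟩ := Submodule.Quotient.mk_surjective _ v
  exact h a b

@[simp]
lemma curveAlgebra_algebraMap_mk (r a b : Rthree) :
    (algebraMap Rthree (curveAlgebra Lx Ly) r).1 (Submodule.Quotient.mk (a, b)) =
      Submodule.Quotient.mk (r * a, r * b) :=
  rfl

@[simp]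
lemma curveCoord_mk (a b : Rthree) :
    (curveCoord Lx Ly).1 (Submodule.Quotient.mk (a, b)) =
      Submodule.Quotient.mk (a + b, -(1 + X 0 * X 1) * a - b) :=
  curveEnd_mk Lx Ly a b

@[simp]
lemma curveAlgebra_mul_apply (s t : curveAlgebra Lx Ly)
    (v : (Rthree × Rthree) ⧸ bcodeRelations Lx Ly) : (s * t).1 v = s.1 (t.1 v) :=
  rfl

@[simp]
lemma curveAlgebra_add_apply (s t : curveAlgebra Lx Ly)
    (v : (Rthree × Rthree) ⧸ bcodeRelations Lx Ly) : (s + t).1 v = s.1 v + t.1 v :=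
  rfl

lemma curveCoord_sq :
    curveCoord Lx Ly ^ 2 + algebraMap Rthree (curveAlgebra Lx Ly) (X 0 * X 1) =
      algebraMap Rthree (curveAlgebra Lx Ly) 0 := by
  rw [sq]
  refine curveAlgebra_ext Lx Ly fun a b => ?_
  simp only [curveAlgebra_mul_apply, curveAlgebra_add_apply, curveCoord_mk,
    curveAlgebra_algebraMap_mk, ← Submodule.Quotient.mk_add, Prod.mk_add_mk]
  congr 2 <;> ring

lemma curveCoord_mul_X_zero :
    curveCoord Lx Ly * algebraMap Rthree (curveAlgebra Lx Ly) (X 0) +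
      algebraMap Rthree (curveAlgebra Lx Ly) (X 0) =
    algebraMap Rthree (curveAlgebra Lx Ly) (X 1 * X 0) + curveCoord Lx Ly := by
  refine curveAlgebra_ext Lx Ly fun a b => ?_
  simp only [curveAlgebra_mul_apply, curveAlgebra_add_apply, curveCoord_mk,
    curveAlgebra_algebraMap_mk, ← Submodule.Quotient.mk_add]
  rw [Submodule.Quotient.eq]
  convert add_mem (Submodule.smul_mem _ (X 0 * a) (bcodeRelations_mem_first Lx Ly))
    (Submodule.smul_mem _ (X 0 * a - a - b) (bcodeRelations_mem_second Lx Ly)) using 1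
  ext1
  · simp only [Prod.fst_add, Prod.smul_fst, Prod.fst_sub, smul_eq_mul]
    ring
  · simp only [Prod.snd_add, Prod.smul_snd, Prod.snd_sub, smul_eq_mul]
    linear_combination (X 0 * X 1 * a - X 0 ^ 2 * X 1 * a) * rthree_three_eq_zero

lemma curveCoord_mul_X_one :
    curveCoord Lx Ly * algebraMap Rthree (curveAlgebra Lx Ly) (X 1) +
      algebraMap Rthree (curveAlgebra Lx Ly) (X 0 * X 1) =
    algebraMap Rthree (curveAlgebra Lx Ly) (X 1) + curveCoord Lx Ly := by
  refine curveAlgebra_ext Lx Ly fun a b => ?_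
  simp only [curveAlgebra_mul_apply, curveAlgebra_add_apply, curveCoord_mk,
    curveAlgebra_algebraMap_mk, ← Submodule.Quotient.mk_add]
  rw [Submodule.Quotient.eq]
  convert add_mem (Submodule.smul_mem _ (-a - b) (bcodeRelations_mem_first Lx Ly))
    (Submodule.smul_mem _ (-a - b - X 1 * a) (bcodeRelations_mem_second Lx Ly)) using 1
  ext1
  · simp only [Prod.fst_add, Prod.smul_fst, Prod.fst_sub, smul_eq_mul]
    ring
  · simp only [Prod.snd_add, Prod.smul_snd, Prod.snd_sub, smul_eq_mul]
    linear_combination (X 0 * X 1 - X 1) * (a + b) * rthree_three_eq_zero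

lemma isCurvePoint_curveCoord :
    IsCurvePoint (algebraMap Rthree (curveAlgebra Lx Ly) (X 0))
      (algebraMap Rthree (curveAlgebra Lx Ly) (X 1)) (curveCoord Lx Ly) := by
  have h1 := curveCoord_sq Lx Ly
  have h2 := curveCoord_mul_X_zero Lx Ly
  have h3 := curveCoord_mul_X_one Lx Ly
  rw [map_mul] at h1 h2 h3
  rw [map_zero] at h1
  exact ⟨eq_neg_of_add_eq_zero_left h1, by linear_combination h2, by linear_combination h3⟩

lemma algebraMap_X_zero_pow :
    algebraMap Rthree (curveAlgebra Lx Ly) (X 0) ^ Lx = 1 := by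
  rw [← map_pow, ← map_one (algebraMap Rthree (curveAlgebra Lx Ly))]
  refine curveAlgebra_ext Lx Ly fun a b => ?_
  simp only [curveAlgebra_algebraMap_mk]
  rw [Submodule.Quotient.eq]
  convert bcodeRelations_mem_x Lx Ly a b using 1
  simp [sub_mul]

lemma algebraMap_X_one_pow :
    algebraMap Rthree (curveAlgebra Lx Ly) (X 1) ^ Ly = 1 := by
  rw [← map_pow, ← map_one (algebraMap Rthree (curveAlgebra Lx Ly))]
  refine curveAlgebra_ext Lx Ly fun a b => ?_
  simp only [curveAlgebra_algebraMap_mk]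
  rw [Submodule.Quotient.eq]
  convert bcodeRelations_mem_y Lx Ly a b using 1
  simp [sub_mul]

lemma exists_mem_adjoin_apply_eq {N : ℕ} (hN : (curveCoord Lx Ly ^ 2 + 1) ^ N = 0)
    (v : (Rthree × Rthree) ⧸ bcodeRelations Lx Ly) :
    ∃ s ∈ Algebra.adjoin (ZMod 3) {curveCoord Lx Ly},
      s.1 (Submodule.Quotient.mk (0, 1)) = v := by
  obtain ⟨⟨a, b⟩, rfl⟩ := Submodule.Quotient.mk_surjective _ v
  have hr := (isCurvePoint_curveCoord Lx Ly).map_mem_adjoin (algebraMap _ _) hN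
  have hj := Algebra.self_mem_adjoin_singleton (ZMod 3) (curveCoord Lx Ly)
  refine ⟨algebraMap _ _ a * curveCoord Lx Ly + algebraMap _ _ (a + b),
    add_mem (mul_mem (hr a) hj) (hr _), ?_⟩
  rw [Subalgebra.coe_add, LinearMap.add_apply, curveAlgebra_mul_apply, curveCoord_mk,
    curveAlgebra_algebraMap_mk, curveAlgebra_algebraMap_mk, ← Submodule.Quotient.mk_add]
  congr 1
  simp

lemma exists_surjective_of_sq_add_one_pow {N : ℕ}
    (hN : (curveCoord Lx Ly ^ 2 + 1) ^ N = 0) :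
    ∃ F : AdjoinRoot ((Polynomial.X ^ 2 + 1 : Polynomial (ZMod 3)) ^ N) →+
      (Rthree × Rthree) ⧸ bcodeRelations Lx Ly, Function.Surjective F := by
  obtain ⟨θ, hθ⟩ := exists_adjoinRoot_ringHom (j := curveCoord Lx Ly)
    (g := (Polynomial.X ^ 2 + 1) ^ N)
    (by rw [map_pow, map_add, map_pow, Polynomial.aeval_X, map_one, hN])
  let F : AdjoinRoot ((Polynomial.X ^ 2 + 1 : Polynomial (ZMod 3)) ^ N) →+
      (Rthree × Rthree) ⧸ bcodeRelations Lx Ly :=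
    { toFun := fun c => (θ c).1 (Submodule.Quotient.mk (0, 1))
      map_zero' := by rw [map_zero]; rfl
      map_add' := fun c d => by rw [map_add]; rfl }
  refine ⟨F, fun v => ?_⟩
  obtain ⟨s, hs, rfl⟩ := exists_mem_adjoin_apply_eq _ _ hN v
  obtain ⟨c, rfl⟩ := hθ s hs
  exact ⟨c, rfl⟩

/-- The semilinear map from `R²` to the coordinate ring of a curve point. -/
noncomputable def curveEval {C : Type*} [CommRing C] (f : Rthree →+* C) (j : C) :
    Rthree × Rthree →ₛₗ[f] C where
  toFun v := f v.1 * (1 + j) + f v.2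
  map_add' v w := by simp only [Prod.fst_add, Prod.snd_add, map_add]; ring
  map_smul' r v := by
    simp only [Prod.smul_fst, Prod.smul_snd, smul_eq_mul, map_mul]; ring

lemma bcodeRelations_le_ker {C : Type*} [CommRing C] [CharP C 3] {f : Rthree →+* C} {j : C}
    (h : IsCurvePoint (f (X 0)) (f (X 1)) j) (hx : f (X 0) ^ Lx = 1) (hy : f (X 1) ^ Ly = 1) :
    bcodeRelations Lx Ly ≤ LinearMap.ker (curveEval f j) := by
  have h3 : (3 : C) = 0 := by exact_mod_cast CharP.cast_eq_zero C 3
  refine Submodule.span_le.2 ?_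
  rintro _ (rfl | rfl | rfl | rfl | rfl | rfl) <;>
    simp only [curveEval, SetLike.mem_coe, LinearMap.mem_ker, LinearMap.coe_mk, AddHom.coe_mk,
      map_sub, map_mul, map_one, map_pow, map_zero, hx, hy, sub_self, zero_mul, add_zero]
  · linear_combination h.mul_x - h.mul_y + (f (X 0) * f (X 1) - f (X 1)) * h3
  · linear_combination -h.mul_x

end bcodeRelations

lemma curveEval_curveOperator {C : Type*} [CommRing C] {f : Rthree →+* C} {j : C}
    (h : IsCurvePoint (f (X 0)) (f (X 1)) j) (v : Rthree × Rthree) :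
    curveEval f j (curveOperator v) = j * curveEval f j v := by
  obtain ⟨a, b⟩ := v
  simp only [curveOperator_apply, curveEval, LinearMap.coe_mk, AddHom.coe_mk, map_add, map_sub,
    map_mul, map_neg, map_one]
  linear_combination -f a * h.sq

lemma curveEval_surjective {g : Polynomial (ZMod 3)} {f : Rthree →+* AdjoinRoot g}
    (h : IsCurvePoint (f (X 0)) (f (X 1)) (AdjoinRoot.root g)) :
    Function.Surjective (curveEval f (AdjoinRoot.root g)) := by
  intro c
  obtain ⟨p, rfl⟩ := AdjoinRoot.mk_surjective c
  induction p using Polynomial.induction_on with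
  | C c =>
    refine ⟨(0, C c), ?_⟩
    have hc : f (C c) = AdjoinRoot.of g c :=
      RingHom.congr_fun (RingHom.ext_zmod (f.comp C) (AdjoinRoot.of g)) c
    simp [curveEval, hc]
  | add p q hp hq =>
    obtain ⟨v, hv⟩ := hp
    obtain ⟨w, hw⟩ := hq
    exact ⟨v + w, by rw [map_add, map_add, hv, hw]⟩
  | monomial n c hp =>
    obtain ⟨v, hv⟩ := hp
    refine ⟨curveOperator v, ?_⟩
    rw [curveEval_curveOperator h, hv, pow_succ, ← AdjoinRoot.mk_X, ← map_mul]
    congr 1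
    ring

lemma finrank_adjoinRoot_sq_add_one_pow (N : ℕ) :
    Module.finrank (ZMod 3)
      (AdjoinRoot ((Polynomial.X ^ 2 + 1 : Polynomial (ZMod 3)) ^ N)) = 2 * N := by
  refine finrank_quotient_span_eq_natDegree.trans ?_
  rw [Polynomial.natDegree_pow, mul_comm]
  congr 1
  compute_degree!

lemma finrank_quotient_bcodeRelations {n i a b : ℕ} (hn : Nat.Coprime 3 n)
    (hi : 3 ^ i ≡ 2 [MOD n]) :
    Module.finrank (ZMod 3)
      ((Rthree × Rthree) ⧸ bcodeRelations (3 ^ a * n) (3 ^ b * n)) = 2 * 3 ^ min a b := by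
  have : Fact (Nat.Prime 3) := ⟨Nat.prime_three⟩
  set g : Polynomial (ZMod 3) := (Polynomial.X ^ 2 + 1) ^ 3 ^ min a b
  have hfin : Module.finrank (ZMod 3) (AdjoinRoot g) = 2 * 3 ^ min a b :=
    finrank_adjoinRoot_sq_add_one_pow _
  have hfinite : Module.Finite (ZMod 3) (AdjoinRoot g) :=
    Module.finite_of_finrank_pos (by rw [hfin]; positivity)
  have hnt : Nontrivial (AdjoinRoot g) :=
    Module.nontrivial_of_finrank_pos (R := ZMod 3) (by rw [hfin]; positivity)
  have hchar : CharP (AdjoinRoot g) 3 :=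
    charP_of_injective_algebraMap (algebraMap (ZMod 3) _).injective 3
  have hroot : (AdjoinRoot.root g ^ 2 + 1) ^ 3 ^ min a b = 0 := by
    rw [← AdjoinRoot.mk_X, ← map_pow, ← map_one (AdjoinRoot.mk g), ← map_add, ← map_pow]
    exact AdjoinRoot.mk_self
  have hcoord : (curveCoord (3 ^ a * n) (3 ^ b * n) ^ 2 + 1) ^ 3 ^ min a b = 0 :=
    (isCurvePoint_curveCoord _ _).sq_add_one_pow_min hn hi
      (algebraMap_X_zero_pow _ _) (algebraMap_X_one_pow _ _)
  obtain ⟨orbitMap, horbitMap⟩ := exists_surjective_of_sq_add_one_pow _ _ hcoord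
  obtain ⟨x, y, hxy⟩ := IsCurvePoint.exists_of_sq_add_one_pow hroot
  obtain ⟨hx, hy⟩ := hxy.pow_eq_one hroot
  let f : Rthree →+* AdjoinRoot g := (MvPolynomial.aeval ![x, y]).toRingHom
  have hfx : f (X 0) = x := by simp [f]
  have hfy : f (X 1) = y := by simp [f]
  have hf : IsCurvePoint (f (X 0)) (f (X 1)) (AdjoinRoot.root g) := by rwa [hfx, hfy]
  have hpow {z : AdjoinRoot g} {c : ℕ} (hc : min a b ≤ c) (hz : z ^ 3 ^ min a b = 1) :
      z ^ (3 ^ c * n) = 1 := by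
    obtain ⟨d, rfl⟩ := Nat.exists_eq_add_of_le hc
    rw [pow_add, mul_assoc, pow_mul, hz, one_pow]
  have hker := bcodeRelations_le_ker (3 ^ a * n) (3 ^ b * n) hf
    (by rw [hfx]; exact hpow (min_le_left a b) hx)
    (by rw [hfy]; exact hpow (min_le_right a b) hy)
  let evalMap := ((bcodeRelations (3 ^ a * n) (3 ^ b * n)).liftQ _ hker).toAddMonoidHom
  have horbit : Function.Surjective (orbitMap.toZModLinearMap 3) := horbitMap
  have heval : Function.Surjective (evalMap.toZModLinearMap 3) := fun c => by
    obtain ⟨v, rfl⟩ := curveEval_surjective hf c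
    exact ⟨Submodule.Quotient.mk v, rfl⟩
  have := Module.Finite.of_surjective _ horbit
  refine le_antisymm ?_ ?_
  · rw [← hfin]
    exact LinearMap.finrank_le_finrank_of_surjective horbit
  · rw [← hfin]
    exact LinearMap.finrank_le_finrank_of_surjective heval

/-- GSD of the `B` code obtained from entanglement renormalization of the square-lattice
`ℤ₃` Laplacian model: the quotient of the free module `R²` (with `R = (ZMod 3)[x,y]`) by the
submodule spanned by the six listed vectors has dimension `2 · 3^(min kx ky)`
over `ZMod 3`, where `Lx = 3^kx · q^m`, `Ly = 3^ky · q^m`, `q` is an odd prime, and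
`3` is a primitive root modulo `q^m` whenever `m ≥ 1`. -/
theorem Bcode_square_gsd_mod_three (q m : ℕ) (hq : q.Prime) (hqodd : Odd q)
    (hprim : 1 ≤ m → Nat.Coprime 3 (q ^ m) ∧
      orderOf ((3 : ℕ) : ZMod (q ^ m)) = Nat.totient (q ^ m))
    (kx ky : ℕ) :
    Module.finrank (ZMod 3)
      ((Rthree × Rthree) ⧸
        Submodule.span Rthree
          ({(X 0 - X 1, X 0 * X 1 - X 1), (1 - X 0, X 0 * X 1 - 1),
            (X 0 ^ (3 ^ kx * q ^ m) - 1, 0), (0, X 0 ^ (3 ^ kx * q ^ m) - 1),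
            (X 1 ^ (3 ^ ky * q ^ m) - 1, 0), (0, X 1 ^ (3 ^ ky * q ^ m) - 1)} :
            Set (Rthree × Rthree))) =
      2 * 3 ^ min kx ky := by
  obtain ⟨hn, i, hi⟩ := exists_three_pow_modEq_two q m hq hqodd hprim
  exact finrank_quotient_bcodeRelations hn hi
end

section
/- Let p be a prime with p > 3. The polynomial f(x,y) = x^2·y + x·y^2 + x^2 + y^2 + x + y − 6·x·y is irreducible in the polynomial ring (ZMod p)[x,y]. -/
open MvPolynomial

/-- A primitive quadratic polynomial over a domain whose discriminant is not a square is
irreducible. -/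
theorem irreducible_quadratic_of_not_isSquare_discrim {R : Type*} [CommRing R] [IsDomain R]
    {a b c : R} (ha : a ≠ 0) (hprim : ∀ r, r ∣ a → r ∣ b → r ∣ c → IsUnit r)
    (hdisc : ¬ IsSquare (discrim a b c)) :
    Irreducible (Polynomial.C a * Polynomial.X ^ 2 + Polynomial.C b * Polynomial.X
      + Polynomial.C c) := by
  have hdeg := Polynomial.natDegree_quadratic (b := b) (c := c) ha
  have hconst : ∀ g h : Polynomial R, Polynomial.C a * Polynomial.X ^ 2 +
      Polynomial.C b * Polynomial.X + Polynomial.C c = g * h → g.natDegree = 0 → IsUnit g := by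
    intro g h hgh hg
    rw [Polynomial.eq_C_of_natDegree_eq_zero hg] at hgh ⊢
    refine Polynomial.isUnit_C.2 (hprim _ ⟨h.coeff 2, ?_⟩ ⟨h.coeff 1, ?_⟩ ⟨h.coeff 0, ?_⟩)
    · simpa [Polynomial.coeff_X, Polynomial.coeff_C] using congrArg (Polynomial.coeff · 2) hgh
    · simpa [Polynomial.coeff_X, Polynomial.coeff_C] using congrArg (Polynomial.coeff · 1) hgh
    · simpa [Polynomial.coeff_X, Polynomial.coeff_C] using congrArg (Polynomial.coeff · 0) hgh
  refine ⟨fun hu => ?_, fun g h hgh => ?_⟩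
  · have := Polynomial.natDegree_eq_zero_of_isUnit hu
    omega
  · have hne : g * h ≠ 0 := by
      intro h0
      rw [hgh, h0] at hdeg
      simp at hdeg
    have hsum : g.natDegree + h.natDegree = 2 := by
      rw [← Polynomial.natDegree_mul (left_ne_zero_of_mul hne) (right_ne_zero_of_mul hne),
        ← hgh, hdeg]
    by_cases hg : g.natDegree = 0
    · exact Or.inl (hconst g h hgh hg)
    by_cases hh : h.natDegree = 0
    · exact Or.inr (hconst h g (hgh.trans (mul_comm g h)) hh)
    obtain ⟨u, v, rfl⟩ := Polynomial.exists_eq_X_add_C_of_natDegree_le_one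
      (show g.natDegree ≤ 1 by omega)
    obtain ⟨w, z, rfl⟩ := Polynomial.exists_eq_X_add_C_of_natDegree_le_one
      (show h.natDegree ≤ 1 by omega)
    have hexp : (Polynomial.C u * Polynomial.X + Polynomial.C v) *
        (Polynomial.C w * Polynomial.X + Polynomial.C z) =
        Polynomial.C (u * w) * Polynomial.X ^ 2 + Polynomial.C (u * z + v * w) * Polynomial.X
          + Polynomial.C (v * z) := by
      simp only [map_mul, map_add]
      ring
    rw [hexp] at hgh
    have h2 : a = u * w := by
      simpa [Polynomial.coeff_X, Polynomial.coeff_C, -map_mul] using congrArg (Polynomial.coeff · 2) hgh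
    have h1 : b = u * z + v * w := by
      simpa [Polynomial.coeff_X, Polynomial.coeff_C, -map_add, -map_mul]
        using congrArg (Polynomial.coeff · 1) hgh
    have h0 : c = v * z := by
      simpa [Polynomial.coeff_X, Polynomial.coeff_C] using congrArg (Polynomial.coeff · 0) hgh
    refine absurd ⟨u * z - v * w, ?_⟩ hdisc
    rw [discrim, h2, h1, h0]
    ring

/-- The discriminant of the triangular-lattice Laplacian polynomial, viewed as a quadratic in one
variable, is not a square in characteristic different from `2` and `3`. -/
theorem not_isSquare_sub_one_sq_mul {K : Type*} [Field K] (h2 : (2 : K) ≠ 0) (h3 : (3 : K) ≠ 0) :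
    ¬ IsSquare ((Polynomial.X - 1) ^ 2 * (Polynomial.X ^ 2 - 14 * Polynomial.X + 1) :
      Polynomial K) := by
  rintro ⟨d, hd⟩
  have hX : (Polynomial.X - 1 : Polynomial K) ≠ 0 := by
    simpa using Polynomial.X_sub_C_ne_zero (1 : K)
  obtain ⟨e, rfl⟩ : (Polynomial.X - 1 : Polynomial K) ∣ d := by
    have hprime : Prime (Polynomial.X - 1 : Polynomial K) := by
      simpa using Polynomial.prime_X_sub_C (1 : K)
    refine hprime.dvd_of_dvd_pow (n := 2) ?_
    rw [pow_two d, ← hd]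
    exact (dvd_pow_self _ two_ne_zero).mul_right _
  have he : Polynomial.X ^ 2 - 14 * Polynomial.X + 1 = e ^ 2 := by
    apply mul_left_cancel₀ (pow_ne_zero 2 hX)
    rw [hd]
    ring
  have hder : (2 * Polynomial.X - 14 : Polynomial K) = 2 * e * Polynomial.derivative e := by
    have := congrArg Polynomial.derivative he
    simpa [Polynomial.derivative_pow, ← Polynomial.C_ofNat] using this
  have hdvd : e ∣ Polynomial.C (192 : K) := by
    refine ⟨2 * Polynomial.derivative e * (2 * Polynomial.X - 14) - 4 * e, ?_⟩
    have h192 : Polynomial.C (192 : K) = 192 := Polynomial.C_ofNat _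
    rw [h192]
    linear_combination (2 * Polynomial.X - 14) * hder - 4 * he
  have h192 : IsUnit (Polynomial.C (192 : K)) := by
    refine (IsUnit.mk0 (192 : K) ?_).map Polynomial.C
    rw [show (192 : K) = 2 ^ 6 * 3 by norm_num]
    exact mul_ne_zero (pow_ne_zero 6 h2) h3
  have hunit := (isUnit_of_dvd_unit hdvd h192).pow 2
  rw [← he] at hunit
  have hcoeff := congrArg (Polynomial.coeff · 2)
    (Polynomial.eq_C_of_natDegree_eq_zero (Polynomial.natDegree_eq_zero_of_isUnit hunit))
  simp [← Polynomial.C_ofNat, Polynomial.coeff_X, Polynomial.coeff_one, Polynomial.coeff_C]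
    at hcoeff

/-- For a prime `p > 3`, the triangular-lattice Laplacian polynomial
`f(x,y) = x²y + xy² + x² + y² + x + y - 6xy` is irreducible in `(ZMod p)[x,y]`. -/
theorem triangular_laplacian_irreducible (p : ℕ) (hp : p.Prime) (hp3 : 3 < p) :
    Irreducible (X 0 ^ 2 * X 1 + X 0 * X 1 ^ 2 + X 0 ^ 2 + X 1 ^ 2 + X 0 + X 1
      - 6 * X 0 * X 1 : MvPolynomial (Fin 2) (ZMod p)) := by
  have : Fact p.Prime := ⟨hp⟩
  have h2 : (2 : ZMod p) ≠ 0 := by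
    intro h
    have := Nat.le_of_dvd two_pos ((ZMod.natCast_eq_zero_iff 2 p).1 (by exact_mod_cast h))
    omega
  have h3 : (3 : ZMod p) ≠ 0 := by
    intro h
    have := Nat.le_of_dvd three_pos ((ZMod.natCast_eq_zero_iff 3 p).1 (by exact_mod_cast h))
    omega
  let φ : MvPolynomial (Fin 1) (ZMod p) →ₐ[ZMod p] Polynomial (ZMod p) :=
    aeval fun _ => Polynomial.X
  rw [← MulEquiv.irreducible_iff (finSuccEquiv (ZMod p) 1)]
  have himage : finSuccEquiv (ZMod p) 1 (X 0 ^ 2 * X 1 + X 0 * X 1 ^ 2 + X 0 ^ 2 + X 1 ^ 2 + X 0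
      + X 1 - 6 * X 0 * X 1) = Polynomial.C (X 0 + 1) * Polynomial.X ^ 2
        + Polynomial.C (X 0 ^ 2 - 6 * X 0 + 1) * Polynomial.X + Polynomial.C (X 0 ^ 2 + X 0) := by
    have hX1 : finSuccEquiv (ZMod p) 1 (X 1) = Polynomial.C (X 0) :=
      finSuccEquiv_X_succ (j := 0)
    simp only [map_add, map_sub, map_mul, map_pow, map_ofNat, map_one, hX1, finSuccEquiv_X_zero]
    ring
  rw [himage]
  apply irreducible_quadratic_of_not_isSquare_discrim
  · intro h
    have := congrArg (Polynomial.coeff · 1) (congrArg φ h)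
    simp [φ, Polynomial.coeff_one] at this
  · intro r ha hb _
    have h8 : r ∣ C (8 : ZMod p) := by
      have h := dvd_sub hb (ha.mul_right (X 0 - 7))
      have e : (X 0 ^ 2 - 6 * X 0 + 1 - (X 0 + 1) * (X 0 - 7) : MvPolynomial (Fin 1) (ZMod p))
          = C (8 : ZMod p) := by
        rw [map_ofNat]
        ring
      rwa [e] at h
    refine isUnit_of_dvd_unit h8 ((IsUnit.mk0 (8 : ZMod p) ?_).map C)
    rw [show (8 : ZMod p) = 2 ^ 3 by norm_num]
    exact pow_ne_zero 3 h2
  · intro h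
    apply not_isSquare_sub_one_sq_mul h2 h3
    have hdisc : φ (discrim (X 0 + 1) (X 0 ^ 2 - 6 * X 0 + 1) (X 0 ^ 2 + X 0)) =
        (Polynomial.X - 1) ^ 2 * (Polynomial.X ^ 2 - 14 * Polynomial.X + 1) := by
      simp only [discrim, φ, map_add, map_sub, map_mul, map_pow, map_ofNat, map_one, aeval_X]
      ring
    rw [← hdisc]
    exact h.map φ
end

section
/- In the polynomial ring (ZMod 3)[x,y], for all nonnegative integers a, b, c, d with (a,b) ≠ (c,d), the polynomial 1 + x + y does not divide x^a·y^b − x^c·y^d. -/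
open MvPolynomial

/-- The monomials in `T` and `-(1 + T)` over a field are pairwise distinct: the trailing degree
recovers the first exponent, and the degree recovers the sum of the two exponents. -/
lemma Polynomial.X_pow_mul_neg_one_add_X_pow_inj {K : Type*} [Field K] {a b c d : ℕ}
    (h : (Polynomial.X : Polynomial K) ^ a * (-(1 + Polynomial.X)) ^ b =
      Polynomial.X ^ c * (-(1 + Polynomial.X)) ^ d) : a = c ∧ b = d := by
  have hdeg : (-(1 + Polynomial.X) : Polynomial K).natDegree = 1 := by
    rw [Polynomial.natDegree_neg, add_comm]
    exact Polynomial.natDegree_X_add_C (1 : K)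
  have hne : (-(1 + Polynomial.X) : Polynomial K) ≠ 0 :=
    Polynomial.ne_zero_of_natDegree_gt (n := 0) (by omega)
  have htrail (n : ℕ) : ((-(1 + Polynomial.X) : Polynomial K) ^ n).natTrailingDegree = 0 :=
    Polynomial.natTrailingDegree_eq_zero.2
      (Or.inr (by simp [Polynomial.coeff_zero_eq_eval_zero]))
  have htrail_monomial (m n : ℕ) :
      ((Polynomial.X : Polynomial K) ^ m * (-(1 + Polynomial.X)) ^ n).natTrailingDegree = m := by
    rw [mul_comm, Polynomial.natTrailingDegree_mul_X_pow (pow_ne_zero _ hne), htrail, zero_add]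
  have hdeg_monomial (m n : ℕ) :
      ((Polynomial.X : Polynomial K) ^ m * (-(1 + Polynomial.X)) ^ n).natDegree = m + n := by
    rw [Polynomial.natDegree_mul (pow_ne_zero _ Polynomial.X_ne_zero) (pow_ne_zero _ hne),
      Polynomial.natDegree_pow, Polynomial.natDegree_pow, hdeg, Polynomial.natDegree_X]
    simp
  have h₁ := congrArg Polynomial.natTrailingDegree h
  have h₂ := congrArg Polynomial.natDegree h
  rw [htrail_monomial, htrail_monomial] at h₁
  rw [hdeg_monomial, hdeg_monomial] at h₂
  omega

/-- In `(ZMod 3)[x,y]`, for nonnegative integers `a, b, c, d` with `(a,b) ≠ (c,d)`, the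
polynomial `1 + x + y` does not divide `x^a·y^b - x^c·y^d`. -/
theorem fractal_spin_liquid_lineon_immobile (a b c d : ℕ) (h : (a, b) ≠ (c, d)) :
    ¬ ((1 + X 0 + X 1 : MvPolynomial (Fin 2) (ZMod 3)) ∣
        X 0 ^ a * X 1 ^ b - X 0 ^ c * X 1 ^ d) := by
  intro hdvd
  have himage := map_dvd
    (aeval (R := ZMod 3) ![Polynomial.X, (-(1 + Polynomial.X) : Polynomial (ZMod 3))]) hdvd
  simp only [map_add, map_sub, map_mul, map_pow, map_one, aeval_X, Matrix.cons_val_zero,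
    Matrix.cons_val_one, add_neg_cancel, zero_dvd_iff, sub_eq_zero] at himage
  obtain ⟨rfl, rfl⟩ := Polynomial.X_pow_mul_neg_one_add_X_pow_inj himage
  exact h rfl
end

section
/- Let p be an odd prime. In the polynomial ring (ZMod p)[x,y], for all nonnegative integers a, b, c, d with (a,b) ≠ (c,d), the polynomial f(x,y) = x^2·y + x·y^2 + x^2 + y^2 + x + y − 6·x·y does not divide x^a·y^b − x^c·y^d. -/
section LeadingCoefficient

open Polynomial

variable {K : Type*} [Field K]

/-- The Laplacian polynomial, as a polynomial in `y` over `K[x]`, has leading coefficient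
`x + 1`. -/
lemma laplacian_leadingCoeff :
    (C X ^ 2 * X + C X * X ^ 2 + C X ^ 2 + X ^ 2 + C X + X - 6 * C X * X
      : K[X][X]).leadingCoeff = X + 1 := by
  have hne : (X + 1 : K[X]) ≠ 0 := by simpa using Polynomial.X_add_C_ne_zero (1 : K)
  have hquad : (C X ^ 2 * X + C X * X ^ 2 + C X ^ 2 + X ^ 2 + C X + X - 6 * C X * X : K[X][X])
      = C (X + 1) * X ^ 2 + C (X ^ 2 + 1 - 6 * X) * X + C (X ^ 2 + X) := by
    have hsix : (C 6 : K[X][X]) = 6 := rfl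
    simp only [map_add, map_sub, map_mul, map_pow, map_one, hsix]
    ring
  rw [hquad, leadingCoeff_quadratic hne]

/-- A power of `x` is not divisible by `x + 1`. -/
lemma not_X_add_one_dvd_X_pow (n : ℕ) : ¬ ((X + 1 : K[X]) ∣ X ^ n) := by
  rintro ⟨g, hg⟩
  simpa using congrArg (Polynomial.eval (-1)) hg

lemma leadingCoeff_monomial_sub_monomial {a b c d : ℕ} (hlt : d < b) :
    (C (X ^ a) * X ^ b - C (X ^ c) * X ^ d : K[X][X]).leadingCoeff = X ^ a := by
  rw [leadingCoeff_sub_of_degree_lt, leadingCoeff_C_mul_X_pow]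
  rw [degree_C_mul_X_pow _ (pow_ne_zero _ X_ne_zero),
    degree_C_mul_X_pow _ (pow_ne_zero _ X_ne_zero)]
  exact_mod_cast hlt

/-- The Laplacian polynomial does not divide a difference of two monomials of different degrees
in `y`. -/
lemma laplacian_not_dvd_monomial_sub_monomial {a b c d : ℕ} (hbd : b ≠ d) :
    ¬ ((C X ^ 2 * X + C X * X ^ 2 + C X ^ 2 + X ^ 2 + C X + X - 6 * C X * X : K[X][X]) ∣
      C (X ^ a) * X ^ b - C (X ^ c) * X ^ d) := by
  intro hdvd
  wlog hlt : d < b generalizing a b c d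
  · exact this hbd.symm ((dvd_sub_comm).mp hdvd) (by omega)
  have hlead := leadingCoeff_dvd_leadingCoeff hdvd
  rw [laplacian_leadingCoeff, leadingCoeff_monomial_sub_monomial hlt] at hlead
  exact not_X_add_one_dvd_X_pow a hlead

end LeadingCoefficient

open MvPolynomial

/-- For an odd prime `p`, in `(ZMod p)[x,y]`, for nonnegative integers `a, b, c, d` with
`(a,b) ≠ (c,d)`, the triangular-lattice Laplacian polynomial
`f = x²y + xy² + x² + y² + x + y - 6xy` does not divide `x^a·y^b - x^c·y^d`. -/
theorem triangular_laplacian_lineon_immobile (p : ℕ) (hp : p.Prime) (hpodd : Odd p)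
    (a b c d : ℕ) (h : (a, b) ≠ (c, d)) :
    ¬ ((X 0 ^ 2 * X 1 + X 0 * X 1 ^ 2 + X 0 ^ 2 + X 1 ^ 2 + X 0 + X 1
        - 6 * X 0 * X 1 : MvPolynomial (Fin 2) (ZMod p)) ∣
        X 0 ^ a * X 1 ^ b - X 0 ^ c * X 1 ^ d) := by
  have : Fact p.Prime := ⟨hp⟩
  intro hdvd
  by_cases hbd : b = d
  · have hac : a ≠ c := fun hac => h (by rw [hac, hbd])
    apply laplacian_not_dvd_monomial_sub_monomial (K := ZMod p) (a := b) (c := d) hac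
    have hmap := map_dvd (aeval (R := ZMod p)
      ![(Polynomial.X : Polynomial (Polynomial (ZMod p))), Polynomial.C Polynomial.X]) hdvd
    simp only [map_add, map_sub, map_mul, map_pow, map_ofNat, aeval_X, Matrix.cons_val_zero,
      Matrix.cons_val_one] at hmap ⊢
    convert hmap using 1 <;> ring
  · apply laplacian_not_dvd_monomial_sub_monomial (K := ZMod p) (a := a) (c := c) hbd
    have hmap := map_dvd (aeval (R := ZMod p)
      ![(Polynomial.C Polynomial.X : Polynomial (Polynomial (ZMod p))), Polynomial.X]) hdvd
    simpa only [map_add, map_sub, map_mul, map_pow, map_ofNat, aeval_X, Matrix.cons_val_zero,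
      Matrix.cons_val_one] using hmap
end

section
/- Let N ≥ 1 be an integer and let h : ℤ × ℤ → ZMod N be a function with finite support satisfying, for every (i,j) ∈ ℤ × ℤ, the discrete harmonicity condition 6·h(i,j) = h(i+1,j) + h(i−1,j) + h(i,j+1) + h(i,j−1) + h(i+1,j−1) + h(i−1,j+1) in ZMod N. Then h is identically zero. -/
/-- On the infinite triangular lattice (vertices `ℤ × ℤ`, neighbors of `(i,j)` being
`(i±1,j)`, `(i,j±1)`, `(i+1,j-1)`, `(i-1,j+1)`), any finitely supported `ZMod N`-valued
discrete harmonic function vanishes identically. -/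
theorem triangular_no_finite_harmonic (N : ℕ) (hN : 1 ≤ N)
    (h : ℤ × ℤ → ZMod N) (hfin : (Function.support h).Finite)
    (hharm : ∀ i j : ℤ,
      6 * h (i, j) =
        h (i + 1, j) + h (i - 1, j) + h (i, j + 1) + h (i, j - 1)
          + h (i + 1, j - 1) + h (i - 1, j + 1)) :
    h = 0 := by
  by_contra hne
  -- At the lexicographically largest point `(a, b)` of the support, harmonicity at `(a + 1, b)`
  -- involves no other point of the support.
  obtain ⟨⟨a, b⟩, hab, hmax⟩ :=
    Set.exists_max_image _ toLex hfin (Function.support_nonempty_iff.mpr hne)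
  have hzero : ∀ i j : ℤ, a < i ∨ a = i ∧ b < j → h (i, j) = 0 := by
    intro i j hij
    by_contra hij0
    exact (hmax (i, j) hij0).not_gt (Prod.Lex.toLex_lt_toLex.mpr hij)
  have key := hharm (a + 1) b
  rw [hzero (a + 1) b (by lia), hzero (a + 1 + 1) b (by lia), hzero (a + 1) (b + 1) (by lia),
    hzero (a + 1) (b - 1) (by lia), hzero (a + 1 + 1) (b - 1) (by lia),
    hzero (a + 1 - 1) (b + 1) (by lia)] at key
  exact hab (by simpa using key.symm)
end

section
/- Let N ≥ 1 be an integer and let hA, hB : ℤ × ℤ → ZMod N be functions, both with finite support, satisfying for every (i,j) ∈ ℤ × ℤ: 3·hA(i,j) = hB(i,j) + hB(i−1,j) + hB(i,j−1) and 3·hB(i,j) = hA(i,j) + hA(i+1,j) + hA(i,j+1) in ZMod N. Then hA and hB are identically zero. -/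
/-- A finitely supported function on `ℤ × ℤ` vanishes if its value at each point is forced to be
zero as soon as it is zero at all lexicographically smaller points. -/
theorem eq_zero_of_finite_support_of_lex {R : Type*} [Zero R] {f : ℤ × ℤ → R}
    (hfin : (Function.support f).Finite)
    (hstep : ∀ i j : ℤ, (∀ k l : ℤ, k < i ∨ k = i ∧ l < j → f (k, l) = 0) → f (i, j) = 0) :
    f = 0 := by
  by_contra hne
  obtain ⟨⟨i, j⟩, hp, hmin⟩ :=
    Set.exists_min_image (Function.support f) toLex hfin (Function.support_nonempty_iff.mpr hne)
  refine hp (hstep i j fun k l hkl => ?_)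
  by_contra hq
  exact (hmin (k, l) hq).not_gt (Prod.Lex.toLex_lt_toLex.mpr hkl)

/-- On the infinite honeycomb lattice (two sublattices `A`, `B` indexed by `ℤ × ℤ`, the
neighbors of the `A`-site `(i,j)` being the `B`-sites `(i,j)`, `(i-1,j)`, `(i,j-1)`, and
the neighbors of the `B`-site `(i,j)` being the `A`-sites `(i,j)`, `(i+1,j)`, `(i,j+1)`),
any finitely supported `ZMod N`-valued discrete harmonic pair vanishes identically. -/
theorem honeycomb_no_finite_harmonic (N : ℕ) (hN : 1 ≤ N)
    (hA hB : ℤ × ℤ → ZMod N)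
    (hfinA : (Function.support hA).Finite) (hfinB : (Function.support hB).Finite)
    (hharmA : ∀ i j : ℤ, 3 * hA (i, j) = hB (i, j) + hB (i - 1, j) + hB (i, j - 1))
    (hharmB : ∀ i j : ℤ, 3 * hB (i, j) = hA (i, j) + hA (i + 1, j) + hA (i, j + 1)) :
    hA = 0 ∧ hB = 0 := by
  have hA0 : hA = 0 := by
    refine eq_zero_of_finite_support_of_lex hfinA fun i j hz => ?_
    have e₀ := hharmA (i - 1) j
    have e₁ := hharmB (i - 1) j
    have e₂ := hharmB (i - 1 - 1) j
    have e₃ := hharmB (i - 1) (j - 1)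
    simp only [sub_add_cancel] at e₁ e₂ e₃
    have z₁ := hz (i - 1) j (by lia)
    have z₂ := hz (i - 1) (j + 1) (by lia)
    have z₃ := hz (i - 1 - 1) j (by lia)
    have z₄ := hz (i - 1 - 1) (j + 1) (by lia)
    have z₅ := hz (i - 1) (j - 1) (by lia)
    have z₆ := hz i (j - 1) (by lia)
    linear_combination 6 * z₁ - z₂ - z₃ - z₄ - z₅ - z₆ - 3 * e₀ - e₁ - e₂ - e₃
  refine ⟨hA0, eq_zero_of_finite_support_of_lex hfinB fun i j hz => ?_⟩
  have e := hharmA i j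
  rw [hz (i - 1) j (by lia), hz i (j - 1) (by lia), hA0] at e
  simpa using e.symm
end
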